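/- Let G be a connected affine algebraic group over ℂ and A_s a torus with trivial G-action. Then the map D : Ext_alg(G, A_s) → Ext(𝔤, 𝔞_s) sending an extension of algebraic groups to its associated Lie algebra extension is the zero map, and the sequence Hom(G̃, A_s) → Hom(Π_G, A_s) → Ext_alg(G, A_s) → 0 is exact, where the first map is restriction of algebraic group homomorphisms and the second map Φ sends γ ∈ Hom(Π_G, A_s) to the pushout extension γ_*G̃ = (A_s × G̃)/Γ(γ) of G by A_s, Γ(γ) being the graph of γ. -/

import Mathlib

noncomputable section

open MvPolynomial

/-- Points of affine `n`-space over `ℂ`. -/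
abbrev Pt (n : ℕ) : Type := Fin n → ℂ

/-- A subset of `ℂ^n` is an (affine) algebraic set if it is the common zero
locus of a set of polynomials. -/
def IsAlgebraicSet {n : ℕ} (V : Set (Pt n)) : Prop :=
  ∃ S : Set (MvPolynomial (Fin n) ℂ), V = {x : Pt n | ∀ p ∈ S, eval x p = 0}

/-- A map `ℂ^n → ℂ^m` is regular (polynomial) on a subset `V ⊆ ℂ^n`. -/
def IsRegularOn {n m : ℕ} (V : Set (Pt n)) (f : Pt n → Pt m) : Prop :=
  ∃ P : Fin m → MvPolynomial (Fin n) ℂ, ∀ x ∈ V, ∀ i, f x i = eval x (P i)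

def Pt.left {n m : ℕ} (z : Pt (n + m)) : Pt n := fun i => z (Fin.castAdd m i)
def Pt.right {n m : ℕ} (z : Pt (n + m)) : Pt m := fun i => z (Fin.natAdd n i)

/-- An affine algebraic group over `ℂ`, realized as an algebraic subset of some
`ℂ^n`, with polynomial multiplication and inversion. -/
structure AffAlgGroup : Type where
  n : ℕ
  carrier : Set (Pt n)
  isAlgebraic : IsAlgebraicSet carrier
  one : Pt n
  one_mem : one ∈ carrier
  mul : Pt n → Pt n → Pt n
  inv : Pt n → Pt n
  mul_mem : ∀ {x y : Pt n}, x ∈ carrier → y ∈ carrier → mul x y ∈ carrier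
  inv_mem : ∀ {x : Pt n}, x ∈ carrier → inv x ∈ carrier
  mul_assoc' : ∀ {x y z : Pt n}, x ∈ carrier → y ∈ carrier → z ∈ carrier →
    mul (mul x y) z = mul x (mul y z)
  one_mul' : ∀ {x : Pt n}, x ∈ carrier → mul one x = x
  mul_one' : ∀ {x : Pt n}, x ∈ carrier → mul x one = x
  inv_mul' : ∀ {x : Pt n}, x ∈ carrier → mul (inv x) x = one
  mul_regular : IsRegularOn
    {z : Pt (n + n) | Pt.left z ∈ carrier ∧ Pt.right z ∈ carrier}
    (fun z => mul (Pt.left z) (Pt.right z))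
  inv_regular : IsRegularOn carrier inv

namespace AffAlgGroup

/-- The group of `ℂ`-points of `G`, as a bundled group. -/
def Gp (G : AffAlgGroup) : Type := {x : Pt G.n // x ∈ G.carrier}

instance (G : AffAlgGroup) : Group G.Gp where
  mul x y := ⟨G.mul x.1 y.1, G.mul_mem x.2 y.2⟩
  one := ⟨G.one, G.one_mem⟩
  inv x := ⟨G.inv x.1, G.inv_mem x.2⟩
  mul_assoc a b c := Subtype.ext (G.mul_assoc' a.2 b.2 c.2)
  one_mul a := Subtype.ext (G.one_mul' a.2)
  mul_one a := Subtype.ext (G.mul_one' a.2)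
  inv_mul_cancel a := Subtype.ext (G.inv_mul' a.2)

/-- The Euclidean (classical) topology on the points of `G`. -/
instance (G : AffAlgGroup) : TopologicalSpace G.Gp :=
  instTopologicalSpaceSubtype

/-- Connectedness of an affine algebraic group: the carrier cannot be divided
into two disjoint relatively (Zariski-)closed pieces. -/
def IsConnected (G : AffAlgGroup) : Prop :=
  ∀ V W : Set (Pt G.n), IsAlgebraicSet V → IsAlgebraicSet W →
    G.carrier ⊆ V ∪ W → G.carrier ∩ (V ∩ W) = ∅ →
    G.carrier ⊆ V ∨ G.carrier ⊆ W

def IsAbelianGrp (G : AffAlgGroup) : Prop :=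
  ∀ x ∈ G.carrier, ∀ y ∈ G.carrier, G.mul x y = G.mul y x

/-- `G` is a torus: it is isomorphic, as an algebraic group, to `(ℂ*)^k`;
the isomorphism and its inverse are required to be given by (Laurent)
polynomials. -/
def IsTorus (G : AffAlgGroup) : Prop :=
  ∃ (k : ℕ) (φ : (Fin k → ℂˣ) → Pt G.n),
    (∀ u, φ u ∈ G.carrier) ∧
    Function.Injective φ ∧
    (∀ x ∈ G.carrier, ∃ u, φ u = x) ∧
    φ (fun _ => 1) = G.one ∧
    (∀ u v, φ (u * v) = G.mul (φ u) (φ v)) ∧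
    (∀ i : Fin G.n, ∃ P : MvPolynomial (Fin k ⊕ Fin k) ℂ,
      ∀ u, φ u i = eval (Sum.elim (fun j => (u j : ℂ)) (fun j => ((u j)⁻¹ : ℂˣ))) P) ∧
    (∀ j : Fin k, ∃ Q : MvPolynomial (Fin G.n) ℂ, ∀ u, (u j : ℂ) = eval (φ u) Q)

end AffAlgGroup

/-- matrix entry access for a point of `ℂ^{m·m}` viewed as an `m × m` matrix -/
def matEntry {m : ℕ} (x : Pt (m * m)) (i j : Fin m) : ℂ := x (finProdFinEquiv (i, j))

/-- matrix multiplication on points of `ℂ^{m·m}` -/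
def matMulPt (m : ℕ) (x y : Pt (m * m)) : Pt (m * m) :=
  fun idx => ∑ k : Fin m,
    matEntry x (finProdFinEquiv.symm idx).1 k * matEntry y k (finProdFinEquiv.symm idx).2

/-- the identity matrix as a point of `ℂ^{m·m}` -/
def idMatPt (m : ℕ) : Pt (m * m) :=
  fun idx => if (finProdFinEquiv.symm idx).1 = (finProdFinEquiv.symm idx).2 then 1 else 0

/-- an upper triangular matrix with `1`'s on the diagonal -/
def IsUnitriangular (m : ℕ) (x : Pt (m * m)) : Prop :=
  (∀ i : Fin m, matEntry x i i = 1) ∧ (∀ i j : Fin m, j < i → matEntry x i j = 0)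

/-- `G` is unipotent: it admits a faithful polynomial representation by
upper triangular unipotent matrices. -/
def AffAlgGroup.IsUnipotent (G : AffAlgGroup) : Prop :=
  ∃ (m : ℕ) (φ : Pt G.n → Pt (m * m)),
    IsRegularOn G.carrier φ ∧
    Set.InjOn φ G.carrier ∧
    (∀ x ∈ G.carrier, IsUnitriangular m (φ x)) ∧
    (∀ x ∈ G.carrier, ∀ y ∈ G.carrier, φ (G.mul x y) = matMulPt m (φ x) (φ y))

/-- A homomorphism of affine algebraic groups: a polynomial map which is
multiplicative on points. -/
structure AlgGroupHom (G H : AffAlgGroup) : Type where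
  toFun : Pt G.n → Pt H.n
  maps_to : ∀ {x : Pt G.n}, x ∈ G.carrier → toFun x ∈ H.carrier
  map_mul : ∀ {x y : Pt G.n}, x ∈ G.carrier → y ∈ G.carrier →
    toFun (G.mul x y) = H.mul (toFun x) (toFun y)
  regular : IsRegularOn G.carrier toFun

/-- An algebraic action of `G` on `A` by group automorphisms. -/
structure AlgAction (G A : AffAlgGroup) : Type where
  act : Pt G.n → Pt A.n → Pt A.n
  maps_to : ∀ {g : Pt G.n} {a : Pt A.n}, g ∈ G.carrier → a ∈ A.carrier →
    act g a ∈ A.carrier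
  act_one : ∀ {a : Pt A.n}, a ∈ A.carrier → act G.one a = a
  act_mul : ∀ {g h : Pt G.n} {a : Pt A.n}, g ∈ G.carrier → h ∈ G.carrier →
    a ∈ A.carrier → act (G.mul g h) a = act g (act h a)
  act_map_mul : ∀ {g : Pt G.n} {a b : Pt A.n}, g ∈ G.carrier → a ∈ A.carrier →
    b ∈ A.carrier → act g (A.mul a b) = A.mul (act g a) (act g b)
  act_bij : ∀ {g : Pt G.n}, g ∈ G.carrier → ∀ a ∈ A.carrier, ∃ b ∈ A.carrier, act g b = a
  regular : IsRegularOn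
    {z : Pt (G.n + A.n) | Pt.left z ∈ G.carrier ∧ Pt.right z ∈ A.carrier}
    (fun z => act (Pt.left z) (Pt.right z))

/-- the trivial action of `G` on `A` -/
def AlgAction.IsTrivial {G A : AffAlgGroup} (ρ : AlgAction G A) : Prop :=
  ∀ g ∈ G.carrier, ∀ a ∈ A.carrier, ρ.act g a = a

/-- An extension `1 → A → E → G → 1` of affine algebraic groups inducing
(via conjugation in `E`) the action `ρ` of `G` on `A`. -/
structure AlgExtension (G A : AffAlgGroup) (ρ : AlgAction G A) : Type where
  E : AffAlgGroup
  i : AlgGroupHom A E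
  q : AlgGroupHom E G
  i_inj : Set.InjOn i.toFun A.carrier
  q_surj : ∀ g ∈ G.carrier, ∃ x ∈ E.carrier, q.toFun x = g
  exact : ∀ x ∈ E.carrier, (q.toFun x = G.one ↔ ∃ a ∈ A.carrier, i.toFun a = x)
  conj_compat : ∀ x ∈ E.carrier, ∀ a ∈ A.carrier,
    E.mul x (E.mul (i.toFun a) (E.inv x)) = i.toFun (ρ.act (q.toFun x) a)

namespace AlgExtension

variable {G A : AffAlgGroup} {ρ : AlgAction G A}

/-- An extension splits if the quotient map admits an algebraic group
theoretic section. -/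
def Splits (e : AlgExtension G A ρ) : Prop :=
  ∃ σ : AlgGroupHom G e.E, ∀ g ∈ G.carrier, e.q.toFun (σ.toFun g) = g

/-- Equivalence of extensions (via a morphism over `G` and under `A`;
such a morphism is automatically an isomorphism). -/
def Equiv (e₁ e₂ : AlgExtension G A ρ) : Prop :=
  ∃ f : AlgGroupHom e₁.E e₂.E,
    (∀ a ∈ A.carrier, f.toFun (e₁.i.toFun a) = e₂.i.toFun a) ∧
    (∀ x ∈ e₁.E.carrier, e₂.q.toFun (f.toFun x) = e₁.q.toFun x)

/-- `e₃` is a Baer sum of `e₁` and `e₂`: there is a regular map from the fiber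
product `E₁ ×_G E₂` to `E₃` which is multiplicative, lies over `G` and
restricts to the multiplication `A × A → A` on the kernels.  (This
characterizes the Baer sum up to equivalence.) -/
def IsBaerSum (e₁ e₂ e₃ : AlgExtension G A ρ) : Prop :=
  ∃ h : Pt (e₁.E.n + e₂.E.n) → Pt e₃.E.n,
    IsRegularOn {z : Pt (e₁.E.n + e₂.E.n) | Pt.left z ∈ e₁.E.carrier ∧
      Pt.right z ∈ e₂.E.carrier ∧ e₁.q.toFun (Pt.left z) = e₂.q.toFun (Pt.right z)} h ∧
    (∀ x ∈ e₁.E.carrier, ∀ y ∈ e₂.E.carrier, e₁.q.toFun x = e₂.q.toFun y →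
      h (Fin.append x y) ∈ e₃.E.carrier) ∧
    (∀ x x' y y', x ∈ e₁.E.carrier → x' ∈ e₁.E.carrier → y ∈ e₂.E.carrier →
      y' ∈ e₂.E.carrier → e₁.q.toFun x = e₂.q.toFun y → e₁.q.toFun x' = e₂.q.toFun y' →
      h (Fin.append (e₁.E.mul x x') (e₂.E.mul y y')) =
        e₃.E.mul (h (Fin.append x y)) (h (Fin.append x' y'))) ∧
    (∀ x ∈ e₁.E.carrier, ∀ y ∈ e₂.E.carrier, e₁.q.toFun x = e₂.q.toFun y →
      e₃.q.toFun (h (Fin.append x y)) = e₁.q.toFun x) ∧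
    (∀ a ∈ A.carrier, ∀ b ∈ A.carrier,
      h (Fin.append (e₁.i.toFun a) (e₂.i.toFun b)) = e₃.i.toFun (A.mul a b))

end AlgExtension

/-- A realization of the abelian group `Ext_alg(G, A)` of equivalence classes
of extensions of `G` by `A` (inducing the action `ρ`), with addition given by
the Baer sum, and zero element the class of split extensions. -/
structure IsExtGroup (G A : AffAlgGroup) (ρ : AlgAction G A)
    (Ext : Type) [AddCommGroup Ext] : Prop where
  exists_cls : ∃ cls : AlgExtension G A ρ → Ext,
    Function.Surjective cls ∧
    (∀ e₁ e₂, cls e₁ = cls e₂ ↔ Relation.EqvGen AlgExtension.Equiv e₁ e₂) ∧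
    (∀ e, cls e = 0 ↔ e.Splits) ∧
    (∀ e₁ e₂ e₃, AlgExtension.IsBaerSum e₁ e₂ e₃ → cls e₁ + cls e₂ = cls e₃)

/-- The class map itself, when we need to name it. -/
structure ExtClassMap (G A : AffAlgGroup) (ρ : AlgAction G A)
    (Ext : Type) [AddCommGroup Ext] : Type where
  cls : AlgExtension G A ρ → Ext
  surj : Function.Surjective cls
  cls_eq_iff : ∀ e₁ e₂, cls e₁ = cls e₂ ↔ Relation.EqvGen AlgExtension.Equiv e₁ e₂
  cls_eq_zero_iff : ∀ e, cls e = 0 ↔ e.Splits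
  cls_baer : ∀ e₁ e₂ e₃, AlgExtension.IsBaerSum e₁ e₂ e₃ → cls e₁ + cls e₂ = cls e₃

/-- An algebraic subgroup of `G`. -/
structure AlgSubgroup (G : AffAlgGroup) : Type where
  carrier : Set (Pt G.n)
  subset : carrier ⊆ G.carrier
  isAlgebraic : IsAlgebraicSet carrier
  one_mem : G.one ∈ carrier
  mul_mem : ∀ {x y : Pt G.n}, x ∈ carrier → y ∈ carrier → G.mul x y ∈ carrier
  inv_mem : ∀ {x : Pt G.n}, x ∈ carrier → G.inv x ∈ carrier

namespace AlgSubgroup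

variable {G : AffAlgGroup}

/-- An algebraic subgroup is itself an affine algebraic group. -/
def toGrp (H : AlgSubgroup G) : AffAlgGroup where
  n := G.n
  carrier := H.carrier
  isAlgebraic := H.isAlgebraic
  one := G.one
  one_mem := H.one_mem
  mul := G.mul
  inv := G.inv
  mul_mem := H.mul_mem
  inv_mem := H.inv_mem
  mul_assoc' hx hy hz := G.mul_assoc' (H.subset hx) (H.subset hy) (H.subset hz)
  one_mul' hx := G.one_mul' (H.subset hx)
  mul_one' hx := G.mul_one' (H.subset hx)
  inv_mul' hx := G.inv_mul' (H.subset hx)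
  mul_regular := by
    obtain ⟨P, hP⟩ := G.mul_regular
    exact ⟨P, fun z hz => hP z ⟨H.subset hz.1, H.subset hz.2⟩⟩
  inv_regular := by
    obtain ⟨P, hP⟩ := G.inv_regular
    exact ⟨P, fun x hx => hP x (H.subset hx)⟩

def IsNormal (H : AlgSubgroup G) : Prop :=
  ∀ g ∈ G.carrier, ∀ x ∈ H.carrier, G.mul g (G.mul x (G.inv g)) ∈ H.carrier

/-- `H` is the unipotent radical of `G`: the largest connected normal
unipotent algebraic subgroup. -/
def IsUnipotentRadical (H : AlgSubgroup G) : Prop :=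
  H.IsNormal ∧ H.toGrp.IsConnected ∧ H.toGrp.IsUnipotent ∧
    ∀ K : AlgSubgroup G, K.IsNormal → K.toGrp.IsConnected → K.toGrp.IsUnipotent →
      K.carrier ⊆ H.carrier

/-- `G` is reductive: its unipotent radical is trivial. -/
def _root_.AffAlgGroup.IsReductive (G : AffAlgGroup) : Prop :=
  ∀ K : AlgSubgroup G, K.IsNormal → K.toGrp.IsConnected → K.toGrp.IsUnipotent →
    K.carrier = {G.one}

end AlgSubgroup

/-- A Levi decomposition `G = G_u ⋊ G_red` of `G`:  `Gu` is the unipotent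
radical and `L` is a connected reductive algebraic subgroup with
`Gu ∩ L = 1` and `Gu · L = G`. -/
structure LeviDecomposition (G : AffAlgGroup) : Type where
  Gu : AlgSubgroup G
  L : AlgSubgroup G
  Gu_radical : Gu.IsUnipotentRadical
  L_connected : L.toGrp.IsConnected
  L_reductive : L.toGrp.IsReductive
  inter : Gu.carrier ∩ L.carrier = {G.one}
  decomp : ∀ x ∈ G.carrier, ∃ u ∈ Gu.carrier, ∃ l ∈ L.carrier, x = G.mul u l

/-- The group homomorphism on point groups induced by a morphism of algebraic
groups. -/
def AlgGroupHom.toGpHom {G H : AffAlgGroup} (f : AlgGroupHom G H) : G.Gp →* H.Gp :=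
  MonoidHom.mk' (fun x => ⟨f.toFun x.1, f.maps_to x.2⟩)
    (fun a b => Subtype.ext (f.map_mul a.2 b.2))

/-- The subgroup of the point group underlying an algebraic subgroup. -/
def AlgSubgroup.toSubgroup {G : AffAlgGroup} (H : AlgSubgroup G) : Subgroup G.Gp where
  carrier := {x : G.Gp | x.1 ∈ H.carrier}
  one_mem' := H.one_mem
  mul_mem' := fun ha hb => H.mul_mem ha hb
  inv_mem' := fun ha => H.inv_mem ha

/-- Iterated product (powers) in an algebraic group. -/
def AffAlgGroup.pow (G : AffAlgGroup) (x : Pt G.n) : ℕ → Pt G.n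
  | 0 => G.one
  | k + 1 => G.mul x (G.pow x k)

/-- The inclusion homomorphism of an algebraic subgroup. -/
def AlgSubgroup.incl {A : AffAlgGroup} (H : AlgSubgroup A) : H.toGrp.Gp →* A.Gp :=
  MonoidHom.mk' (fun x => ⟨x.1, H.subset x.2⟩) (fun _ _ => rfl)
/-! ### Tangent spaces and Lie algebras -/

/-- The (Zariski) tangent space at `x₀` of a subset `V ⊆ ℂ^n`: the directions
annihilated by the differentials at `x₀` of all polynomials vanishing on `V`. -/
def tangentAt {n : ℕ} (V : Set (Pt n)) (x₀ : Pt n) : Submodule ℂ (Pt n) where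
  carrier := {v | ∀ p : MvPolynomial (Fin n) ℂ, (∀ x ∈ V, eval x p = 0) →
    ∑ j, v j * eval x₀ (pderiv j p) = 0}
  zero_mem' := by intro p hp; simp
  add_mem' := by
    intro a b ha hb p hp
    simp only [Pi.add_apply, add_mul, Finset.sum_add_distrib, ha p hp, hb p hp, add_zero]
  smul_mem' := by
    intro t a ha p hp
    simp only [Pi.smul_apply, smul_eq_mul, mul_assoc, ← Finset.mul_sum, ha p hp, mul_zero]

/-- A family of polynomials representing the commutator map
`(x, y) ↦ x y x⁻¹ y⁻¹` of `G` on `G × G`. -/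
def IsCommutatorRep (G : AffAlgGroup) (F : Fin G.n → MvPolynomial (Fin (G.n + G.n)) ℂ) : Prop :=
  ∀ x ∈ G.carrier, ∀ y ∈ G.carrier, ∀ i,
    G.mul (G.mul x y) (G.mul (G.inv x) (G.inv y)) i = eval (Fin.append x y) (F i)

/-- `𝔤` (an abstract complex Lie algebra) is the Lie algebra of `G`, via the
linear identification `e` of `𝔤` with the tangent space of `G` at the
identity; the Lie bracket corresponds to the mixed second-order term at the
identity of the commutator map of `G`. -/
structure IsLieAlgebraOf (G : AffAlgGroup) (𝔤 : Type) [LieRing 𝔤] [LieAlgebra ℂ 𝔤]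
    (e : 𝔤 →ₗ[ℂ] Pt G.n) : Prop where
  inj : Function.Injective e
  range_eq : ∀ v : Pt G.n, (∃ u : 𝔤, e u = v) ↔ v ∈ tangentAt G.carrier G.one
  bracket_eq : ∀ F, IsCommutatorRep G F → ∀ u v : 𝔤, ∀ i : Fin G.n,
    e ⁅u, v⁆ i = ∑ j, ∑ k, e u j * e v k *
      eval (Fin.append G.one G.one)
        (pderiv (Fin.castAdd G.n j) (pderiv (Fin.natAdd G.n k) (F i)))

/-- The Lie subalgebra `𝔥 ⊆ 𝔤` corresponds to the algebraic subgroup `H ⊆ G`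
(under the identification `e` of `𝔤` with the tangent space of `G` at `1`). -/
def IsLieSubalgebraOf {G : AffAlgGroup} (H : AlgSubgroup G) {𝔤 : Type} [LieRing 𝔤]
    [LieAlgebra ℂ 𝔤] (e : 𝔤 →ₗ[ℂ] Pt G.n) (𝔥 : LieSubalgebra ℂ 𝔤) : Prop :=
  ∀ u : 𝔤, u ∈ 𝔥 ↔ e u ∈ tangentAt H.carrier G.one

/-! ### The relative Chevalley–Eilenberg complex of a pair `(𝔤, 𝔥)` -/

section CE
set_option linter.unusedSectionVars false

variable {𝔤 : Type} [LieRing 𝔤] [LieAlgebra ℂ 𝔤]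
variable {M : Type} [AddCommGroup M] [Module ℂ M] [LieRingModule 𝔤 M]

/-- `c` is an alternating `p`-multilinear map `𝔤^p → M`. -/
def IsMultilinearAlt (p : ℕ) (c : (Fin p → 𝔤) → M) : Prop :=
  (∀ (v : Fin p → 𝔤) (i : Fin p) (x y : 𝔤),
    c (Function.update v i (x + y)) = c (Function.update v i x) + c (Function.update v i y)) ∧
  (∀ (v : Fin p → 𝔤) (i : Fin p) (t : ℂ) (x : 𝔤),
    c (Function.update v i (t • x)) = t • c (Function.update v i x)) ∧
  (∀ (v : Fin p → 𝔤) (i j : Fin p), i ≠ j → v i = v j → c v = 0)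

/-- The Chevalley–Eilenberg differential (in the form valid on alternating
cochains). -/
def ceD (p : ℕ) (c : (Fin p → 𝔤) → M) : (Fin (p + 1) → 𝔤) → M := fun v =>
  (∑ i : Fin (p + 1), ((-1 : ℤ) ^ (i : ℕ)) • ⁅v i, c (fun k => v (i.succAbove k))⁆) +
  ∑ i : Fin (p + 1), ∑ j : Fin (p + 1),
    if h : i < j then
      ((-1 : ℤ) ^ ((i : ℕ) + 1)) •
        c (Function.update (fun k => v (i.succAbove k))
            (j.pred (Fin.pos_iff_ne_zero.mp (lt_of_le_of_lt (Fin.zero_le i) h)))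
            ⁅v i, v j⁆)
    else 0

lemma ceD_zero (p : ℕ) : ceD (M := M) (𝔤 := 𝔤) p 0 = 0 := by
  funext v
  simp [ceD]

lemma ceD_add (p : ℕ) (c c' : (Fin p → 𝔤) → M) :
    ceD p (c + c') = ceD p c + ceD p c' := by
  funext v
  simp only [ceD, Pi.add_apply]
  have e1 : (∑ i : Fin (p + 1), ((-1 : ℤ) ^ (i : ℕ)) •
      ⁅v i, c (fun k => v (i.succAbove k)) + c' (fun k => v (i.succAbove k))⁆)
      = (∑ i : Fin (p + 1), ((-1 : ℤ) ^ (i : ℕ)) • ⁅v i, c (fun k => v (i.succAbove k))⁆)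
      + ∑ i : Fin (p + 1), ((-1 : ℤ) ^ (i : ℕ)) • ⁅v i, c' (fun k => v (i.succAbove k))⁆ := by
    rw [← Finset.sum_add_distrib]
    exact Finset.sum_congr rfl fun i _ => by rw [lie_add, smul_add]
  rw [e1]
  have e2 : ∀ i j : Fin (p + 1),
      (if h : i < j then ((-1 : ℤ) ^ ((i : ℕ) + 1)) •
        ((c (Function.update (fun k => v (i.succAbove k))
            (j.pred (Fin.pos_iff_ne_zero.mp (lt_of_le_of_lt (Fin.zero_le i) h))) ⁅v i, v j⁆))
         + (c' (Function.update (fun k => v (i.succAbove k))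
            (j.pred (Fin.pos_iff_ne_zero.mp (lt_of_le_of_lt (Fin.zero_le i) h))) ⁅v i, v j⁆)))
       else 0)
      = (if h : i < j then ((-1 : ℤ) ^ ((i : ℕ) + 1)) •
          (c (Function.update (fun k => v (i.succAbove k))
            (j.pred (Fin.pos_iff_ne_zero.mp (lt_of_le_of_lt (Fin.zero_le i) h))) ⁅v i, v j⁆))
         else 0)
      + (if h : i < j then ((-1 : ℤ) ^ ((i : ℕ) + 1)) •
          (c' (Function.update (fun k => v (i.succAbove k))
            (j.pred (Fin.pos_iff_ne_zero.mp (lt_of_le_of_lt (Fin.zero_le i) h))) ⁅v i, v j⁆))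
         else 0) := by
    intro i j
    by_cases h : i < j <;> simp [h, smul_add]
  simp only [e2, Finset.sum_add_distrib]
  try abel

lemma ceD_neg (p : ℕ) (c : (Fin p → 𝔤) → M) : ceD p (-c) = -(ceD p c) := by
  have h := ceD_add p c (-c)
  simp only [add_neg_cancel, ceD_zero] at h
  rw [eq_comm, neg_eq_iff_add_eq_zero, eq_comm, ← h]
  try rfl

/-- `c` is a relative `p`-cochain for the pair `(𝔤, 𝔥)`: alternating
multilinear, vanishing when one argument lies in `𝔥`, and `𝔥`-equivariant. -/
def IsRelCochain (𝔥 : LieSubalgebra ℂ 𝔤) (p : ℕ) (c : (Fin p → 𝔤) → M) : Prop :=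
  IsMultilinearAlt p c ∧
  (∀ v : Fin p → 𝔤, (∃ i, v i ∈ 𝔥) → c v = 0) ∧
  (∀ x : 𝔤, x ∈ 𝔥 → ∀ v : Fin p → 𝔤,
    ⁅x, c v⁆ = ∑ i, c (Function.update v i ⁅x, v i⁆))

lemma isRelCochain_zero (𝔥 : LieSubalgebra ℂ 𝔤) (p : ℕ) :
    IsRelCochain (M := M) 𝔥 p 0 := by
  refine ⟨⟨?_, ?_, ?_⟩, ?_, ?_⟩ <;> intros <;> simp

lemma isRelCochain_add (𝔥 : LieSubalgebra ℂ 𝔤) (p : ℕ) {c c' : (Fin p → 𝔤) → M}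
    (h : IsRelCochain 𝔥 p c) (h' : IsRelCochain 𝔥 p c') :
    IsRelCochain 𝔥 p (c + c') := by
  obtain ⟨⟨hm, hs, ha⟩, hv, he⟩ := h
  obtain ⟨⟨hm', hs', ha'⟩, hv', he'⟩ := h'
  refine ⟨⟨?_, ?_, ?_⟩, ?_, ?_⟩
  · intro v i x y
    simp only [Pi.add_apply, hm, hm']
    abel
  · intro v i t x
    simp only [Pi.add_apply, hs, hs', smul_add]
  · intro v i j hij hvv
    simp only [Pi.add_apply, ha v i j hij hvv, ha' v i j hij hvv, add_zero]
  · intro v hv₀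
    simp only [Pi.add_apply, hv v hv₀, hv' v hv₀, add_zero]
  · intro x hx v
    simp only [Pi.add_apply, lie_add, he x hx v, he' x hx v, Finset.sum_add_distrib]

lemma isRelCochain_neg (𝔥 : LieSubalgebra ℂ 𝔤) (p : ℕ) {c : (Fin p → 𝔤) → M}
    (h : IsRelCochain 𝔥 p c) : IsRelCochain 𝔥 p (-c) := by
  obtain ⟨⟨hm, hs, ha⟩, hv, he⟩ := h
  refine ⟨⟨?_, ?_, ?_⟩, ?_, ?_⟩
  · intro v i x y
    simp only [Pi.neg_apply, hm]
    abel
  · intro v i t x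
    simp only [Pi.neg_apply, hs, smul_neg]
  · intro v i j hij hvv
    simp only [Pi.neg_apply, ha v i j hij hvv, neg_zero]
  · intro v hv₀
    simp only [Pi.neg_apply, hv v hv₀, neg_zero]
  · intro x hx v
    simp only [Pi.neg_apply, lie_neg, he x hx v, Finset.sum_neg_distrib]

/-- The group of relative `p`-cocycles of the pair `(𝔤, 𝔥)` with values in `M`. -/
def relZ (𝔥 : LieSubalgebra ℂ 𝔤) (M : Type) [AddCommGroup M] [Module ℂ M]
    [LieRingModule 𝔤 M] (p : ℕ) : AddSubgroup ((Fin p → 𝔤) → M) where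
  carrier := {c | IsRelCochain 𝔥 p c ∧ ∀ v, ceD p c v = 0}
  zero_mem' := ⟨isRelCochain_zero 𝔥 p, fun v => by rw [ceD_zero]; rfl⟩
  add_mem' := by
    rintro c c' ⟨hc, hcz⟩ ⟨hc', hcz'⟩
    refine ⟨isRelCochain_add 𝔥 p hc hc', fun v => ?_⟩
    rw [ceD_add]
    simp [hcz v, hcz' v]
  neg_mem' := by
    rintro c ⟨hc, hcz⟩
    refine ⟨isRelCochain_neg 𝔥 p hc, fun v => ?_⟩
    rw [ceD_neg]
    simp [hcz v]

/-- The group of relative `(p+1)`-coboundaries of the pair `(𝔤, 𝔥)`. -/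
def relB (𝔥 : LieSubalgebra ℂ 𝔤) (M : Type) [AddCommGroup M] [Module ℂ M]
    [LieRingModule 𝔤 M] (p : ℕ) : AddSubgroup ((Fin (p + 1) → 𝔤) → M) where
  carrier := {c | ∃ f : (Fin p → 𝔤) → M, IsRelCochain 𝔥 p f ∧ c = ceD p f}
  zero_mem' := ⟨0, isRelCochain_zero 𝔥 p, (ceD_zero p).symm⟩
  add_mem' := by
    rintro c c' ⟨f, hf, rfl⟩ ⟨f', hf', rfl⟩
    exact ⟨f + f', isRelCochain_add 𝔥 p hf hf', (ceD_add p f f').symm⟩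
  neg_mem' := by
    rintro c ⟨f, hf, rfl⟩
    exact ⟨-f, isRelCochain_neg 𝔥 p hf, (ceD_neg p f).symm⟩

/-- The relative Lie algebra cohomology `H^p(𝔤, 𝔥, M)` of the pair `(𝔤, 𝔥)`
with coefficients in the `𝔤`-module `M`. -/
def relH (𝔥 : LieSubalgebra ℂ 𝔤) (M : Type) [AddCommGroup M] [Module ℂ M]
    [LieRingModule 𝔤 M] : ℕ → Type
  | 0 => ↥(relZ 𝔥 M 0)
  | (p + 1) => ↥(relZ 𝔥 M (p + 1)) ⧸ ((relB 𝔥 M p).addSubgroupOf (relZ 𝔥 M (p + 1)))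

instance relH.instAddCommGroup (𝔥 : LieSubalgebra ℂ 𝔤) (M : Type) [AddCommGroup M]
    [Module ℂ M] [LieRingModule 𝔤 M] (p : ℕ) : AddCommGroup (relH 𝔥 M p) :=
  match p with
  | 0 => inferInstanceAs (AddCommGroup ↥(relZ 𝔥 M 0))
  | (p + 1) => inferInstanceAs
      (AddCommGroup (↥(relZ 𝔥 M (p + 1)) ⧸ ((relB 𝔥 M p).addSubgroupOf (relZ 𝔥 M (p + 1)))))

/-- The class in `H^{p+1}(𝔤, 𝔥, M)` of a relative cocycle. -/
def relHClass (𝔥 : LieSubalgebra ℂ 𝔤) (M : Type) [AddCommGroup M] [Module ℂ M]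
    [LieRingModule 𝔤 M] (p : ℕ) (c : ↥(relZ 𝔥 M (p + 1))) : relH 𝔥 M (p + 1) :=
  QuotientAddGroup.mk c

end CE

/-- `df` is the differential at the identity of the morphism `f` of algebraic
groups: for any polynomial representative of `f`, `df` is given on tangent
vectors by the derivative at the identity. -/
def IsDerivAtOne {G H : AffAlgGroup} (f : AlgGroupHom G H)
    (df : Pt G.n →ₗ[ℂ] Pt H.n) : Prop :=
  ∀ P : Fin H.n → MvPolynomial (Fin G.n) ℂ,
    (∀ x ∈ G.carrier, ∀ i, f.toFun x i = eval x (P i)) →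
    ∀ v ∈ tangentAt G.carrier G.one, ∀ i,
      df v i = ∑ j, v j * eval G.one (pderiv j (P i))

/-! ### The canonical covering `G̃ = G_u ⋊ (Z × G̃'_red) → G` -/

/-- Data of the canonical algebraic covering `q_G : G̃ → G` attached to a Levi
decomposition `G = G_u ⋊ L`: here `Z` is the identity component of the center
of `L` (the maximal connected central algebraic subgroup), `Lder = [L, L]` is
the derived group of `L`, and `G̃ = G_u ⋊ (Z × G̃'_red)`, where `G̃'_red` is the
universal (simply connected) algebraic covering group of `Lder`. -/
structure CoveringData (G : AffAlgGroup) (LD : LeviDecomposition G) : Type where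
  /-- the identity component of the center of the Levi subgroup `L` -/
  Z : AlgSubgroup G
  Z_sub : Z.carrier ⊆ LD.L.carrier
  Z_central : ∀ z ∈ Z.carrier, ∀ l ∈ LD.L.carrier, G.mul z l = G.mul l z
  Z_connected : Z.toGrp.IsConnected
  Z_max : ∀ K : AlgSubgroup G, K.carrier ⊆ LD.L.carrier →
    (∀ z ∈ K.carrier, ∀ l ∈ LD.L.carrier, G.mul z l = G.mul l z) →
    K.toGrp.IsConnected → K.carrier ⊆ Z.carrier
  /-- the derived group `[L, L]` of the Levi subgroup -/
  Lder : AlgSubgroup G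
  Lder_sub : Lder.carrier ⊆ LD.L.carrier
  Lder_comm : ∀ x ∈ LD.L.carrier, ∀ y ∈ LD.L.carrier,
    G.mul x (G.mul y (G.mul (G.inv x) (G.inv y))) ∈ Lder.carrier
  Lder_min : ∀ K : AlgSubgroup G,
    (∀ x ∈ LD.L.carrier, ∀ y ∈ LD.L.carrier,
      G.mul x (G.mul y (G.mul (G.inv x) (G.inv y))) ∈ K.carrier) →
    Lder.carrier ⊆ K.carrier
  /-- the covering group `G̃` and the covering morphism -/
  Gt : AffAlgGroup
  qG : AlgGroupHom Gt G
  qG_surj : ∀ g ∈ G.carrier, ∃ x ∈ Gt.carrier, qG.toFun x = g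
  /-- the three factors of `G̃ = G_u ⋊ (Z × G̃'_red)` -/
  Gu' : AlgSubgroup Gt
  Zc : AlgSubgroup Gt
  Gs : AlgSubgroup Gt
  Gu'_normal : Gu'.IsNormal
  Zc_Gs_comm : ∀ z ∈ Zc.carrier, ∀ s ∈ Gs.carrier, Gt.mul z s = Gt.mul s z
  Zc_Gs_inter : Zc.carrier ∩ Gs.carrier = {Gt.one}
  decomp : ∀ x ∈ Gt.carrier, ∃ u ∈ Gu'.carrier, ∃ z ∈ Zc.carrier, ∃ s ∈ Gs.carrier,
    x = Gt.mul u (Gt.mul z s)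
  levi_inter : {x | x ∈ Gu'.carrier ∧
      ∃ z ∈ Zc.carrier, ∃ s ∈ Gs.carrier, x = Gt.mul z s} = {Gt.one}
  /-- `q_G` restricts to an isomorphism `G_u' ≅ G_u` -/
  qG_Gu'_inj : Set.InjOn qG.toFun Gu'.carrier
  qG_Gu'_img : qG.toFun '' Gu'.carrier = LD.Gu.carrier
  /-- `q_G` restricts to an isomorphism `Z_c ≅ Z` -/
  qG_Zc_inj : Set.InjOn qG.toFun Zc.carrier
  qG_Zc_img : qG.toFun '' Zc.carrier = Z.carrier
  /-- `q_G` maps `G̃'_red` onto `[L, L]`, and `G̃'_red` is connected and simply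
  connected: it is the universal algebraic covering group of `[L, L]` -/
  qG_Gs_img : qG.toFun '' Gs.carrier = Lder.carrier
  Gs_connected : Gs.toGrp.IsConnected
  Gs_simplyConnected : ∀ γ : FundamentalGroup Gs.toGrp.Gp ⟨Gt.one, Gs.one_mem⟩, γ = 1
  /-- the kernel `Π_G` of the covering is finite and central -/
  ker_finite : {x ∈ Gt.carrier | qG.toFun x = G.one}.Finite
  ker_central : ∀ x ∈ Gt.carrier, qG.toFun x = G.one →
    ∀ y ∈ Gt.carrier, Gt.mul x y = Gt.mul y x

namespace CoveringData

variable {G : AffAlgGroup} {LD : LeviDecomposition G}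

/-- The kernel `Π_G` of the covering `q_G : G̃ → G`, as a subgroup of the point
group of `G̃`. -/
def PiG (CD : CoveringData G LD) : Subgroup CD.Gt.Gp := CD.qG.toGpHom.ker

/-- The fundamental group `π₁(G'_red)` of the derived group of the Levi
subgroup, realized as the kernel of `G̃'_red → G'_red`, a subgroup of `Π_G`. -/
def pi1Gs (CD : CoveringData G LD) : Subgroup CD.Gt.Gp where
  carrier := {x : CD.Gt.Gp | x.1 ∈ CD.Gs.carrier ∧ x ∈ CD.PiG}
  one_mem' := ⟨CD.Gs.one_mem, one_mem CD.PiG⟩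
  mul_mem' := fun hx hy => ⟨CD.Gs.mul_mem hx.1 hy.1, mul_mem hx.2 hy.2⟩
  inv_mem' := fun hx => ⟨CD.Gs.inv_mem hx.1, inv_mem hx.2⟩

lemma pi1Gs_le_PiG (CD : CoveringData G LD) : CD.pi1Gs ≤ CD.PiG := fun _ hx => hx.2

/-- `ext` is (equivalent to) the pushout extension `γ_* G̃ = (A × G̃)/Γ(γ)` of
`G` by `A` along `γ : Π_G → A`:  this is characterized by the existence of a
morphism `h : G̃ → E` over `G` restricting to `γ` on `Π_G`. -/
def IsPushoutOf (CD : CoveringData G LD) {A : AffAlgGroup} {ρ : AlgAction G A}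
    (γ : ↥CD.PiG →* A.Gp) (ext : AlgExtension G A ρ) : Prop :=
  ∃ h : AlgGroupHom CD.Gt ext.E,
    (∀ x ∈ CD.Gt.carrier, ext.q.toFun (h.toFun x) = CD.qG.toFun x) ∧
    (∀ x : ↥CD.PiG, h.toFun x.1.1 = ext.i.toFun (γ x).1)

end CoveringData

namespace AlgGrp

/-! ### Commutative algebra over `ℂ` -/

lemma exists_algHom_complex (B : Type*) [CommRing B] [Algebra ℂ B] [Algebra.FiniteType ℂ B]
    [Nontrivial B] : Nonempty (B →ₐ[ℂ] ℂ) := by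
  obtain ⟨m, hm⟩ := Ideal.exists_maximal B
  let : Field (B ⧸ m) := Ideal.Quotient.field m
  have : Algebra.FiniteType ℂ (B ⧸ m) :=
    Algebra.FiniteType.of_surjective (Ideal.Quotient.mkₐ ℂ m) (Ideal.Quotient.mkₐ_surjective ℂ m)
  have := finite_of_finite_type_of_isJacobsonRing ℂ (B ⧸ m)
  have : Algebra.IsAlgebraic ℂ (B ⧸ m) := Algebra.IsAlgebraic.of_finite ℂ _
  exact ⟨(IsAlgClosed.lift (R := ℂ) (S := B ⧸ m) (M := ℂ)).comp (Ideal.Quotient.mkₐ ℂ m)⟩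

lemma exists_algHom_of_ne_top {B : Type*} [CommRing B] [Algebra ℂ B] [Algebra.FiniteType ℂ B]
    {I : Ideal B} (hI : I ≠ ⊤) : ∃ φ : B →ₐ[ℂ] ℂ, ∀ b ∈ I, φ b = 0 := by
  have : Nontrivial (B ⧸ I) := Ideal.Quotient.nontrivial_iff.mpr hI
  have : Algebra.FiniteType ℂ (B ⧸ I) :=
    Algebra.FiniteType.of_surjective (Ideal.Quotient.mkₐ ℂ I) (Ideal.Quotient.mkₐ_surjective ℂ I)
  obtain ⟨φ⟩ := exists_algHom_complex (B ⧸ I)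
  refine ⟨φ.comp (Ideal.Quotient.mkₐ ℂ I), fun b hb => ?_⟩
  have : Ideal.Quotient.mk I b = 0 := Ideal.Quotient.eq_zero_iff_mem.mpr hb
  simp [this]

lemma isNilpotent_of_forall_algHom {B : Type*} [CommRing B] [Algebra ℂ B]
    [Algebra.FiniteType ℂ B] (w : B) (hw : ∀ φ : B →ₐ[ℂ] ℂ, φ w = 0) : IsNilpotent w := by
  by_contra hn
  have hnt : Nontrivial (Localization.Away w) := by
    by_contra h
    rw [not_nontrivial_iff_subsingleton] at h
    have h1 : algebraMap B (Localization.Away w) 1 = algebraMap B _ 0 := Subsingleton.elim _ _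
    obtain ⟨⟨c, n, rfl⟩, hc⟩ := (IsLocalization.eq_iff_exists (Submonoid.powers w) _).mp h1
    exact hn ⟨n, by simpa using hc⟩
  have : Algebra.FiniteType B (Localization.Away w) := by
    have := IsLocalization.Away.finitePresentation (S := Localization.Away w) w
    infer_instance
  have : Algebra.FiniteType ℂ (Localization.Away w) := Algebra.FiniteType.trans ‹_› ‹_›
  obtain ⟨φ⟩ := exists_algHom_complex (Localization.Away w)
  have h0 := hw (φ.comp (IsScalarTower.toAlgHom ℂ B (Localization.Away w)))
  have hu : IsUnit (algebraMap B (Localization.Away w) w) :=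
    IsLocalization.Away.algebraMap_isUnit w
  have := hu.map φ
  simp at h0
  rw [h0] at this
  exact not_isUnit_zero this

/-! ### Affine varieties as algebras of functions -/

variable {X Y Z : Type}

/-- Pullback of functions along a map. -/
def pull (g : X → Y) : (Y → ℂ) →ₐ[ℂ] (X → ℂ) where
  toFun f := f ∘ g
  map_one' := rfl
  map_mul' _ _ := rfl
  map_zero' := rfl
  map_add' _ _ := rfl
  commutes' _ := rfl

@[simp] lemma pull_apply (g : X → Y) (f : Y → ℂ) (x : X) : pull g f x = f (g x) := rfl

/-- `O` is the algebra of regular functions of an affine variety with point set `X`. -/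
structure IsAff (O : Subalgebra ℂ (X → ℂ)) : Prop where
  fg : O.FG
  point : ∀ φ : O →ₐ[ℂ] ℂ, ∃ x, ∀ f : O, φ f = f.1 x
  sep : ∀ x y, (∀ f ∈ O, f x = f y) → x = y

lemma IsAff.finiteType {O : Subalgebra ℂ (X → ℂ)} (h : IsAff O) : Algebra.FiniteType ℂ O :=
  ⟨(Subalgebra.fg_top O).mpr h.fg⟩

lemma IsAff.noeth {O : Subalgebra ℂ (X → ℂ)} (h : IsAff O) : IsNoetherianRing O :=
  isNoetherianRing_of_fg h.fg

instance (O : Subalgebra ℂ (X → ℂ)) : IsReduced O := by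
  refine ⟨fun f ⟨n, hn⟩ => Subtype.ext (funext fun x => ?_)⟩
  have : (f.1 x) ^ n = 0 := congrFun (congrArg Subtype.val hn) x
  exact eq_zero_of_pow_eq_zero this

/-- Evaluation at a point. -/
def evalAt (O : Subalgebra ℂ (X → ℂ)) (x : X) : O →ₐ[ℂ] ℂ :=
  (Pi.evalAlgHom ℂ (fun _ : X => ℂ) x).comp O.val

@[simp] lemma evalAt_apply (O : Subalgebra ℂ (X → ℂ)) (x : X) (f : O) : evalAt O x f = f.1 x := rfl

lemma IsAff.exists_zero {O : Subalgebra ℂ (X → ℂ)} (h : IsAff O) {I : Ideal O} (hI : I ≠ ⊤) :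
    ∃ x, ∀ f ∈ I, f.1 x = 0 := by
  have := h.finiteType
  obtain ⟨φ, hφ⟩ := exists_algHom_of_ne_top hI
  obtain ⟨x, hx⟩ := h.point φ
  exact ⟨x, fun f hf => by rw [← hx, hφ f hf]⟩

/-- Zariski closed subsets. -/
def ZClosed (O : Subalgebra ℂ (X → ℂ)) (S : Set X) : Prop :=
  ∀ x, (∀ f ∈ O, (∀ s ∈ S, f s = 0) → f x = 0) → x ∈ S

/-- Regular maps. -/
def Reg (OX : Subalgebra ℂ (X → ℂ)) (OY : Subalgebra ℂ (Y → ℂ)) (g : X → Y) : Prop :=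
  ∀ f ∈ OY, f ∘ g ∈ OX

lemma Reg.comp {OX : Subalgebra ℂ (X → ℂ)} {OY : Subalgebra ℂ (Y → ℂ)}
    {OZ : Subalgebra ℂ (Z → ℂ)} {g : Y → Z} {f : X → Y} (hg : Reg OY OZ g) (hf : Reg OX OY f) :
    Reg OX OZ (g ∘ f) := fun k hk => hf _ (hg k hk)

lemma Reg.id (OX : Subalgebra ℂ (X → ℂ)) : Reg OX OX (fun x => x) := fun _ hf => hf

lemma Reg.const (OX : Subalgebra ℂ (X → ℂ)) (OY : Subalgebra ℂ (Y → ℂ)) (y : Y) :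
    Reg OX OY (fun _ => y) := fun f _ => OX.algebraMap_mem (f y)

lemma ZClosed.preimage {OX : Subalgebra ℂ (X → ℂ)} {OY : Subalgebra ℂ (Y → ℂ)} {g : X → Y}
    (hg : Reg OX OY g) {S : Set Y} (hS : ZClosed OY S) : ZClosed OX (g ⁻¹' S) :=
  fun x hx => hS (g x) fun f hf h0 => hx (f ∘ g) (hg f hf) fun _ hs => h0 _ hs

lemma ZClosed.inter {OX : Subalgebra ℂ (X → ℂ)} {S T : Set X} (hS : ZClosed OX S)
    (hT : ZClosed OX T) : ZClosed OX (S ∩ T) :=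
  fun x hx => ⟨hS x fun f hf h => hx f hf fun s hs => h s hs.1,
    hT x fun f hf h => hx f hf fun s hs => h s hs.2⟩

lemma ZClosed.forall {ι : Sort*} {OX : Subalgebra ℂ (X → ℂ)} {S : ι → Set X}
    (hS : ∀ i, ZClosed OX (S i)) : ZClosed OX {x | ∀ i, x ∈ S i} :=
  fun x hx i => hS i x fun f hf h => hx f hf fun s hs => h s (hs i)

lemma ZClosed.eqLocus {OX : Subalgebra ℂ (X → ℂ)} {f g : X → ℂ} (hf : f ∈ OX) (hg : g ∈ OX) :
    ZClosed OX {x | f x = g x} := fun _ hx =>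
  sub_eq_zero.mp (hx (f - g) (sub_mem hf hg) fun _ hs => sub_eq_zero.mpr hs)

lemma ZClosed.eqLocus_reg {OX : Subalgebra ℂ (X → ℂ)} {OY : Subalgebra ℂ (Y → ℂ)} {f g : X → Y}
    (hY : IsAff OY) (hf : Reg OX OY f) (hg : Reg OX OY g) : ZClosed OX {x | f x = g x} := by
  have : {x | f x = g x} = {x | ∀ k : OY, x ∈ {x | (k.1 ∘ f) x = (k.1 ∘ g) x}} := by
    ext x
    exact ⟨fun h k => congrArg k.1 h, fun h => hY.sep _ _ fun k hk => h ⟨k, hk⟩⟩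
  rw [this]
  exact ZClosed.forall fun k => ZClosed.eqLocus (hf _ k.2) (hg _ k.2)

/-- Restriction of functions along (an inclusion) `ι`. -/
def res (O : Subalgebra ℂ (X → ℂ)) (ι : Z → X) : Subalgebra ℂ (Z → ℂ) := O.map (pull ι)

lemma mem_res {O : Subalgebra ℂ (X → ℂ)} {ι : Z → X} {f : Z → ℂ} :
    f ∈ res O ι ↔ ∃ g ∈ O, g ∘ ι = f := Iff.rfl

lemma reg_res (O : Subalgebra ℂ (X → ℂ)) (ι : Z → X) : Reg (res O ι) O ι := fun f hf => ⟨f, hf, rfl⟩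

lemma reg_to_res {OY : Subalgebra ℂ (Y → ℂ)} {O : Subalgebra ℂ (X → ℂ)} {ι : Z → X} {g : Y → Z}
    (h : Reg OY O (ι ∘ g)) : Reg OY (res O ι) g := by
  rintro _ ⟨f, hf, rfl⟩
  exact h f hf

lemma IsAff.res {O : Subalgebra ℂ (X → ℂ)} (h : IsAff O) {ι : Z → X}
    (hι : Function.Injective ι) (hc : ZClosed O (Set.range ι)) : IsAff (res O ι) where
  fg := h.fg.map _
  point φ := by
    let r : O →ₐ[ℂ] AlgGrp.res O ι :=
      ((pull ι).comp O.val).codRestrict _ fun f => ⟨f.1, f.2, rfl⟩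
    obtain ⟨x, hx⟩ := h.point (φ.comp r)
    have hxr : x ∈ Set.range ι := hc x fun f hf h0 => by
      refine (hx ⟨f, hf⟩).symm.trans ?_
      have : r ⟨f, hf⟩ = 0 := Subtype.ext (funext fun z => h0 _ ⟨z, rfl⟩)
      simp [this]
    obtain ⟨z, rfl⟩ := hxr
    refine ⟨z, ?_⟩
    rintro ⟨_, f, hf, rfl⟩
    exact hx ⟨f, hf⟩
  sep x y hxy := hι (h.sep _ _ fun f hf => hxy _ ⟨f, hf, rfl⟩)

/-- Regular functions on a product. -/
def prodAlg (O₁ : Subalgebra ℂ (X → ℂ)) (O₂ : Subalgebra ℂ (Y → ℂ)) :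
    Subalgebra ℂ (X × Y → ℂ) := O₁.map (pull Prod.fst) ⊔ O₂.map (pull Prod.snd)

variable {O₁ : Subalgebra ℂ (X → ℂ)} {O₂ : Subalgebra ℂ (Y → ℂ)} {O₃ : Subalgebra ℂ (Z → ℂ)}

lemma reg_fst : Reg (prodAlg O₁ O₂) O₁ Prod.fst := fun f hf =>
  (le_sup_left : _ ≤ prodAlg O₁ O₂) ⟨f, hf, rfl⟩

lemma reg_snd : Reg (prodAlg O₁ O₂) O₂ Prod.snd := fun f hf =>
  (le_sup_right : _ ≤ prodAlg O₁ O₂) ⟨f, hf, rfl⟩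

lemma Reg.prodMk {f : Z → X} {g : Z → Y} (hf : Reg O₃ O₁ f) (hg : Reg O₃ O₂ g) :
    Reg O₃ (prodAlg O₁ O₂) (fun z => (f z, g z)) := by
  have : prodAlg O₁ O₂ ≤ O₃.comap (pull fun z => (f z, g z)) := by
    refine sup_le ?_ ?_
    · rintro _ ⟨k, hk, rfl⟩
      exact hf k hk
    · rintro _ ⟨k, hk, rfl⟩
      exact hg k hk
  exact fun k hk => this hk

lemma mem_prodAlg_iff {F : X × Y → ℂ} : F ∈ prodAlg O₁ O₂ ↔
    ∃ S : Finset (O₁ × O₂), ∀ x y, F (x, y) = ∑ i ∈ S, i.1.1 x * i.2.1 y := by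
  constructor
  · intro hF
    let T := Algebra.TensorProduct.productMap ((pull (Prod.fst : X × Y → X)).comp O₁.val)
      ((pull (Prod.snd : X × Y → Y)).comp O₂.val)
    have : prodAlg O₁ O₂ ≤ T.range := by
      refine sup_le ?_ ?_
      · rintro _ ⟨k, hk, rfl⟩
        exact ⟨(⟨k, hk⟩ : O₁) ⊗ₜ 1, by simp [T]⟩
      · rintro _ ⟨k, hk, rfl⟩
        exact ⟨1 ⊗ₜ (⟨k, hk⟩ : O₂), by simp [T]⟩
    obtain ⟨t, rfl⟩ := this hF
    obtain ⟨S, rfl⟩ := TensorProduct.exists_finset t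
    refine ⟨S, fun x y => ?_⟩
    simp [T, Finset.sum_apply]
  · rintro ⟨S, hS⟩
    have : F = ∑ i ∈ S, (i.1.1 ∘ Prod.fst) * (i.2.1 ∘ Prod.snd) := by
      funext ⟨x, y⟩
      simp [hS, Finset.sum_apply]
    rw [this]
    exact sum_mem fun i _ => mul_mem (reg_fst _ i.1.2) (reg_snd _ i.2.2)

lemma IsAff.prod (h₁ : IsAff O₁) (h₂ : IsAff O₂) : IsAff (prodAlg O₁ O₂) where
  fg := (h₁.fg.map _).sup (h₂.fg.map _)
  point φ := by
    let r₁ : O₁ →ₐ[ℂ] prodAlg O₁ O₂ :=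
      ((pull Prod.fst).comp O₁.val).codRestrict _ fun f => reg_fst _ f.2
    let r₂ : O₂ →ₐ[ℂ] prodAlg O₁ O₂ :=
      ((pull Prod.snd).comp O₂.val).codRestrict _ fun f => reg_snd _ f.2
    obtain ⟨x, hx⟩ := h₁.point (φ.comp r₁)
    obtain ⟨y, hy⟩ := h₂.point (φ.comp r₂)
    refine ⟨(x, y), fun f => ?_⟩
    obtain ⟨S, hS⟩ := mem_prodAlg_iff.mp f.2
    have : f = ∑ i ∈ S, r₁ i.1 * r₂ i.2 := by
      apply Subtype.ext
      funext ⟨x, y⟩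
      rw [hS]
      simp only [AddSubmonoidClass.coe_finsetSum, Finset.sum_apply]
      rfl
    rw [hS, this, map_sum]
    refine Finset.sum_congr rfl fun i _ => ?_
    rw [map_mul, ← hx, ← hy]
    rfl
  sep := by
    rintro ⟨x, y⟩ ⟨x', y'⟩ h
    exact Prod.ext (h₁.sep _ _ fun f hf => h _ (reg_fst f hf))
      (h₂.sep _ _ fun f hf => h _ (reg_snd f hf))

/-- Zariski connectedness: a regular function with values in `{0, 1}` is constant. -/
def ZConn (O : Subalgebra ℂ (X → ℂ)) : Prop :=
  ∀ e ∈ O, (∀ x, e x = 0 ∨ e x = 1) → ∀ x y, e x = e y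

/-- Irreducibility. -/
def ZIrr (O : Subalgebra ℂ (X → ℂ)) : Prop :=
  ∀ f ∈ O, ∀ g ∈ O, f * g = 0 → f = 0 ∨ g = 0

lemma ZConn.of_surj (h : ZConn O₁) {g : X → Y} (hg : Reg O₁ O₂ g) (hs : Function.Surjective g) :
    ZConn O₂ := by
  intro e he h01 x y
  obtain ⟨x, rfl⟩ := hs x
  obtain ⟨y, rfl⟩ := hs y
  exact h (e ∘ g) (hg e he) (fun x => h01 _) x y

lemma slice_left {F : X × Y → ℂ} (hF : F ∈ prodAlg O₁ O₂) (y : Y) : (fun x => F (x, y)) ∈ O₁ :=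
  ((Reg.id O₁).prodMk (Reg.const O₁ O₂ y)) F hF

lemma slice_right {F : X × Y → ℂ} (hF : F ∈ prodAlg O₁ O₂) (x : X) : (fun y => F (x, y)) ∈ O₂ :=
  ((Reg.const O₂ O₁ x).prodMk (Reg.id O₂)) F hF

lemma ZIrr.prod (h₁ : ZIrr O₁) (h₂ : ZIrr O₂) : ZIrr (prodAlg O₁ O₂) := by
  intro f hf g hg hfg
  by_contra! hne
  obtain ⟨⟨⟨a, b⟩, hab⟩, ⟨⟨c, d⟩, hcd⟩⟩ :=
    And.intro (Function.ne_iff.mp hne.1) (Function.ne_iff.mp hne.2)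
  have h1 := h₁ _ (slice_left hf b) _ (slice_left hg d)
  have : ¬ ((fun x => f (x, b)) = 0 ∨ (fun x => g (x, d)) = 0) := by
    rintro (h | h)
    · exact hab (congrFun h a)
    · exact hcd (congrFun h c)
  have h2 : (fun x => f (x, b)) * (fun x => g (x, d)) ≠ 0 := fun h => this (h1 h)
  obtain ⟨x, hx⟩ := Function.ne_iff.mp h2
  rcases h₂ _ (slice_right hf x) _ (slice_right hg x)
    (by funext y; exact congrFun hfg (x, y)) with h | h
  · exact hx (by simp [show f (x, b) = 0 from congrFun h b])
  · exact hx (by simp [show g (x, d) = 0 from congrFun h d])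

lemma ZIrr.isDomain [Nonempty X] (h : ZIrr O₁) : IsDomain O₁ := by
  have : NoZeroDivisors O₁ := ⟨fun {a b} hab => by
    rcases h a.1 a.2 b.1 b.2 (congrArg Subtype.val hab) with h | h
    · exact Or.inl (Subtype.ext h)
    · exact Or.inr (Subtype.ext h)⟩
  exact NoZeroDivisors.to_isDomain _

/-! ### Affine algebraic groups -/

/-- `O` is the algebra of regular functions of an affine algebraic group with points `X`. -/
structure IsGrp [Group X] (O : Subalgebra ℂ (X → ℂ)) : Prop extends IsAff O where
  mul : Reg (prodAlg O O) O (fun p : X × X => p.1 * p.2)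
  inv : Reg O O (fun x : X => x⁻¹)

section Grp
variable [Group X]

lemma IsGrp.mulReg (h : IsGrp O₁) {f g : Y → X} (hf : Reg O₂ O₁ f) (hg : Reg O₂ O₁ g) :
    Reg O₂ O₁ (fun y => f y * g y) := h.mul.comp (hf.prodMk hg)

lemma IsGrp.invReg (h : IsGrp O₁) {f : Y → X} (hf : Reg O₂ O₁ f) :
    Reg O₂ O₁ (fun y => (f y)⁻¹) := h.inv.comp hf

lemma IsGrp.left (h : IsGrp O₁) (g : X) : Reg O₁ O₁ (fun x => g * x) :=
  h.mulReg (Reg.const _ _ g) (Reg.id _)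

lemma IsGrp.right (h : IsGrp O₁) (g : X) : Reg O₁ O₁ (fun x => x * g) :=
  h.mulReg (Reg.id _) (Reg.const _ _ g)

lemma IsGrp.prod [Group Y] (h₁ : IsGrp O₁) (h₂ : IsGrp O₂) : IsGrp (prodAlg O₁ O₂) where
  toIsAff := h₁.toIsAff.prod h₂.toIsAff
  mul := Reg.prodMk (h₁.mulReg (reg_fst.comp reg_fst) (reg_fst.comp reg_snd))
    (h₂.mulReg (reg_snd.comp reg_fst) (reg_snd.comp reg_snd))
  inv := Reg.prodMk (h₁.invReg reg_fst) (h₂.invReg reg_snd)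

lemma IsGrp.res [Group Z] (h : IsGrp O₁) {ι : Z →* X} (hι : Function.Injective ι)
    (hc : ZClosed O₁ (Set.range ι)) : IsGrp (res O₁ ι) where
  toIsAff := h.toIsAff.res hι hc
  mul := by
    refine reg_to_res ?_
    have : ι ∘ (fun p : Z × Z => p.1 * p.2) = fun p => ι p.1 * ι p.2 := by funext p; simp
    rw [this]
    exact h.mulReg ((reg_res _ _).comp reg_fst) ((reg_res _ _).comp reg_snd)
  inv := by
    refine reg_to_res ?_
    have : ι ∘ (fun p : Z => p⁻¹) = fun p => (ι p)⁻¹ := by funext p; simp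
    rw [this]
    exact h.invReg (reg_res _ _)

lemma IsGrp.resSub (h : IsGrp O₁) (S : Subgroup X) (hc : ZClosed O₁ (S : Set X)) :
    IsGrp (AlgGrp.res O₁ S.subtype) :=
  h.res S.subtype_injective (by simpa using hc)

/-- Right translation of functions, as a representation. -/
def rtrans (g : X) : (X → ℂ) →ₐ[ℂ] (X → ℂ) := pull (fun x => x * g)

@[simp] lemma rtrans_apply (g : X) (f : X → ℂ) (x : X) : rtrans g f x = f (x * g) := rfl

lemma rtrans_mul (g h : X) (f : X → ℂ) : rtrans (g * h) f = rtrans g (rtrans h f) := by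
  funext x; simp [mul_assoc]

lemma rtrans_one (f : X → ℂ) : rtrans (1 : X) f = f := by
  funext x; simp

lemma IsGrp.rtrans_mem (h : IsGrp O₁) (g : X) {f : X → ℂ} (hf : f ∈ O₁) : rtrans g f ∈ O₁ :=
  h.right g f hf

/-- The span of the right translates of a function. -/
def orbitSpan (f : X → ℂ) : Submodule ℂ (X → ℂ) := Submodule.span ℂ (Set.range fun g => rtrans g f)

lemma mem_orbitSpan (f : X → ℂ) : f ∈ orbitSpan f :=
  Submodule.subset_span ⟨1, rtrans_one f⟩

lemma orbitSpan_stable (f : X → ℂ) (g : X) {w : X → ℂ} (hw : w ∈ orbitSpan f) :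
    rtrans g w ∈ orbitSpan f := by
  have : orbitSpan f ≤ (orbitSpan f).comap (rtrans g).toLinearMap := by
    refine Submodule.span_le.mpr ?_
    rintro _ ⟨h, rfl⟩
    exact Submodule.subset_span ⟨g * h, rtrans_mul g h f⟩
  exact this hw

lemma IsGrp.orbitSpan_le (h : IsGrp O₁) {f : X → ℂ} (hf : f ∈ O₁) :
    orbitSpan f ≤ Subalgebra.toSubmodule O₁ := by
  refine Submodule.span_le.mpr ?_
  rintro _ ⟨g, rfl⟩
  exact h.rtrans_mem g hf

lemma IsGrp.orbitSpan_finite (h : IsGrp O₁) {f : X → ℂ} (hf : f ∈ O₁) :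
    FiniteDimensional ℂ (orbitSpan f) := by
  classical
  obtain ⟨S, hS⟩ := mem_prodAlg_iff.mp (h.mul f hf)
  have hle : orbitSpan f ≤ Submodule.span ℂ ((S.image fun i => i.1.1 : Finset (X → ℂ)) : Set _) := by
    refine Submodule.span_le.mpr ?_
    rintro _ ⟨g, rfl⟩
    have : rtrans g f = ∑ i ∈ S, i.2.1 g • i.1.1 := by
      funext x
      have := hS x g
      simp only [Function.comp] at this
      simp [this, Finset.sum_apply, mul_comm]
    simp only [this]
    exact Submodule.sum_mem _ fun i hi => Submodule.smul_mem _ _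
      (Submodule.subset_span (Finset.mem_coe.mpr (Finset.mem_image_of_mem _ hi)))
  exact Submodule.finiteDimensional_of_le hle

end Grp

end AlgGrp

namespace AlgGrp

variable {X Y Z : Type} {O₁ : Subalgebra ℂ (X → ℂ)} {O₂ : Subalgebra ℂ (Y → ℂ)}
  {O₃ : Subalgebra ℂ (Z → ℂ)}

/-! ### Components -/

lemma IsAff.minimalPrimes_finite (h : IsAff O₁) : (minimalPrimes O₁).Finite := by
  have := h.noeth
  exact minimalPrimes.finite_of_isNoetherianRing O₁

lemma eq_zero_of_mem_minimalPrimes (f : O₁) (h : ∀ p ∈ minimalPrimes O₁, f ∈ p) : f = 0 := by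
  have h1 : f ∈ sInf (minimalPrimes O₁) := by
    rw [Submodule.mem_sInf]; exact h
  rw [minimalPrimes, Ideal.sInf_minimalPrimes] at h1
  have : IsNilpotent f := mem_nilradical.mp h1
  exact this.eq_zero

lemma IsAff.finite_idem (h : IsAff O₁) : {e : X → ℂ | e ∈ O₁ ∧ ∀ x, e x = 0 ∨ e x = 1}.Finite := by
  classical
  have hfin := h.minimalPrimes_finite.powerset
  refine Set.Finite.of_finite_image (f := fun e => {p ∈ minimalPrimes O₁ | ∃ he : e ∈ O₁, ⟨e, he⟩ ∈ p})
    (hfin.subset ?_) ?_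
  · rintro _ ⟨e, -, rfl⟩ p hp
    exact hp.1
  · rintro e ⟨he, h01⟩ e' ⟨he', h01'⟩ heq
    have key : ∀ p ∈ minimalPrimes O₁, ((⟨e, he⟩ : O₁) ∈ p ↔ (⟨e', he'⟩ : O₁) ∈ p) := by
      intro p hp
      have := Set.ext_iff.mp heq p
      exact ⟨fun h => (this.mp ⟨hp, he, h⟩).2.2, fun h => (this.mpr ⟨hp, he', h⟩).2.2⟩
    have idem : ∀ (e : X → ℂ) (he : e ∈ O₁), (∀ x, e x = 0 ∨ e x = 1) → ∀ p ∈ minimalPrimes O₁,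
        (⟨e, he⟩ : O₁) ∉ p → 1 - (⟨e, he⟩ : O₁) ∈ p := by
      intro e he h01 p hp hn
      have : (⟨e, he⟩ : O₁) * (1 - ⟨e, he⟩) = 0 := by
        apply Subtype.ext; funext x
        rcases h01 x with h | h <;> simp [h]
      have hpp : p.IsPrime := hp.1.1
      exact (hpp.mem_or_mem (this ▸ p.zero_mem)).resolve_left hn
    have : (⟨e, he⟩ : O₁) - ⟨e', he'⟩ = 0 := by
      apply eq_zero_of_mem_minimalPrimes
      intro p hp
      by_cases hm : (⟨e, he⟩ : O₁) ∈ p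
      · exact sub_mem hm ((key p hp).mp hm)
      · have := sub_mem (idem e' he' h01' p hp (fun h => hm ((key p hp).mpr h)))
          (idem e he h01 p hp hm)
        simpa using this
    exact congrArg Subtype.val (sub_eq_zero.mp this)

section Grp
variable [Group X] [Group Y] [Group Z]

/-- Right translation as a ring automorphism of the algebra of regular functions. -/
def rtransO (h : IsGrp O₁) (g : X) : O₁ →+* O₁ :=
  (((rtrans g).comp O₁.val).codRestrict O₁ fun f => h.rtrans_mem g f.2).toRingHom

lemma rtransO_apply (h : IsGrp O₁) (g : X) (f : O₁) (x : X) : (rtransO h g f).1 x = f.1 (x * g) :=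
  rfl

lemma rtransO_inv (h : IsGrp O₁) (g : X) (f : O₁) : rtransO h g (rtransO h g⁻¹ f) = f := by
  apply Subtype.ext; funext x
  simp [rtransO_apply]

lemma comap_rtransO_mem (h : IsGrp O₁) (g : X) {p : Ideal O₁} (hp : p ∈ minimalPrimes O₁) :
    p.comap (rtransO h g) ∈ minimalPrimes O₁ := by
  have hpp : p.IsPrime := hp.1.1
  refine ⟨⟨Ideal.comap_isPrime _ _, bot_le⟩, ?_⟩
  rintro q ⟨hq, -⟩ hle f hf
  have h1 : q.comap (rtransO h g⁻¹) ≤ p := by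
    intro k hk
    have := hle hk
    rw [Ideal.mem_comap, rtransO_inv] at this
    exact this
  have h2 := hp.2 ⟨Ideal.comap_isPrime _ q, bot_le⟩ h1 hf
  rw [Ideal.mem_comap] at h2
  have h3 := rtransO_inv h g⁻¹ f
  rw [inv_inv] at h3
  rwa [h3] at h2

theorem IsGrp.irr (h : IsGrp O₁) (hc : ZConn O₁) : ZIrr O₁ := by
  classical
  have hfin := h.minimalPrimes_finite
  let x1 : X := 1
  have hnt : Nontrivial O₁ := ⟨0, 1, fun h0 => by
    have := congrFun (congrArg Subtype.val h0) x1
    simp at this⟩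
  have hker : ∀ x : X, (RingHom.ker (evalAt O₁ x)).IsPrime := fun x => RingHom.ker_isPrime _
  obtain ⟨p0, hp0, -⟩ := Ideal.exists_minimalPrimes_le (bot_le : ⊥ ≤ RingHom.ker (evalAt O₁ x1))
  have hprime : ∀ p ∈ minimalPrimes O₁, p.IsPrime := fun p hp => hp.1.1
  -- the intersection of the other components
  have others : ∀ p ∈ minimalPrimes O₁, ∃ f : O₁, f ∉ p ∧ ∀ q ∈ minimalPrimes O₁, q ≠ p → f ∈ q := by
    intro p hp
    by_contra! hcon
    have hle : (hfin.toFinset.erase p).inf id ≤ p := by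
      intro f hf
      by_contra hfp
      obtain ⟨q, hq, hne, hfq⟩ := hcon f hfp
      exact hfq ((Finset.inf_le (f := id) (Finset.mem_erase.mpr ⟨hne, hfin.mem_toFinset.mpr hq⟩)) hf)
    obtain ⟨q, hq, hqp⟩ := (Ideal.IsPrime.inf_le' (hprime p hp)).mp hle
    obtain ⟨hne, hq⟩ := Finset.mem_erase.mp hq
    have hq := hfin.mem_toFinset.mp hq
    exact hne (le_antisymm hqp (hp.2 hq.1 hqp))
  obtain ⟨f, hfp, hfo⟩ := others p0 hp0
  obtain ⟨x0, hx0⟩ : ∃ x, f.1 x ≠ 0 := by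
    by_contra! h0
    exact hfp ((show f = 0 from Subtype.ext (funext h0)) ▸ p0.zero_mem)
  have uniq0 : ∀ p ∈ minimalPrimes O₁, p ≤ RingHom.ker (evalAt O₁ x0) → p = p0 := by
    intro p hp hle
    by_contra hne
    exact hx0 (hle (hfo p hp hne))
  have uniq : ∀ x, ∀ p ∈ minimalPrimes O₁, ∀ q ∈ minimalPrimes O₁,
      p ≤ RingHom.ker (evalAt O₁ x) → q ≤ RingHom.ker (evalAt O₁ x) → p ≤ q := by
    intro x p hp q hq hpx hqx
    have tr : ∀ r ∈ minimalPrimes O₁, r ≤ RingHom.ker (evalAt O₁ x) →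
        r.comap (rtransO h (x⁻¹ * x0)) = p0 := by
      intro r hr hrx
      refine uniq0 _ (comap_rtransO_mem h _ hr) fun k hk => ?_
      have := hrx hk
      simpa [RingHom.mem_ker, rtransO_apply] using this
    intro k hk
    have e : p.comap (rtransO h (x⁻¹ * x0)) = q.comap (rtransO h (x⁻¹ * x0)) :=
      (tr p hp hpx).trans (tr q hq hqx).symm
    have h3 := rtransO_inv h (x⁻¹ * x0) k
    have : rtransO h (x⁻¹ * x0)⁻¹ k ∈ p.comap (rtransO h (x⁻¹ * x0)) := by
      rw [Ideal.mem_comap, h3]; exact hk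
    rw [e, Ideal.mem_comap, h3] at this
    exact this
  have cop : ∀ p ∈ minimalPrimes O₁, p ≠ p0 → p0 ⊔ p = ⊤ := by
    intro p hp hne
    by_contra htop
    obtain ⟨x, hx⟩ := h.exists_zero htop
    have a := uniq x p hp p0 hp0 (fun k hk => hx k (Ideal.mem_sup_right hk))
      (fun k hk => hx k (Ideal.mem_sup_left hk))
    have b := uniq x p0 hp0 p hp (fun k hk => hx k (Ideal.mem_sup_left hk))
      (fun k hk => hx k (Ideal.mem_sup_right hk))
    exact hne (le_antisymm a b)
  have only : ∀ p ∈ minimalPrimes O₁, p = p0 := by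
    intro p1 hp1
    by_contra hne
    have hcop : p0 ⊔ (hfin.toFinset.erase p0).inf id = ⊤ := by
      rw [← Ideal.isCoprime_iff_sup_eq]
      have : ∀ s : Finset (Ideal O₁), (∀ p ∈ s, IsCoprime p0 p) → IsCoprime p0 (s.inf id) := by
        intro s
        induction s using Finset.induction_on with
        | empty => intro _; simp [Ideal.isCoprime_iff_sup_eq]
        | insert a s ha ih =>
          intro hs
          rw [Finset.inf_insert]
          have h1 : IsCoprime p0 (a * s.inf id) := IsCoprime.mul_right
            (hs a (Finset.mem_insert_self _ _)) (ih fun p hp => hs p (Finset.mem_insert_of_mem hp))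
          rw [Ideal.isCoprime_iff_sup_eq] at h1 ⊢
          exact top_le_iff.mp (h1 ▸ sup_le_sup_left Ideal.mul_le_inf _)
      refine this _ fun p hp => ?_
      obtain ⟨hne, hp⟩ := Finset.mem_erase.mp hp
      exact (Ideal.isCoprime_iff_sup_eq).mpr (cop p (hfin.mem_toFinset.mp hp) hne)
    obtain ⟨a, ha, b, hb, hab⟩ := Submodule.mem_sup.mp (hcop ▸ Submodule.mem_top : (1 : O₁) ∈ _)
    have hb' : ∀ p ∈ minimalPrimes O₁, p ≠ p0 → b ∈ p := fun p hp hne =>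
      (Finset.inf_le (f := id) (Finset.mem_erase.mpr ⟨hne, hfin.mem_toFinset.mpr hp⟩)) hb
    have hab0 : a * b = 0 := by
      apply eq_zero_of_mem_minimalPrimes
      intro p hp
      by_cases hpp : p = p0
      · rw [hpp]; exact Ideal.mul_mem_right _ _ ha
      · exact Ideal.mul_mem_left _ _ (hb' p hp hpp)
    have hb01 : ∀ x, b.1 x = 0 ∨ b.1 x = 1 := by
      intro x
      have e1 : a.1 x * b.1 x = 0 := congrFun (congrArg Subtype.val hab0) x
      have e2 : a.1 x + b.1 x = 1 := congrFun (congrArg Subtype.val hab) x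
      rcases mul_eq_zero.mp e1 with h | h
      · right; simpa [h] using e2
      · exact Or.inl h
    obtain ⟨y0, hy0⟩ := h.exists_zero (hprime p0 hp0).ne_top
    obtain ⟨y1, hy1⟩ := h.exists_zero (hprime p1 hp1).ne_top
    have e0 : a.1 y0 = 0 := hy0 a ha
    have e1 : b.1 y1 = 0 := hy1 b (hb' p1 hp1 hne)
    have e2 : a.1 y0 + b.1 y0 = 1 := congrFun (congrArg Subtype.val hab) y0
    have := hc b.1 b.2 hb01 y0 y1
    rw [e1] at this
    rw [e0, this] at e2
    simp at e2
  have hbot : ∀ f ∈ p0, f = 0 := fun f hf => eq_zero_of_mem_minimalPrimes f fun p hp => by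
    rw [only p hp]; exact hf
  intro f hf g hg hfg
  have : (⟨f, hf⟩ : O₁) * ⟨g, hg⟩ ∈ p0 := by
    have : (⟨f, hf⟩ : O₁) * ⟨g, hg⟩ = 0 := Subtype.ext hfg
    rw [this]; exact p0.zero_mem
  rcases (hprime p0 hp0).mem_or_mem this with h | h
  · exact Or.inl (congrArg Subtype.val (hbot _ h))
  · exact Or.inr (congrArg Subtype.val (hbot _ h))

/-- The identity component. -/
def idComp (h : IsGrp O₁) : Subgroup X where
  carrier := {x | ∀ e ∈ O₁, (∀ y, e y = 0 ∨ e y = 1) → e x = e 1}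
  one_mem' := fun _ _ _ => rfl
  mul_mem' := by
    intro x y hx hy e he h01
    have := hy (e ∘ fun z => x * z) (h.left x e he) (fun z => h01 _)
    simp only [Function.comp, mul_one] at this
    rw [this, hx e he h01]
  inv_mem' := by
    intro x hx e he h01
    have := hx (e ∘ fun z => x⁻¹ * z) (h.left x⁻¹ e he) (fun z => h01 _)
    simp only [Function.comp, mul_one, inv_mul_cancel] at this
    exact this.symm

lemma mem_idComp (h : IsGrp O₁) {x : X} :
    x ∈ idComp h ↔ ∀ e ∈ O₁, (∀ y, e y = 0 ∨ e y = 1) → e x = e 1 := Iff.rfl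

lemma exists_idComp_indicator (h : IsGrp O₁) : ∃ ε ∈ O₁, ∀ x,
    (x ∈ idComp h → ε x = 1) ∧ (x ∉ idComp h → ε x = 0) := by
  classical
  have hfin := h.finite_idem
  refine ⟨∏ e ∈ hfin.toFinset, (if e 1 = 1 then e else 1 - e), ?_, fun x => ⟨fun hx => ?_, fun hx => ?_⟩⟩
  · refine prod_mem fun e he => ?_
    have he := (hfin.mem_toFinset.mp he).1
    split_ifs
    · exact he
    · exact sub_mem O₁.one_mem he
  · rw [Finset.prod_apply]
    refine Finset.prod_eq_one fun e he => ?_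
    obtain ⟨he, h01⟩ := hfin.mem_toFinset.mp he
    have h1 := hx e he h01
    split_ifs with hh
    · rw [h1, hh]
    · have : e 1 = 0 := (h01 1).resolve_right hh
      simp [h1, this]
  · rw [mem_idComp] at hx
    push Not at hx
    obtain ⟨e, he, h01, hne⟩ := hx
    rw [Finset.prod_apply]
    refine Finset.prod_eq_zero (hfin.mem_toFinset.mpr ⟨he, h01⟩) ?_
    split_ifs with hh
    · exact (h01 x).resolve_right (fun h => hne (h.trans hh.symm))
    · have h10 : e 1 = 0 := (h01 1).resolve_right hh
      have : e x = 1 := (h01 x).resolve_left (fun h => hne (h.trans h10.symm))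
      simp [this]

lemma idComp_closed (h : IsGrp O₁) : ZClosed O₁ (idComp h : Set X) := by
  obtain ⟨ε, hε, hε1⟩ := exists_idComp_indicator h
  have : (idComp h : Set X) = {x | ε x = (1 : X → ℂ) x} := by
    ext x
    refine ⟨fun hx => (hε1 x).1 hx, fun hx => ?_⟩
    by_contra hn
    have := (hε1 x).2 hn
    rw [Set.mem_ofPred_eq, this] at hx
    simp at hx
  rw [this]
  exact ZClosed.eqLocus hε O₁.one_mem

lemma idComp_finite (h : IsGrp O₁) : Finite (X ⧸ idComp h) := by
  classical
  have hfin := h.finite_idem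
  have : Finite (hfin.toFinset → Prop) := inferInstance
  let F : X → (hfin.toFinset → Prop) := fun x e => e.1 x = 1
  have : Finite (Set.range F) := inferInstance
  refine Finite.of_injective (fun c : X ⧸ idComp h => (F c.out)) ?_
  intro c d hcd
  rw [← c.out_eq', ← d.out_eq', QuotientGroup.eq]
  intro e he h01
  have hmem : (e ∘ fun z => (Quotient.out c)⁻¹ * z) ∈ hfin.toFinset :=
    hfin.mem_toFinset.mpr ⟨h.left _ e he, fun z => h01 _⟩
  have := congrFun hcd ⟨_, hmem⟩
  simp only [F, Function.comp, inv_mul_cancel, eq_iff_iff] at this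
  rcases h01 1 with h1 | h1
  · rw [h1]
    refine (h01 _).resolve_right fun h2 => ?_
    rw [this.mpr h2] at h1
    simp at h1
  · rw [h1]; exact this.mp h1

lemma idComp_conn (h : IsGrp O₁) : ZConn (res O₁ (idComp h).subtype) := by
  obtain ⟨ε, hε, hε1⟩ := exists_idComp_indicator h
  rintro _ ⟨f, hf, rfl⟩ h01 x y
  have h01' : ∀ x, (ε * f) x = 0 ∨ (ε * f) x = 1 := by
    intro x
    by_cases hx : x ∈ idComp h
    · simpa [(hε1 x).1 hx] using h01 ⟨x, hx⟩
    · simp [(hε1 x).2 hx]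
  have key : ∀ x : idComp h, f x = (ε * f) 1 := by
    intro x
    rw [← x.2 (ε * f) (mul_mem hε hf) h01']
    simp [(hε1 x.1).1 x.2]
  exact (key x).trans (key y).symm

lemma mem_of_idComp_inv (h : IsGrp O₁) (f : X → ℂ) (hf : ∀ x, ∀ y ∈ idComp h, f (x * y) = f x) :
    f ∈ O₁ := by
  classical
  obtain ⟨ε, hε, hε1⟩ := exists_idComp_indicator h
  have := idComp_finite h
  have := Fintype.ofFinite (X ⧸ idComp h)
  have : f = ∑ c : X ⧸ idComp h, f c.out • (ε ∘ fun x => (c.out)⁻¹ * x) := by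
    funext x
    rw [Finset.sum_apply, Finset.sum_eq_single (QuotientGroup.mk x : X ⧸ idComp h)]
    · have hm : (Quotient.out (QuotientGroup.mk x : X ⧸ idComp h))⁻¹ * x ∈ idComp h := by
        rw [← QuotientGroup.eq]; exact Quotient.out_eq' _
      have h1 := hf (Quotient.out (QuotientGroup.mk x : X ⧸ idComp h)) _ hm
      rw [mul_inv_cancel_left] at h1
      simp only [Pi.smul_apply, Function.comp, (hε1 _).1 hm, smul_eq_mul, mul_one]
      exact h1
    · intro c _ hne
      have hm : (Quotient.out c)⁻¹ * x ∉ idComp h := by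
        rw [← QuotientGroup.eq]
        intro h2
        exact hne ((Quotient.out_eq' c).symm.trans h2)
      simp [(hε1 _).2 hm]
    · simp
  rw [this]
  exact sum_mem fun c _ => O₁.smul_mem (h.left _ ε hε) _

/-- A connected group maps into the identity component. -/
lemma ZConn.map_idComp (hc : ZConn O₂) (h : IsGrp O₁) (q : Y →* X) (hq : Reg O₂ O₁ q) (y : Y) :
    q y ∈ idComp h := by
  intro e he h01
  have := hc (e ∘ q) (hq e he) (fun _ => h01 _) y 1
  simpa using this

end Grp

end AlgGrp

namespace AlgGrp

open scoped TensorProduct nonZeroDivisors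

/-! ### Functions constant on fibres -/

lemma mem_range_of_isNilpotent_tensor {k S : Type} [Field k] [CharZero k] [CommRing S] [Algebra k S]
    [IsReduced S] (f : S) (h : IsNilpotent (f ⊗ₜ[k] (1 : S) - (1 : S) ⊗ₜ[k] f)) :
    ∃ c : k, f = algebraMap k S c := by
  classical
  let ev : Polynomial k →ₐ[k] S := Polynomial.aeval f
  let I : Ideal (Polynomial k) := RingHom.ker ev
  let A := Polynomial k ⧸ I
  let x : A := Ideal.Quotient.mk I Polynomial.X
  let ι : A →ₐ[k] S := Ideal.kerLiftAlg ev
  have hι : Function.Injective ι := Ideal.kerLiftAlg_injective ev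
  have hιx : ι x = f := by
    change Ideal.kerLiftAlg ev (Ideal.Quotient.mk _ Polynomial.X) = f
    rw [Ideal.kerLiftAlg_mk]; simp [ev]
  have hinj : Function.Injective (Algebra.TensorProduct.map ι ι) :=
    TensorProduct.map_injective_of_flat_flat (R := k) ι.toLinearMap ι.toLinearMap hι hι
  have hx : IsNilpotent (x ⊗ₜ[k] (1 : A) - (1 : A) ⊗ₜ[k] x) := by
    rw [← IsNilpotent.map_iff hinj]
    simpa [hιx] using h
  have uniq : ∀ (φ ψ : A →ₐ[k] AlgebraicClosure k), φ x = ψ x := by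
    intro φ ψ
    have := hx.map (Algebra.TensorProduct.productMap φ ψ)
    have := this.eq_zero
    simpa [sub_eq_zero] using this
  let p := Submodule.IsPrincipal.generator I
  have hp : ∀ q, q ∈ I ↔ p ∣ q := fun q => Submodule.IsPrincipal.mem_iff_generator_dvd I
  have hroot : ∀ z : AlgebraicClosure k, Polynomial.aeval z p = 0 →
      ∃ φ : A →ₐ[k] AlgebraicClosure k, φ x = z := by
    intro z hz
    refine ⟨Ideal.Quotient.liftₐ I (Polynomial.aeval z) fun q hq => ?_, ?_⟩
    · obtain ⟨r, rfl⟩ := (hp q).mp hq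
      simp [hz]
    · exact (Ideal.Quotient.lift_mk I _ _).trans (by simp)
  have huniq : ∀ z w : AlgebraicClosure k, Polynomial.aeval z p = 0 → Polynomial.aeval w p = 0 →
      z = w := by
    intro z w hz hw
    obtain ⟨φ, rfl⟩ := hroot z hz
    obtain ⟨ψ, rfl⟩ := hroot w hw
    exact uniq φ ψ
  have hp0 : p ≠ 0 := by
    intro h0
    exact zero_ne_one (huniq 0 1 (by simp [h0]) (by simp [h0]))
  have hpI : p ∈ I := (hp p).mpr dvd_rfl
  have hsq : Squarefree p := by
    intro r hr
    obtain ⟨s, hs⟩ := hr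
    have h1 : ev (r * s) = 0 := by
      have : IsNilpotent (ev (r * s)) := ⟨2, by
        have : (r * s) ^ 2 = p * s := by rw [hs]; ring
        rw [← map_pow, this, map_mul, show ev p = 0 from hpI, zero_mul]⟩
      exact this.eq_zero
    have h2 : p ∣ r * s := (hp _).mp h1
    obtain ⟨t, ht⟩ := h2
    have hrs : r * s ≠ 0 := fun h => hp0 (by rw [hs, mul_assoc, h, mul_zero])
    have : (r * s) * (r * t) = (r * s) * 1 := by
      rw [mul_one]
      calc r * s * (r * t) = (r * r * s) * t := by ring
        _ = r * s := by rw [← hs, ← ht]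
    exact IsUnit.of_mul_eq_one _ (mul_left_cancel₀ hrs this)
  have hsep : p.Separable := PerfectField.separable_iff_squarefree.mpr hsq
  have hcard := Polynomial.card_rootSet_eq_natDegree (K := AlgebraicClosure k) hsep
    (IsAlgClosed.splits _)
  have hle : p.natDegree ≤ 1 := by
    rw [← hcard]
    refine Fintype.card_le_one_iff.mpr ?_
    rintro ⟨z, hz⟩ ⟨w, hw⟩
    rw [Polynomial.mem_rootSet] at hz hw
    exact Subtype.ext (huniq z w hz.2 hw.2)
  have hfp : Polynomial.aeval f p = 0 := hpI
  obtain ⟨a, b, hab⟩ := Polynomial.exists_eq_X_add_C_of_natDegree_le_one hle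
  rw [hab] at hfp
  simp only [map_add, map_mul, Polynomial.aeval_C, Polynomial.aeval_X] at hfp
  by_cases ha : a = 0
  · have hb : b ≠ 0 := by rintro rfl; exact hp0 (by simp [hab, ha])
    refine ⟨0, ?_⟩
    have h1 : algebraMap k S b = 0 := by simpa [ha] using hfp
    have : (1 : S) = 0 := by
      rw [← map_one (algebraMap k S), ← mul_inv_cancel₀ hb, map_mul, h1, zero_mul]
    rw [← mul_one f, this]; simp
  · refine ⟨a⁻¹ * -b, ?_⟩
    have : f = algebraMap k S a⁻¹ * (algebraMap k S a * f) := by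
      rw [← mul_assoc, ← map_mul, inv_mul_cancel₀ ha, map_one, one_mul]
    rw [this, map_mul, eq_neg_of_add_eq_zero_left hfp, map_neg]

/-- A function which is determined by a domain `C` up to nilpotents is a fraction over `C`. -/
theorem exists_smul_eq_algebraMap {C R : Type} [CommRing C] [IsDomain C] [Algebra ℂ C] [CommRing R]
    [IsReduced R] [Algebra ℂ R] [Algebra.FiniteType ℂ R] [Algebra C R] [IsScalarTower ℂ C R] (f : R)
    (hf : ∀ φ ψ : R →ₐ[ℂ] ℂ, (∀ c : C, φ (algebraMap C R c) = ψ (algebraMap C R c)) → φ f = ψ f) :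
    ∃ b c : C, b ≠ 0 ∧ algebraMap C R b * f = algebraMap C R c := by
  classical
  have hfin : Algebra.FiniteType ℂ (R ⊗[C] R) := by
    have : Algebra.FiniteType ℂ (R ⊗[ℂ] R) :=
      Algebra.FiniteType.trans (S := R) ‹_› inferInstance
    refine Algebra.FiniteType.of_surjective (A := R ⊗[ℂ] R)
      (Algebra.TensorProduct.lift (S := ℂ) (Algebra.TensorProduct.includeLeft : R →ₐ[ℂ] R ⊗[C] R)
        ((Algebra.TensorProduct.includeRight : R →ₐ[C] R ⊗[C] R).restrictScalars ℂ)
        (fun _ _ => Commute.all _ _)) ?_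
    intro t
    induction t using TensorProduct.induction_on with
    | zero => exact ⟨0, map_zero _⟩
    | tmul a b => exact ⟨a ⊗ₜ b, by simp⟩
    | add a b ha hb =>
      obtain ⟨a, rfl⟩ := ha
      obtain ⟨b, rfl⟩ := hb
      exact ⟨a + b, map_add _ _ _⟩
  have hnil : IsNilpotent (f ⊗ₜ[C] (1 : R) - (1 : R) ⊗ₜ[C] f) := by
    apply isNilpotent_of_forall_algHom
    intro φ
    rw [map_sub, sub_eq_zero]
    refine hf (φ.comp (Algebra.TensorProduct.includeLeft : R →ₐ[ℂ] R ⊗[C] R))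
      (φ.comp ((Algebra.TensorProduct.includeRight : R →ₐ[C] R ⊗[C] R).restrictScalars ℂ)) ?_
    intro c
    simp only [AlgHom.comp_apply, AlgHom.restrictScalars_apply, Algebra.TensorProduct.includeLeft_apply,
      Algebra.TensorProduct.includeRight_apply]
    rw [Algebra.algebraMap_eq_smul_one, TensorProduct.smul_tmul]
  let M := Algebra.algebraMapSubmonoid R C⁰
  let S := Localization M
  let k := FractionRing C
  let alg : Algebra k S := (IsLocalization.map S (algebraMap C R) (M := C⁰) (T := M)
    (by intro c hc; exact ⟨c, hc, rfl⟩)).toAlgebra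
  have hkS : ∀ c : C, algebraMap k S (algebraMap C k c) = algebraMap R S (algebraMap C R c) := by
    intro c
    exact IsLocalization.map_eq _ c
  have hred : IsReduced S := isReduced_localizationPreserves M S inferInstance
  have hch : CharZero k := by
    have : CharZero C := charZero_of_injective_algebraMap (algebraMap ℂ C).injective
    exact charZero_of_injective_algebraMap (IsFractionRing.injective C k)
  let jl : R →+* S ⊗[k] S := (Algebra.TensorProduct.includeLeft : S →ₐ[k] S ⊗[k] S).toRingHom.comp
    (algebraMap R S)
  let jr : R →+* S ⊗[k] S := (Algebra.TensorProduct.includeRight : S →ₐ[k] S ⊗[k] S).toRingHom.comp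
    (algebraMap R S)
  let algC : Algebra C (S ⊗[k] S) := (jl.comp (algebraMap C R)).toAlgebra
  let jl' : R →ₐ[C] S ⊗[k] S := { jl with commutes' := fun _ => rfl }
  have hjr : ∀ c : C, jr (algebraMap C R c) = algebraMap C (S ⊗[k] S) c := by
    intro c
    change (1 : S) ⊗ₜ[k] (algebraMap R S (algebraMap C R c)) =
      (algebraMap R S (algebraMap C R c)) ⊗ₜ[k] (1 : S)
    rw [← hkS, Algebra.algebraMap_eq_smul_one (R := k) (A := S), TensorProduct.smul_tmul]
  let jr' : R →ₐ[C] S ⊗[k] S := { jr with commutes' := hjr }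
  have hn2 := hnil.map (Algebra.TensorProduct.productMap jl' jr')
  have hn3 : IsNilpotent (algebraMap R S f ⊗ₜ[k] (1 : S) - (1 : S) ⊗ₜ[k] algebraMap R S f) := by
    have e1 : jl' f = algebraMap R S f ⊗ₜ[k] (1 : S) := rfl
    have e2 : jr' f = (1 : S) ⊗ₜ[k] algebraMap R S f := rfl
    simpa [e1, e2] using hn2
  obtain ⟨c, hc⟩ := mem_range_of_isNilpotent_tensor _ hn3
  obtain ⟨⟨n, d⟩, hnd⟩ := IsLocalization.surj C⁰ c
  have h1 : algebraMap R S (algebraMap C R d * f) = algebraMap R S (algebraMap C R n) := by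
    rw [map_mul, hc, ← hkS, ← map_mul, ← hkS, mul_comm, hnd]
  obtain ⟨⟨_, t, ht, rfl⟩, h2⟩ := (IsLocalization.eq_iff_exists M S).mp h1
  refine ⟨t * d, t * n, mul_ne_zero (nonZeroDivisors.ne_zero ht) (nonZeroDivisors.ne_zero d.2), ?_⟩
  simp only [map_mul] at h2 ⊢
  rw [mul_assoc]
  exact h2

end AlgGrp

namespace AlgGrp

variable {X Y Z : Type} {O₁ : Subalgebra ℂ (X → ℂ)} {O₂ : Subalgebra ℂ (Y → ℂ)}
  {O₃ : Subalgebra ℂ (Z → ℂ)}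

/-- A regular function constant on the fibres of a surjection onto an irreducible variety
is a fraction of regular functions on the base. -/
lemma exists_frac [Nonempty Y] (h₁ : IsAff O₁) (hsep : ∀ x y, (∀ f ∈ O₂, f x = f y) → x = y) (hi : ZIrr O₂) (q : X → Y)
    (hq : Reg O₁ O₂ q) {f : X → ℂ} (hf : f ∈ O₁)
    (hconst : ∀ x x', q x = q x' → f x = f x') :
    ∃ b ∈ O₂, ∃ c ∈ O₂, b ≠ 0 ∧ ∀ x, b (q x) * f x = c (q x) := by
  have := hi.isDomain
  have := h₁.finiteType
  let m : O₂ →ₐ[ℂ] O₁ := ((pull q).comp O₂.val).codRestrict O₁ fun f => hq f.1 f.2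
  let alg : Algebra O₂ O₁ := m.toRingHom.toAlgebra
  have : IsScalarTower ℂ O₂ O₁ := IsScalarTower.of_algebraMap_eq fun c => (m.commutes c).symm
  have hm : ∀ (c : O₂) (x : X), (algebraMap O₂ O₁ c).1 x = c.1 (q x) := fun _ _ => rfl
  obtain ⟨b, c, hb, hbc⟩ := exists_smul_eq_algebraMap (C := O₂) (R := O₁) ⟨f, hf⟩ (by
    intro φ ψ hφψ
    obtain ⟨x, hx⟩ := h₁.point φ
    obtain ⟨x', hx'⟩ := h₁.point ψ
    rw [hx, hx']
    refine hconst x x' (hsep _ _ fun k hk => ?_)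
    have := hφψ ⟨k, hk⟩
    rw [hx, hx', hm, hm] at this
    exact this)
  refine ⟨b.1, b.2, c.1, c.2, fun h => hb (Subtype.ext h), fun x => ?_⟩
  exact congrFun (congrArg Subtype.val hbc) x

variable [Group X] [Group Y] [Group Z]

theorem descent (h₁ : IsGrp O₁) (h₂ : IsGrp O₂) (hc : ZConn O₂) (q : X →* Y) (hq : Reg O₁ O₂ q)
    (hs : Function.Surjective q) {f : X → ℂ} (hf : f ∈ O₁)
    (hconst : ∀ x x', q x = q x' → f x = f x') : ∃ F ∈ O₂, ∀ x, F (q x) = f x := by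
  classical
  have hi := h₂.irr hc
  have hdom := hi.isDomain
  let I : Ideal O₂ :=
    { carrier := {c | ∀ h : X, ∃ c' ∈ O₂, ∀ x, c.1 (q x) * f (x * h) = c' (q x)}
      zero_mem' := fun h => ⟨0, O₂.zero_mem, fun x => by simp⟩
      add_mem' := by
        intro a b ha hb h
        obtain ⟨a', ha', ea⟩ := ha h
        obtain ⟨b', hb', eb⟩ := hb h
        refine ⟨a' + b', add_mem ha' hb', fun x => ?_⟩
        simp [add_mul, ea, eb]
      smul_mem' := by
        intro a b hb h
        obtain ⟨b', hb', eb⟩ := hb h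
        refine ⟨a.1 * b', mul_mem a.2 hb', fun x => ?_⟩
        simp [mul_assoc, eb] }
  have hmem : ∀ c : O₂, c ∈ I ↔ ∀ h : X, ∃ c' ∈ O₂, ∀ x, c.1 (q x) * f (x * h) = c' (q x) :=
    fun c => Iff.rfl
  have htr : ∀ c ∈ I, ∀ y, rtransO h₂ y c ∈ I := by
    intro c hcI y h
    obtain ⟨g, rfl⟩ := hs y
    obtain ⟨c', hc', e⟩ := hcI (g⁻¹ * h)
    refine ⟨_, h₂.rtrans_mem (q g) hc', fun x => ?_⟩
    have := e (x * g)
    simp only [map_mul, mul_assoc, mul_inv_cancel_left] at this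
    simp only [rtransO_apply, rtrans_apply, this]
  have hne : ∃ c ∈ I, c ≠ 0 := by
    have hfd := h₁.orbitSpan_finite hf
    obtain ⟨S, hS⟩ := (Submodule.fg_iff_finiteDimensional _).mpr hfd
    have hcon : ∀ w ∈ orbitSpan f, ∀ x x', q x = q x' → w x = w x' := by
      intro w hw x x' hx
      refine Submodule.span_induction (p := fun w _ => w x = w x') ?_ rfl ?_ ?_ hw
      · rintro _ ⟨g, rfl⟩
        exact hconst _ _ (by simp [hx])
      · intro a b _ _ ha hb; simp [ha, hb]
      · intro a b _ hb; simp [hb]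
    have hfr : ∀ s : S, ∃ b ∈ O₂, ∃ c ∈ O₂, b ≠ 0 ∧ ∀ x, b (q x) * s.1 x = c (q x) := by
      intro s
      have : s.1 ∈ orbitSpan f := hS ▸ Submodule.subset_span s.2
      exact exists_frac h₁.toIsAff h₂.sep hi q hq (h₁.orbitSpan_le hf this) (hcon _ this)
    choose b hb c hc' hb0 hbc using hfr
    let B : O₂ := ∏ s : S, ⟨b s, hb s⟩
    have key : ∀ w ∈ orbitSpan f, ∃ c' ∈ O₂, ∀ x, B.1 (q x) * w x = c' (q x) := by
      intro w hw
      rw [← hS] at hw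
      refine Submodule.span_induction (p := fun w _ => ∃ c' ∈ O₂, ∀ x, B.1 (q x) * w x = c' (q x))
        ?_ ?_ ?_ ?_ hw
      · intro s hs
        refine ⟨(∏ t ∈ Finset.univ.erase (⟨s, hs⟩ : S), (⟨b t, hb t⟩ : O₂)).1 * c ⟨s, hs⟩,
          mul_mem (Subtype.prop _) (hc' _), fun x => ?_⟩
        have : B = (∏ t ∈ Finset.univ.erase (⟨s, hs⟩ : S), (⟨b t, hb t⟩ : O₂)) * ⟨b ⟨s, hs⟩, hb _⟩ :=
          (Finset.prod_erase_mul _ _ (Finset.mem_univ _)).symm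
        rw [this]
        have := hbc ⟨s, hs⟩ x
        simp only [MulMemClass.coe_mul, Pi.mul_apply, mul_assoc]
        rw [this]
      · exact ⟨0, O₂.zero_mem, fun x => by simp⟩
      · rintro u v _ _ ⟨u', hu', eu⟩ ⟨v', hv', ev⟩
        exact ⟨u' + v', add_mem hu' hv', fun x => by simp [mul_add, eu, ev]⟩
      · rintro a u _ ⟨u', hu', eu⟩
        exact ⟨a • u', O₂.smul_mem hu' a, fun x => by simp [← eu, mul_left_comm]⟩
    refine ⟨B, fun h => ?_, ?_⟩
    · exact key (rtrans h f) (Submodule.subset_span ⟨h, rfl⟩)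
    · exact Finset.prod_ne_zero_iff.mpr fun s _ h0 => hb0 s (congrArg Subtype.val h0)
  have htop : I = ⊤ := by
    by_contra hI
    obtain ⟨y0, hy0⟩ := h₂.exists_zero hI
    obtain ⟨c, hcI, hc0⟩ := hne
    refine hc0 (Subtype.ext (funext fun y => ?_))
    have := hy0 _ (htr c hcI (y0⁻¹ * y))
    rw [rtransO_apply, mul_inv_cancel_left] at this
    exact this
  obtain ⟨F, hF, e⟩ := (hmem 1).mp (htop ▸ Submodule.mem_top) 1
  exact ⟨F, hF, fun x => by simpa using (e x).symm⟩

/-- Regular maps descend along surjective homomorphisms. -/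
theorem descent_reg (h₁ : IsGrp O₁) (h₂ : IsGrp O₂) (hc : ZConn O₂) (q : X →* Y) (hq : Reg O₁ O₂ q)
    (hs : Function.Surjective q) {W : Type} {O : Subalgebra ℂ (W → ℂ)} {g : Y → W}
    (hg : Reg O₁ O (g ∘ q)) : Reg O₂ O g := by
  intro f hf
  obtain ⟨F, hF, e⟩ := descent h₁ h₂ hc q hq hs (hg f hf) (by
    intro x x' h; simp [h])
  have : f ∘ g = F := by
    funext y
    obtain ⟨x, rfl⟩ := hs y
    exact (e x).symm
  rw [this]; exact hF

theorem map_idComp_surj (h₁ : IsGrp O₁) (h₂ : IsGrp O₂) (hc : ZConn O₂) (q : X →* Y)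
    (hq : Reg O₁ O₂ q) (hs : Function.Surjective q) (y : Y) : ∃ x ∈ idComp h₁, q x = y := by
  classical
  let e : Y → ℂ := fun y => if ∃ x ∈ idComp h₁, q x = y then 1 else 0
  have hinv : ∀ x, ∀ z ∈ idComp h₁, (e ∘ q) (x * z) = (e ∘ q) x := by
    intro x z hz
    have : (∃ x' ∈ idComp h₁, q x' = q (x * z)) ↔ (∃ x' ∈ idComp h₁, q x' = q x) := by
      constructor
      · rintro ⟨x', hx', e⟩
        exact ⟨x' * z⁻¹, mul_mem hx' (inv_mem hz), by simp [e]⟩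
      · rintro ⟨x', hx', e⟩
        exact ⟨x' * z, mul_mem hx' hz, by simp [e]⟩
    simp only [e, Function.comp, this]
  have he : e ∈ O₂ := by
    obtain ⟨F, hF, eF⟩ := descent h₁ h₂ hc q hq hs (mem_of_idComp_inv h₁ (e ∘ q) hinv) (by
      intro x x' h; simp [h])
    have : e = F := by
      funext y
      obtain ⟨x, rfl⟩ := hs y
      exact (eF x).symm
    rw [this]; exact hF
  have h01 : ∀ y, e y = 0 ∨ e y = 1 := fun y => by
    simp only [e]; split_ifs <;> simp
  have := hc e he h01 y 1
  have h1 : e 1 = 1 := if_pos ⟨1, one_mem _, map_one q⟩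
  by_contra hn
  have h0 : e y = 0 := if_neg hn
  rw [h0, h1] at this
  exact zero_ne_one this

/-- If `q` is surjective onto a connected group with kernel in the identity component then the
source is connected. -/
theorem ZConn.of_ker (h₁ : IsGrp O₁) (h₂ : IsGrp O₂) (hc : ZConn O₂) (q : X →* Y)
    (hq : Reg O₁ O₂ q) (hs : Function.Surjective q) (hk : ∀ x, q x = 1 → x ∈ idComp h₁) :
    ZConn O₁ := by
  have hall : ∀ x, x ∈ idComp h₁ := by
    intro x
    obtain ⟨z, hz, e⟩ := map_idComp_surj h₁ h₂ hc q hq hs (q x)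
    have : z⁻¹ * x ∈ idComp h₁ := hk _ (by simp [e])
    simpa using mul_mem hz this
  intro e he h01 x y
  rw [hall x e he h01, hall y e he h01]

theorem ZConn.of_bij (h₁ : IsGrp O₁) (h₂ : IsGrp O₂) (hc : ZConn O₂) (q : X →* Y)
    (hq : Reg O₁ O₂ q) (hb : Function.Bijective q) : ZConn O₁ :=
  ZConn.of_ker h₁ h₂ hc q hq hb.2 fun x hx => by
    rw [hb.1 (hx.trans (map_one q).symm)]; exact one_mem _

end AlgGrp

namespace AlgGrp

variable {X Y Z : Type} {O₁ : Subalgebra ℂ (X → ℂ)} {O₂ : Subalgebra ℂ (Y → ℂ)}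
  {O₃ : Subalgebra ℂ (Z → ℂ)}

/-! ### Regular functions on embedded affine algebraic groups -/

lemma eval_mem {n : ℕ} {c : X → Pt n} (hc : ∀ i, (fun x => c x i) ∈ O₁)
    (p : MvPolynomial (Fin n) ℂ) : (fun x => eval (c x) p) ∈ O₁ := by
  induction p using MvPolynomial.induction_on with
  | C a =>
    simp only [eval_C]
    exact O₁.algebraMap_mem a
  | add p q hp hq =>
    have := add_mem hp hq
    simpa [Pi.add_def] using this
  | mul_X p i hp =>
    have := mul_mem hp (hc i)
    simpa [Pi.mul_def] using this

/-- The algebra of regular functions on an affine algebraic group. -/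
def OG (G : AffAlgGroup) : Subalgebra ℂ (G.Gp → ℂ) :=
  (aeval (fun i => fun x : G.Gp => x.1 i) : MvPolynomial (Fin G.n) ℂ →ₐ[ℂ] (G.Gp → ℂ)).range

variable {G H : AffAlgGroup}

lemma aeval_coord_apply (p : MvPolynomial (Fin G.n) ℂ) (x : G.Gp) :
    (aeval (fun i => fun x : G.Gp => x.1 i) p : G.Gp → ℂ) x = eval x.1 p := by
  induction p using MvPolynomial.induction_on with
  | C a => simp
  | add p q hp hq => simp [hp, hq]
  | mul_X p i hp => simp [hp]

lemma mem_OG {f : G.Gp → ℂ} : f ∈ OG G ↔ ∃ p, ∀ x : G.Gp, f x = eval x.1 p := by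
  constructor
  · rintro ⟨p, rfl⟩
    exact ⟨p, aeval_coord_apply p⟩
  · rintro ⟨p, hp⟩
    refine ⟨p, ?_⟩
    funext x
    exact (aeval_coord_apply p x).trans (hp x).symm

lemma coord_mem_OG (i : Fin G.n) : (fun x : G.Gp => x.1 i) ∈ OG G :=
  mem_OG.mpr ⟨MvPolynomial.X i, fun x => by simp⟩

lemma reg_OG {g : X → G.Gp} (h : ∀ i, (fun x => (g x).1 i) ∈ O₁) : Reg O₁ (OG G) g := by
  intro f hf
  obtain ⟨p, hp⟩ := mem_OG.mp hf
  have := eval_mem h p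
  convert this using 1
  funext x
  exact hp _

lemma isAff_OG (G : AffAlgGroup) : IsAff (OG G) where
  fg := by
    rw [OG, ← Algebra.map_top]
    exact Subalgebra.FG.map _ Algebra.FiniteType.out
  point φ := by
    let x : Pt G.n := fun i => φ ⟨_, coord_mem_OG i⟩
    have key : ∀ p : MvPolynomial (Fin G.n) ℂ,
        φ ⟨fun y => eval y.1 p, mem_OG.mpr ⟨p, fun _ => rfl⟩⟩ = eval x p := by
      intro p
      induction p using MvPolynomial.induction_on with
      | C a =>
        rw [eval_C]
        exact (congrArg φ (Subtype.ext (by funext y; simp [Algebra.algebraMap_eq_smul_one]))).trans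
          (φ.commutes a)
      | add p q hp hq =>
        rw [map_add, ← hp, ← hq, ← map_add]
        exact congrArg φ (Subtype.ext (by funext y; simp))
      | mul_X p i hp =>
        rw [map_mul, ← hp, eval_X, ← map_mul]
        exact congrArg φ (Subtype.ext (by funext y; simp))
    have hx : x ∈ G.carrier := by
      obtain ⟨S, hS⟩ := G.isAlgebraic
      rw [hS]
      intro p hp
      rw [← key, ← map_zero φ]
      congr 1
      apply Subtype.ext
      funext y
      have : ∀ z ∈ G.carrier, eval z p = 0 := fun z hz => by rw [hS] at hz; exact hz p hp
      exact this _ y.2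
    refine ⟨⟨x, hx⟩, fun f => ?_⟩
    obtain ⟨p, hp⟩ := mem_OG.mp f.2
    have : f = ⟨fun y => eval y.1 p, mem_OG.mpr ⟨p, fun _ => rfl⟩⟩ := Subtype.ext (funext hp)
    rw [this, key]
  sep x y h := Subtype.ext (funext fun i => h _ (coord_mem_OG i))

lemma isGrp_OG (G : AffAlgGroup) : IsGrp (OG G) where
  toIsAff := isAff_OG G
  mul := by
    obtain ⟨P, hP⟩ := G.mul_regular
    refine reg_OG fun i => ?_
    let c : G.Gp × G.Gp → Pt (G.n + G.n) := fun z => Fin.append z.1.1 z.2.1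
    have hl : ∀ z, Pt.left (c z) = z.1.1 := fun z => by funext j; exact Fin.append_left _ _ j
    have hr : ∀ z, Pt.right (c z) = z.2.1 := fun z => by funext j; exact Fin.append_right _ _ j
    have hc : ∀ j, (fun z => c z j) ∈ prodAlg (OG G) (OG G) := by
      intro j
      refine Fin.addCases (fun j => ?_) (fun j => ?_) j
      · convert reg_fst (O₁ := OG G) (O₂ := OG G) _ (coord_mem_OG j) using 1
        funext z; exact Fin.append_left _ _ j
      · convert reg_snd (O₁ := OG G) (O₂ := OG G) _ (coord_mem_OG j) using 1
        funext z; exact Fin.append_right _ _ j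
    convert eval_mem hc (P i) using 1
    funext z
    have := hP (c z) ⟨by rw [hl]; exact z.1.2, by rw [hr]; exact z.2.2⟩ i
    simp only [hl, hr] at this
    exact this
  inv := by
    obtain ⟨P, hP⟩ := G.inv_regular
    exact reg_OG fun i => mem_OG.mpr ⟨P i, fun x => hP x.1 x.2 i⟩

lemma reg_toGpHom (f : AlgGroupHom G H) : Reg (OG G) (OG H) f.toGpHom := by
  obtain ⟨P, hP⟩ := f.regular
  exact reg_OG fun i => mem_OG.mpr ⟨P i, fun x => hP x.1 x.2 i⟩

lemma exists_algGroupHom (g : G.Gp →* H.Gp) (hg : Reg (OG G) (OG H) g) :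
    ∃ f : AlgGroupHom G H, ∀ x : G.Gp, f.toFun x.1 = (g x).1 := by
  have : ∀ i, ∃ p, ∀ x : G.Gp, (g x).1 i = eval x.1 p :=
    fun i => mem_OG.mp (hg _ (coord_mem_OG i))
  choose P hP using this
  have key : ∀ x : G.Gp, (fun i => eval x.1 (P i)) = (g x).1 := fun x => funext fun i => (hP i x).symm
  refine ⟨{ toFun := fun x i => eval x (P i)
            maps_to := fun {x} hx => by
              let x' : G.Gp := ⟨x, hx⟩
              have := (g x').2
              rw [← key x'] at this; exact this
            map_mul := fun {x y} hx hy => ?_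
            regular := ⟨P, fun _ _ _ => rfl⟩ }, key⟩
  let x' : G.Gp := ⟨x, hx⟩
  let y' : G.Gp := ⟨y, hy⟩
  have h1 := key (x' * y')
  rw [map_mul] at h1
  have h2 := key x'
  have h3 := key y'
  exact h1.trans (congrArg₂ H.mul h2.symm h3.symm)

lemma zconn_OG (h : G.IsConnected) : ZConn (OG G) := by
  intro e he h01 x y
  obtain ⟨p, hp⟩ := mem_OG.mp he
  have hcl : ∀ p : MvPolynomial (Fin G.n) ℂ, IsAlgebraicSet {x : Pt G.n | eval x p = 0} :=
    fun p => ⟨{p}, by simp⟩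
  have := h _ _ (hcl p) (hcl (p - 1)) (by
    intro x hx
    let x' : G.Gp := ⟨x, hx⟩
    have := h01 x'
    rw [hp x'] at this
    rcases this with h | h
    · exact Or.inl h
    · exact Or.inr (by simpa [sub_eq_zero] using h)) (by
    ext x
    simp only [Set.mem_inter_iff, Set.mem_ofPred_eq, Set.mem_empty_iff_false, iff_false]
    rintro ⟨-, h1, h2⟩
    simp [h1] at h2)
  rcases this with h | h
  · rw [hp, hp, show eval x.1 p = 0 from h x.2, show eval y.1 p = 0 from h y.2]
  · have e1 : eval x.1 (p - 1) = 0 := h x.2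
    have e2 : eval y.1 (p - 1) = 0 := h y.2
    simp only [map_sub, map_one] at e1 e2
    rw [hp, hp, sub_eq_zero.mp e1, sub_eq_zero.mp e2]

lemma zclosed_toSubgroup (K : AlgSubgroup G) : ZClosed (OG G) (K.toSubgroup : Set G.Gp) := by
  intro x hx
  obtain ⟨S, hS⟩ := K.isAlgebraic
  change x.1 ∈ K.carrier
  rw [hS]
  intro p hp
  refine hx (fun y => eval y.1 p) (mem_OG.mpr ⟨p, fun _ => rfl⟩) fun s hs => ?_
  have : s.1 ∈ K.carrier := hs
  rw [hS] at this
  exact this p hp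

lemma zconn_toSubgroup (K : AlgSubgroup G) (h : K.toGrp.IsConnected) :
    ZConn (res (OG G) K.toSubgroup.subtype) := by
  refine (zconn_OG h).of_surj (g := fun x => ⟨⟨x.1, K.subset x.2⟩, x.2⟩) ?_ ?_
  · exact reg_to_res (reg_OG fun i => coord_mem_OG (G := K.toGrp) i)
  · rintro ⟨⟨x, hx⟩, hx'⟩
    exact ⟨⟨x, hx'⟩, rfl⟩

lemma gp_mul_val (x y : G.Gp) : (x * y).1 = G.mul x.1 y.1 := rfl

end AlgGrp

namespace AlgGrp

/-! ### Tori -/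

/-- `A` is a torus with coordinate characters `u`. -/
structure IsTor {A : Type} [CommGroup A] {k : ℕ} (OA : Subalgebra ℂ (A → ℂ))
    (u : Fin k → A →* ℂˣ) : Prop extends IsGrp OA where
  bij : Function.Bijective (fun a j => u j a)
  gen : OA = Algebra.adjoin ℂ (Set.range (fun j a => (u j a : ℂ)) ∪
    Set.range (fun j a => (((u j a)⁻¹ : ℂˣ) : ℂ)))

section Tor
variable {A : Type} [CommGroup A] {k : ℕ} {OA : Subalgebra ℂ (A → ℂ)} {u : Fin k → A →* ℂˣ}
variable {Y : Type} {O₂ : Subalgebra ℂ (Y → ℂ)}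

lemma IsTor.u_mem (h : IsTor OA u) (j : Fin k) : (fun a => (u j a : ℂ)) ∈ OA := by
  rw [h.gen]
  exact Algebra.subset_adjoin (Or.inl ⟨j, rfl⟩)

lemma IsTor.reg (h : IsTor OA u) {g : Y → A} (h1 : ∀ j, (fun y => (u j (g y) : ℂ)) ∈ O₂)
    (h2 : ∀ j, (fun y => (((u j (g y))⁻¹ : ℂˣ) : ℂ)) ∈ O₂) : Reg O₂ OA g := by
  have : OA ≤ O₂.comap (pull g) := by
    rw [h.gen]
    refine Algebra.adjoin_le ?_
    rintro _ (⟨j, rfl⟩ | ⟨j, rfl⟩)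
    · exact h1 j
    · exact h2 j
  exact fun f hf => this hf

lemma IsTor.conn (h : IsTor OA u) : ZConn OA := by
  have hfin := idComp_finite h.toIsGrp
  have hfi : (idComp h.toIsGrp).FiniteIndex := Subgroup.finiteIndex_of_finite_quotient
  have hn : (idComp h.toIsGrp).index ≠ 0 := Subgroup.FiniteIndex.index_ne_zero
  have hall : ∀ x, x ∈ idComp h.toIsGrp := by
    intro x
    have : ∀ j, ∃ z : ℂˣ, z ^ (idComp h.toIsGrp).index = u j x := by
      intro j
      obtain ⟨z, hz⟩ := IsAlgClosed.exists_pow_nat_eq (u j x : ℂ) (Nat.pos_of_ne_zero hn)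
      have hz0 : z ≠ 0 := by
        rintro rfl
        rw [zero_pow hn] at hz
        exact (u j x).ne_zero hz.symm
      exact ⟨Units.mk0 z hz0, Units.ext (by simpa using hz)⟩
    choose z hz using this
    obtain ⟨y, hy⟩ := h.bij.2 z
    have : y ^ (idComp h.toIsGrp).index = x := by
      apply h.bij.1
      funext j
      simp only [map_pow]
      rw [← hz j, ← hy]
    rw [← this]
    exact Subgroup.pow_index_mem _ y
  intro e he h01 x y
  rw [hall x e he h01, hall y e he h01]

lemma IsTor.le_span (h : IsTor OA u) : ∀ f ∈ OA, f ∈ Submodule.span ℂ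
    (Set.range fun χ : A →* ℂ => (χ : A → ℂ)) := by
  intro f hf
  rw [h.gen, ← Subalgebra.mem_toSubmodule, Algebra.adjoin_eq_span] at hf
  refine Submodule.span_mono ?_ hf
  intro g hg
  refine Submonoid.closure_induction (motive := fun g _ => g ∈ Set.range fun χ : A →* ℂ => (χ : A → ℂ))
    ?_ ⟨1, rfl⟩ ?_ hg
  · rintro _ (⟨j, rfl⟩ | ⟨j, rfl⟩)
    · exact ⟨(Units.coeHom ℂ).comp (u j), rfl⟩
    · exact ⟨(Units.coeHom ℂ).comp (u j)⁻¹, rfl⟩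
  · rintro _ _ _ _ ⟨χ, rfl⟩ ⟨ψ, rfl⟩
    exact ⟨χ * ψ, rfl⟩

end Tor

/-! ### Central extensions by tori -/

/-- A central extension `A → E → G` of a connected group by a torus. -/
structure TorExt {A E G : Type} [CommGroup A] [Group E] [Group G] {k : ℕ}
    (OA : Subalgebra ℂ (A → ℂ)) (OE : Subalgebra ℂ (E → ℂ)) (OG : Subalgebra ℂ (G → ℂ))
    (u : Fin k → A →* ℂˣ) (i : A →* E) (q : E →* G) : Prop where
  tor : IsTor OA u
  hE : IsGrp OE
  hG : IsGrp OG
  cG : ZConn OG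
  iReg : Reg OA OE i
  qReg : Reg OE OG q
  i_inj : Function.Injective i
  q_surj : Function.Surjective q
  exact : ∀ x, q x = 1 ↔ ∃ a, i a = x
  central : ∀ a x, i a * x = x * i a

section Ext
variable {A E G : Type} [CommGroup A] [Group E] [Group G] {k : ℕ}
  {OA : Subalgebra ℂ (A → ℂ)} {OE : Subalgebra ℂ (E → ℂ)} {OG : Subalgebra ℂ (G → ℂ)}
  {u : Fin k → A →* ℂˣ} {i : A →* E} {q : E →* G}
variable {Y : Type} {O₂ : Subalgebra ℂ (Y → ℂ)}

lemma TorExt.qi (h : TorExt OA OE OG u i q) (a : A) : q (i a) = 1 := (h.exact _).mpr ⟨a, rfl⟩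

lemma TorExt.conn (h : TorExt OA OE OG u i q) : ZConn OE :=
  ZConn.of_ker h.hE h.hG h.cG q h.qReg h.q_surj fun x hx => by
    obtain ⟨a, rfl⟩ := (h.exact x).mp hx
    exact h.tor.conn.map_idComp h.hE i h.iReg a

lemma zclosed_one {X : Type} [Group X] {O : Subalgebra ℂ (X → ℂ)} (h : IsGrp O) :
    ZClosed O ({1} : Set X) := by
  have : ({1} : Set X) = {x | (fun x => x) x = (fun _ => 1) x} := by ext; simp
  rw [this]
  exact ZClosed.eqLocus_reg h.toIsAff (Reg.id _) (Reg.const _ _ 1)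

lemma zclosed_ker {X Y : Type} [Group X] [Group Y] {O₁ : Subalgebra ℂ (X → ℂ)}
    {O₂ : Subalgebra ℂ (Y → ℂ)} (h : IsGrp O₂) {q : X →* Y} (hq : Reg O₁ O₂ q) :
    ZClosed O₁ (q.ker : Set X) :=
  (zclosed_one h).preimage hq

lemma TorExt.ker_grp (h : TorExt OA OE OG u i q) : IsGrp (res OE q.ker.subtype) :=
  h.hE.resSub _ (zclosed_ker h.hG h.qReg)

/-- The isomorphism of the torus onto the kernel. -/
def TorExt.toKer (h : TorExt OA OE OG u i q) : A →* q.ker :=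
  i.codRestrict q.ker h.qi

lemma TorExt.toKer_surj (h : TorExt OA OE OG u i q) : Function.Surjective h.toKer := by
  rintro ⟨x, hx⟩
  obtain ⟨a, rfl⟩ := (h.exact x).mp hx
  exact ⟨a, rfl⟩

lemma TorExt.toKer_reg (h : TorExt OA OE OG u i q) : Reg OA (res OE q.ker.subtype) h.toKer :=
  reg_to_res h.iReg

lemma TorExt.descent_ker (h : TorExt OA OE OG u i q) {W : Type} {O : Subalgebra ℂ (W → ℂ)}
    {g : q.ker → W} (hg : Reg OA O (g ∘ h.toKer)) : Reg (res OE q.ker.subtype) O g :=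
  descent_reg h.tor.toIsGrp h.ker_grp (h.tor.conn.of_surj h.toKer_reg h.toKer_surj) h.toKer
    h.toKer_reg h.toKer_surj hg

lemma TorExt.reg_of_comp_i (h : TorExt OA OE OG u i q) {g : Y → A} (hg : Reg O₂ OE (i ∘ g)) :
    Reg O₂ OA g := by
  let r : q.ker → A := fun x => Function.invFun h.toKer x
  have hinj : Function.Injective h.toKer := fun a b hab => h.i_inj (congrArg Subtype.val hab)
  have hr : ∀ a, r (h.toKer a) = a := Function.leftInverse_invFun hinj
  have h1 : Reg (res OE q.ker.subtype) OA r := by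
    refine h.descent_ker ?_
    have : r ∘ h.toKer = fun a => a := funext hr
    rw [this]
    exact Reg.id _
  have h2 : Reg O₂ (res OE q.ker.subtype) (h.toKer ∘ g) := reg_to_res hg
  have h3 : g = r ∘ (h.toKer ∘ g) := by funext y; simp [hr]
  rw [h3]
  exact h1.comp h2

lemma TorExt.exists_extend (h : TorExt OA OE OG u i q) {f : A → ℂ} (hf : f ∈ OA) :
    ∃ F ∈ OE, ∀ a, F (i a) = f a := by
  have hinj : Function.Injective h.toKer := fun a b hab => h.i_inj (congrArg Subtype.val hab)
  obtain ⟨F, hF, e⟩ := descent h.tor.toIsGrp h.ker_grp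
    (h.tor.conn.of_surj h.toKer_reg h.toKer_surj) h.toKer h.toKer_reg h.toKer_surj hf
    (fun a b hab => congrArg f (hinj hab))
  obtain ⟨F', hF', rfl⟩ := hF
  exact ⟨F', hF', e⟩

lemma TorExt.exists_weight (h : TorExt OA OE OG u i q) (j : Fin k) :
    ∃ w ∈ OE, w ≠ 0 ∧ ∀ a x, w (i a * x) = u j a * w x := by
  classical
  obtain ⟨f, hf, hfi⟩ := h.exists_extend (h.tor.u_mem j)
  have hreg : Reg (prodAlg OA OE) OE (fun p => i p.1 * p.2) :=
    h.hE.mulReg (h.iReg.comp reg_fst) reg_snd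
  obtain ⟨S, hS⟩ := mem_prodAlg_iff.mp (hreg f hf)
  have hex : ∀ s : OA × OE, ∃ c : (A →* ℂ) →₀ ℂ, ∀ a, s.1.1 a = c.sum fun χ z => z * χ a := by
    intro s
    obtain ⟨c, hc⟩ := (Finsupp.mem_span_range_iff_exists_finsupp).mp (h.tor.le_span _ s.1.2)
    refine ⟨c, fun a => ?_⟩
    rw [← hc, Finsupp.sum, Finset.sum_apply]
    rfl
  choose c hc using hex
  let T : Finset (A →* ℂ) := S.biUnion fun s => (c s).support
  let w : (A →* ℂ) → E → ℂ := fun χ x => ∑ s ∈ S, c s χ * s.2.1 x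
  have hw : ∀ χ, w χ ∈ OE := by
    intro χ
    have : w χ = ∑ s ∈ S, c s χ • s.2.1 := by
      funext x; simp [w, Finset.sum_apply]
    rw [this]
    exact sum_mem fun s _ => OE.smul_mem s.2.2 _
  have hfw : ∀ a x, f (i a * x) = ∑ χ ∈ T, χ a * w χ x := by
    intro a x
    have := hS a x
    simp only [Function.comp] at this
    rw [this]
    simp only [w, Finset.mul_sum]
    rw [Finset.sum_comm]
    refine Finset.sum_congr rfl fun s hs => ?_
    rw [hc, Finsupp.sum_of_support_subset (s := T) _ (Finset.subset_biUnion_of_mem (fun s => (c s).support) hs)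
      _ (by simp), Finset.sum_mul]
    exact Finset.sum_congr rfl fun χ _ => by ring
  have hwT : ∀ χ ∉ T, w χ = 0 := by
    intro χ hχ
    funext x
    refine Finset.sum_eq_zero fun s hs => ?_
    have : c s χ = 0 := by
      by_contra h0
      exact hχ (Finset.mem_biUnion.mpr ⟨s, hs, Finsupp.mem_support_iff.mpr h0⟩)
    simp [this]
  have hli : LinearIndependent ℂ (fun χ : A →* ℂ => (χ : A → ℂ)) := linearIndependent_monoidHom A ℂ
  have huniq : ∀ (T : Finset (A →* ℂ)) (g : (A →* ℂ) → ℂ), (∀ a, ∑ χ ∈ T, g χ * χ a = 0) → ∀ χ ∈ T, g χ = 0 := by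
    intro T g hg
    refine linearIndependent_iff'.mp hli T g ?_
    funext a
    rw [Finset.sum_apply]
    exact hg a
  let χ₀ : A →* ℂ := (Units.coeHom ℂ).comp (u j)
  have hweight : ∀ χ b x, w χ (i b * x) = χ b * w χ x := by
    intro χ b x
    by_cases hχ : χ ∈ T
    · have := huniq T (fun χ => w χ (i b * x) - χ b * w χ x) (by
        intro a
        have e1 := hfw (a * b) x
        have e2 := hfw a (i b * x)
        rw [← mul_assoc, ← map_mul, e1, eq_comm, ← sub_eq_zero, ← Finset.sum_sub_distrib] at e2
        rw [← e2]
        refine Finset.sum_congr rfl fun χ _ => ?_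
        rw [map_mul]; ring) χ hχ
      exact sub_eq_zero.mp this
    · simp [hwT χ hχ]
  refine ⟨w χ₀, hw _, fun h0 => ?_, fun a x => hweight χ₀ a x⟩
  have := huniq (insert χ₀ T) (fun χ => w χ 1 - if χ = χ₀ then 1 else 0) (by
    intro a
    have e1 := hfw a 1
    rw [mul_one, hfi] at e1
    have e2 : ∑ χ ∈ insert χ₀ T, w χ 1 * χ a = ∑ χ ∈ T, χ a * w χ 1 := by
      rw [← Finset.sum_subset (Finset.subset_insert χ₀ T) (fun χ _ hχ => by simp [hwT χ hχ])]
      exact Finset.sum_congr rfl fun χ _ => mul_comm _ _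
    simp only [sub_mul, Finset.sum_sub_distrib, e2, ← e1, ite_mul, one_mul, zero_mul]
    simp [χ₀]) χ₀ (Finset.mem_insert_self _ _)
  simp [h0] at this

end Ext

/-! ### Irreducible translation-stable spaces of weight functions -/

/-- A right translation stable finite dimensional nonzero irreducible space of regular functions. -/
structure IrrSp {E : Type} [Group E] (OE : Subalgebra ℂ (E → ℂ)) (V : Submodule ℂ (E → ℂ)) :
    Prop where
  fd : FiniteDimensional ℂ V
  ne : V ≠ ⊥
  le : ∀ w ∈ V, w ∈ OE
  stable : ∀ g, ∀ w ∈ V, rtrans g w ∈ V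
  irr : ∀ W ≤ V, W ≠ ⊥ → (∀ g, ∀ w ∈ W, rtrans g w ∈ W) → W = V

section Irr
variable {E : Type} [Group E] {OE : Subalgebra ℂ (E → ℂ)}

lemma exists_irrSp (hE : IsGrp OE) {U : Submodule ℂ (E → ℂ)} (hU : ∀ g, ∀ w ∈ U, rtrans g w ∈ U)
    {w : E → ℂ} (hw : w ∈ OE) (hwU : w ∈ U) (hw0 : w ≠ 0) : ∃ V ≤ U, IrrSp OE V := by
  classical
  let P : ℕ → Prop := fun n => ∃ V ≤ U, FiniteDimensional ℂ V ∧ V ≠ ⊥ ∧ (∀ w ∈ V, w ∈ OE) ∧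
    (∀ g, ∀ w ∈ V, rtrans g w ∈ V) ∧ Module.finrank ℂ V = n
  have hex : ∃ n, P n := by
    refine ⟨_, orbitSpan w, ?_, hE.orbitSpan_finite hw, ?_, fun v hv => hE.orbitSpan_le hw hv,
      fun g v hv => orbitSpan_stable w g hv, rfl⟩
    · refine Submodule.span_le.mpr ?_
      rintro _ ⟨g, rfl⟩
      exact hU g w hwU
    · intro h0
      have := mem_orbitSpan w
      rw [h0] at this
      exact hw0 ((Submodule.mem_bot ℂ).mp this)
  obtain ⟨V, hVU, hfd, hne, hle, hst, hn⟩ := Nat.find_spec hex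
  refine ⟨V, hVU, hfd, hne, hle, hst, fun W hWV hW0 hWst => ?_⟩
  have hWfd : FiniteDimensional ℂ W := Submodule.finiteDimensional_of_le hWV
  have := Nat.find_min' hex ⟨W, hWV.trans hVU, hWfd, hW0, fun w hw => hle w (hWV hw), hWst, rfl⟩
  rw [← hn] at this
  exact Submodule.eq_of_le_of_finrank_le hWV this

variable {V : Submodule ℂ (E → ℂ)}

/-- The representation by right translations. -/
def IrrSp.rho (h : IrrSp OE V) : E →* Module.End ℂ V where
  toFun g := (rtrans g).toLinearMap.restrict (h.stable g)
  map_one' := by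
    ext w : 2
    exact rtrans_one w.1
  map_mul' g g' := by
    ext w : 2
    exact rtrans_mul g g' w.1

lemma IrrSp.rho_apply (h : IrrSp OE V) (g : E) (w : V) (x : E) : (h.rho g w).1 x = w.1 (x * g) := rfl

/-- Linear functionals on a finite dimensional space of functions are combinations of
evaluations. -/
lemma dual_eq_eval {X : Type} (V : Submodule ℂ (X → ℂ)) [FiniteDimensional ℂ V]
    (ℓ : Module.Dual ℂ V) : ∃ c : X →₀ ℂ, ∀ w : V, ℓ w = c.sum fun x z => z * w.1 x := by
  let ev : X → Module.Dual ℂ V := fun x => (LinearMap.proj x).comp V.subtype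
  have htop : Submodule.span ℂ (Set.range ev) = ⊤ := by
    suffices hb : (Submodule.span ℂ (Set.range ev)).dualCoannihilator = ⊥ by
      rw [← Subspace.dualCoannihilator_dualAnnihilator_eq (W := Submodule.span ℂ (Set.range ev)),
        hb, Submodule.dualAnnihilator_bot]
    rw [eq_bot_iff]
    intro w hw
    rw [Submodule.mem_dualCoannihilator] at hw
    refine (Submodule.mem_bot ℂ).mpr (Subtype.ext (funext fun x => ?_))
    exact hw (ev x) (Submodule.subset_span ⟨x, rfl⟩)
  obtain ⟨c, hc⟩ := Finsupp.mem_span_range_iff_exists_finsupp.mp (htop ▸ Submodule.mem_top : ℓ ∈ _)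
  refine ⟨c, fun w => ?_⟩
  rw [← hc, Finsupp.sum, LinearMap.sum_apply]
  rfl

lemma IrrSp.coeff_mem (h : IrrSp OE V) (hE : IsGrp OE) (ℓ : Module.Dual ℂ V) (w : V) :
    (fun g => ℓ (h.rho g w)) ∈ OE := by
  have := h.fd
  obtain ⟨c, hc⟩ := dual_eq_eval V ℓ
  have : (fun g => ℓ (h.rho g w)) = ∑ x ∈ c.support, c x • (w.1 ∘ fun g => x * g) := by
    funext g
    rw [hc, Finset.sum_apply]
    rfl
  rw [this]
  exact sum_mem fun x _ => OE.smul_mem (hE.left x _ (h.le _ w.2)) _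

/-- The determinant character. -/
def IrrSp.delta (h : IrrSp OE V) : E →* ℂ := LinearMap.det.comp h.rho

lemma IrrSp.delta_ne_zero (h : IrrSp OE V) (g : E) : h.delta g ≠ 0 := by
  have : h.delta g * h.delta g⁻¹ = 1 := by rw [← map_mul, mul_inv_cancel, map_one]
  exact left_ne_zero_of_mul_eq_one this

lemma IrrSp.delta_mem (h : IrrSp OE V) (hE : IsGrp OE) : (h.delta : E → ℂ) ∈ OE := by
  classical
  have := h.fd
  let b := Module.finBasis ℂ V
  have hd : ∀ g, h.delta g = (LinearMap.toMatrix b b (h.rho g)).det :=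
    fun g => (LinearMap.det_toMatrix b _).symm
  have : (h.delta : E → ℂ) = ∑ σ : Equiv.Perm (Fin (Module.finrank ℂ V)),
      (Equiv.Perm.sign σ : ℤ) • ∏ i, (fun g => b.coord (σ i) (h.rho g (b i))) := by
    funext g
    rw [hd, Matrix.det_apply, Finset.sum_apply]
    refine Finset.sum_congr rfl fun σ _ => ?_
    rw [Pi.smul_apply, Finset.prod_apply]
    simp [LinearMap.toMatrix_apply, Units.smul_def]
  rw [this]
  exact sum_mem fun σ _ => zsmul_mem (prod_mem fun i _ => h.coeff_mem hE _ _) _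

end Irr

end AlgGrp

namespace AlgGrp

/-! ### Generalized eigenspaces of algebra endomorphisms and unipotent groups -/

section GenEig
variable {B : Type} [CommRing B] [Algebra ℂ B]

lemma mem_maxGenEigenspace_of_sub {M : Type} [AddCommGroup M] [Module ℂ M] (T : Module.End ℂ M)
    (μ : ℂ) {x : M} (h : T x - μ • x ∈ T.maxGenEigenspace μ) : x ∈ T.maxGenEigenspace μ := by
  obtain ⟨n, hn⟩ := (Module.End.mem_maxGenEigenspace T μ _).mp h
  refine (Module.End.mem_maxGenEigenspace T μ _).mpr ⟨n + 1, ?_⟩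
  rw [pow_succ, Module.End.mul_apply]
  simpa using hn

lemma maxGenEigenspace_mul_aux (T : B →ₐ[ℂ] B) (α β : ℂ) (N : ℕ) : ∀ (n m : ℕ) (a b : B), n + m ≤ N →
    ((T.toLinearMap - α • (1 : Module.End ℂ B)) ^ n) a = 0 →
    ((T.toLinearMap - β • (1 : Module.End ℂ B)) ^ m) b = 0 →
    a * b ∈ Module.End.maxGenEigenspace T.toLinearMap (α * β) := by
  induction N with
  | zero =>
    intro n m a b hnm ha hb
    obtain rfl : n = 0 := by omega
    have : a = 0 := by simpa using ha
    simp [this]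
  | succ N ih =>
    intro n m a b hnm ha hb
    rcases n with _ | n
    · have : a = 0 := by simpa using ha
      simp [this]
    rcases m with _ | m
    · have : b = 0 := by simpa using hb
      simp [this]
    refine mem_maxGenEigenspace_of_sub _ _ ?_
    have e : T.toLinearMap (a * b) - (α * β) • (a * b) =
        (T a - α • a) * T b + (α • a) * (T b - β • b) := by
      simp only [AlgHom.toLinearMap_apply, map_mul, Algebra.smul_def]; ring
    rw [e]
    have ha' : ((T.toLinearMap - α • (1 : Module.End ℂ B)) ^ n) (T a - α • a) = 0 := by
      rw [pow_succ, Module.End.mul_apply] at ha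
      simpa using ha
    have hb' : ((T.toLinearMap - β • (1 : Module.End ℂ B)) ^ m) (T b - β • b) = 0 := by
      rw [pow_succ, Module.End.mul_apply] at hb
      simpa using hb
    have hb'' : ((T.toLinearMap - β • (1 : Module.End ℂ B)) ^ (m + 1)) (T b) = 0 := by
      have hc : Commute ((T.toLinearMap - β • (1 : Module.End ℂ B)) ^ (m + 1)) T.toLinearMap :=
        ((Commute.refl _).sub_left ((Commute.one_left _).smul_left β)).pow_left _
      have := LinearMap.congr_fun hc.eq b
      rw [Module.End.mul_apply, Module.End.mul_apply, hb, map_zero] at this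
      exact this
    refine add_mem (ih _ _ _ _ (by omega) ha' hb'') (ih (n + 1) m _ _ (by omega) ?_ hb')
    rw [map_smul, ha, smul_zero]

lemma maxGenEigenspace_mul (T : B →ₐ[ℂ] B) {α β : ℂ} {a b : B}
    (ha : a ∈ Module.End.maxGenEigenspace T.toLinearMap α)
    (hb : b ∈ Module.End.maxGenEigenspace T.toLinearMap β) :
    a * b ∈ Module.End.maxGenEigenspace T.toLinearMap (α * β) := by
  obtain ⟨n, hn⟩ := (Module.End.mem_maxGenEigenspace _ _ _).mp ha
  obtain ⟨m, hm⟩ := (Module.End.mem_maxGenEigenspace _ _ _).mp hb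
  exact maxGenEigenspace_mul_aux T α β _ n m a b le_rfl hn hm

end GenEig

/-- `φ` is a faithful unitriangular representation. -/
structure IsUnip {U : Type} [Group U] (O : Subalgebra ℂ (U → ℂ)) {m : ℕ}
    (φ : U →* Matrix (Fin m) (Fin m) ℂ) : Prop where
  reg : ∀ i j, (fun x => φ x i j) ∈ O
  inj : Function.Injective φ
  diag : ∀ x i, φ x i i = 1
  low : ∀ x i j, j < i → φ x i j = 0

section Unip
variable {U : Type} [Group U] {O : Subalgebra ℂ (U → ℂ)} {m : ℕ}
  {φ : U →* Matrix (Fin m) (Fin m) ℂ}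

lemma IsUnip.entry_mem (h : IsUnip O φ) (g : U) (i j : Fin m) :
    (fun x => φ x i j) ∈ Module.End.maxGenEigenspace (rtrans g).toLinearMap 1 := by
  induction j using WellFoundedLT.induction with
  | _ j ih =>
  refine mem_maxGenEigenspace_of_sub _ _ ?_
  have : (rtrans g).toLinearMap (fun x => φ x i j) - (1 : ℂ) • (fun x => φ x i j) =
      ∑ l ∈ Finset.univ.filter (· < j), φ g l j • (fun x => φ x i l) := by
    funext x
    simp only [AlgHom.toLinearMap_apply, Pi.sub_apply, rtrans_apply, map_mul, Matrix.mul_apply,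
      one_smul, Finset.sum_apply, Pi.smul_apply, smul_eq_mul]
    rw [Finset.sum_filter, ← Finset.sum_erase_add _ _ (Finset.mem_univ j), h.diag, mul_one,
      add_sub_cancel_right, ← Finset.sum_erase_add _ _ (Finset.mem_univ j), if_neg (lt_irrefl j),
      add_zero]
    refine Finset.sum_congr rfl fun l hl => ?_
    split_ifs with hlj
    · ring
    · rw [h.low g l j (lt_of_le_of_ne (not_lt.mp hlj) (Finset.ne_of_mem_erase hl).symm), mul_zero]
  rw [this]
  exact sum_mem fun l hl => Submodule.smul_mem _ _ (ih l (Finset.mem_filter.mp hl).2)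

/-- Semi-invariant functions on a unipotent group are invariant. -/
lemma IsUnip.eigenvalue (h : IsUnip O φ) (hO : IsGrp O) (hc : ZConn O) {f : U → ℂ} (hf : f ∈ O)
    (hf0 : f ≠ 0) {g : U} {μ : ℂ} (hg : ∀ x, f (x * g) = μ * f x) : μ = 1 := by
  have hi := hO.irr hc
  let C : Subalgebra ℂ (U → ℂ) := Algebra.adjoin ℂ (Set.range fun p : Fin m × Fin m => fun x => φ x p.1 p.2)
  have hCO : C ≤ O := by
    refine Algebra.adjoin_le ?_
    rintro _ ⟨p, rfl⟩
    exact h.reg _ _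
  have hCgen : ∀ b ∈ C, b ∈ Module.End.maxGenEigenspace (rtrans g).toLinearMap (1 : ℂ) := by
    have h1 : ∀ c : ℂ, algebraMap ℂ (U → ℂ) c ∈
        Module.End.maxGenEigenspace (rtrans g).toLinearMap (1 : ℂ) := fun c =>
      mem_maxGenEigenspace_of_sub _ _ (by simp)
    intro b hb
    refine Algebra.adjoin_induction (fun x hx => ?_) h1
      (fun x y _ _ hx hy => add_mem hx hy) (fun x y _ _ hx hy => ?_) hb
    · obtain ⟨p, rfl⟩ := hx
      exact h.entry_mem g _ _
    · simpa using maxGenEigenspace_mul _ hx hy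
  obtain ⟨b, hb, c, hc', hb0, hbc⟩ := exists_frac (O₂ := C) hO.toIsAff (fun x y hxy => h.inj (by
      ext i j; exact hxy _ (Algebra.subset_adjoin ⟨(i, j), rfl⟩)))
    (fun f hf g hg => hi f (hCO hf) g (hCO hg)) (fun x => x) (fun k hk => hCO hk) hf
    (fun x x' hxx => congrArg f hxx)
  have hfm : f ∈ Module.End.maxGenEigenspace (rtrans g).toLinearMap μ :=
    mem_maxGenEigenspace_of_sub _ _ (by
      have : (rtrans g).toLinearMap f - μ • f = 0 := by
        funext x
        simp [hg]
      rw [this]; exact zero_mem _)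
  have hbf : b * f = c := funext hbc
  have h1 : c ∈ Module.End.maxGenEigenspace (rtrans g).toLinearMap μ := by
    rw [← hbf]; simpa using maxGenEigenspace_mul _ (hCgen b hb) hfm
  by_contra hne
  have hd := (Module.End.independent_maxGenEigenspace (rtrans g).toLinearMap).pairwiseDisjoint hne
  have : c = 0 := Submodule.disjoint_def.mp hd c h1 (hCgen c hc')
  rcases hi b (hCO hb) f hf (hbf.trans this) with h | h
  · exact hb0 h
  · exact hf0 h

end Unip

end AlgGrp

namespace AlgGrp

/-! ### Irreducible weight spaces -/

/-- An irreducible space of functions of weight `χ` under the central subgroup. -/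
structure WtSp {A E : Type} [CommGroup A] [Group E] (OE : Subalgebra ℂ (E → ℂ)) (i : A →* E)
    (χ : A →* ℂˣ) (V : Submodule ℂ (E → ℂ)) : Prop extends IrrSp OE V where
  weight : ∀ w ∈ V, ∀ a x, w (i a * x) = χ a * w x

section Wt
variable {A E G : Type} [CommGroup A] [Group E] [Group G] {k : ℕ}
  {OA : Subalgebra ℂ (A → ℂ)} {OE : Subalgebra ℂ (E → ℂ)} {OG : Subalgebra ℂ (G → ℂ)}
  {u : Fin k → A →* ℂˣ} {i : A →* E} {q : E →* G} {χ : A →* ℂˣ} {V : Submodule ℂ (E → ℂ)}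

lemma TorExt.exists_wtSp (h : TorExt OA OE OG u i q) (j : Fin k) : ∃ V, WtSp OE i (u j) V := by
  obtain ⟨w, hw, hw0, hww⟩ := h.exists_weight j
  let U : Submodule ℂ (E → ℂ) :=
    { carrier := {w | ∀ a x, w (i a * x) = u j a * w x}
      zero_mem' := fun a x => by simp
      add_mem' := fun {v w} hv hw a x => by simp [hv a x, hw a x, mul_add]
      smul_mem' := fun c w hw a x => by simp [hw a x, mul_left_comm] }
  obtain ⟨V, hVU, hV⟩ := exists_irrSp h.hE (U := U)
    (fun g w hw a x => by simpa [mul_assoc] using hw a (x * g)) hw hww hw0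
  exact ⟨V, hV, fun w hw => hVU hw⟩

lemma IrrSp.finrank_pos (h : IrrSp OE V) : 0 < Module.finrank ℂ V := by
  have := h.fd
  exact Nat.pos_of_ne_zero fun h0 => h.ne (Submodule.finrank_eq_zero.mp h0)

lemma IrrSp.exists_point (h : IrrSp OE V) : ∃ w ∈ V, ∃ y, w y ≠ 0 := by
  obtain ⟨w, hw, hw0⟩ := Submodule.exists_mem_ne_zero_of_ne_bot h.ne
  exact ⟨w, hw, Function.ne_iff.mp hw0⟩

lemma WtSp.rtrans_i (hV : WtSp OE i χ V) (h : TorExt OA OE OG u i q) (a : A) {w : E → ℂ}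
    (hw : w ∈ V) : rtrans (i a) w = (χ a : ℂ) • w := by
  funext x
  rw [rtrans_apply, ← h.central, hV.weight w hw]
  rfl

lemma IrrSp.delta_of_scalar (hV : IrrSp OE V) {x : E} {c : ℂ}
    (hx : ∀ w ∈ V, rtrans x w = c • w) : hV.delta x = c ^ Module.finrank ℂ V := by
  have : hV.rho x = c • (1 : Module.End ℂ V) := by
    ext w : 2
    exact hx w.1 w.2
  change LinearMap.det (hV.rho x) = _
  rw [this, LinearMap.det_smul, map_one, mul_one]

lemma WtSp.delta_i (hV : WtSp OE i χ V) (h : TorExt OA OE OG u i q) (a : A) :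
    hV.delta (i a) = (χ a : ℂ) ^ Module.finrank ℂ V :=
  hV.delta_of_scalar fun _ hw => hV.rtrans_i h a hw

/-- A character of the extension restricting to a positive power of a coordinate character. -/
lemma TorExt.exists_delta (h : TorExt OA OE OG u i q) (j : Fin k) : ∃ (δ : E →* ℂ) (m : ℕ), 0 < m ∧
    (δ : E → ℂ) ∈ OE ∧ ∀ a, δ (i a) = (u j a : ℂ) ^ m := by
  obtain ⟨V, hV⟩ := h.exists_wtSp j
  exact ⟨hV.delta, _, hV.finrank_pos, hV.delta_mem h.hE, hV.delta_i h⟩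

lemma const_of_finite_values {X : Type} [Nonempty X] {O : Subalgebra ℂ (X → ℂ)} (hi : ZIrr O)
    {f : X → ℂ} (hf : f ∈ O) {S : Finset ℂ} (hS : ∀ x, f x ∈ S) : ∀ x y, f x = f y := by
  have := hi.isDomain
  have h0 : ∏ s ∈ S, ((⟨f, hf⟩ : O) - algebraMap ℂ O s) = 0 := by
    refine Subtype.ext (funext fun x => ?_)
    rw [← evalAt_apply, map_prod]
    exact Finset.prod_eq_zero (hS x) (by rw [map_sub, AlgHom.commutes]; simp)
  obtain ⟨s, -, hs⟩ := Finset.prod_eq_zero_iff.mp h0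
  have : ∀ x, f x = s := fun x => by
    have := congrArg (evalAt O x) hs
    rw [map_sub, AlgHom.commutes, map_zero, sub_eq_zero] at this
    exact this
  intro x y
  rw [this, this]

/-- A closed connected normal unipotent subgroup. -/
structure UnipSub (OG : Subalgebra ℂ (G → ℂ)) (Gu : Subgroup G) {m : ℕ}
    (φ : Gu →* Matrix (Fin m) (Fin m) ℂ) : Prop where
  closed : ZClosed OG (Gu : Set G)
  conn : ZConn (res OG Gu.subtype)
  normal : Gu.Normal
  unip : IsUnip (res OG Gu.subtype) φ

variable {Gu : Subgroup G} {m : ℕ} {φ : Gu →* Matrix (Fin m) (Fin m) ℂ}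

lemma WtSp.eig_aux (hV : WtSp OE i χ V) (h : TorExt OA OE OG u i q) (hU : UnipSub OG Gu φ) {x : E}
    (hx : q x ∈ Gu) {v v' : E → ℂ} (hv : v ∈ V) (hv' : v' ∈ V) (hv0 : v ≠ 0) (hv0' : v' ≠ 0)
    {l l' : ℂ} (hl : rtrans x v = l • v) (hl' : rtrans x v' = l' • v') :
    l * l' ^ (Module.finrank ℂ V - 1) = hV.delta x := by
  have hi := h.hE.irr h.conn
  set n := Module.finrank ℂ V with hn
  have hnpos : 0 < n := hV.finrank_pos
  let δ' : E → ℂ := fun y => hV.delta y⁻¹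
  have hδ' : δ' ∈ OE := h.hE.inv _ (hV.delta_mem h.hE)
  let F : E → ℂ := v * v' ^ (n - 1) * δ'
  have hF : F ∈ OE := mul_mem (mul_mem (hV.le _ hv) (pow_mem (hV.le _ hv') _)) hδ'
  have hδinv : ∀ y, hV.delta y⁻¹ = (hV.delta y)⁻¹ := fun y =>
    eq_inv_of_mul_eq_one_left (by rw [← map_mul, inv_mul_cancel, map_one])
  have hFa : ∀ a y, F (i a * y) = F y := by
    intro a y
    simp only [F, δ', Pi.mul_apply, Pi.pow_apply, hδinv, map_mul, hV.delta_i h, hV.weight v hv,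
      hV.weight v' hv', ← hn]
    have h1 : (χ a : ℂ) ≠ 0 := (χ a).ne_zero
    have h2 := hV.delta_ne_zero y
    have e : (χ a : ℂ) ^ n = χ a * χ a ^ (n - 1) := by
      rw [← pow_succ', Nat.sub_add_cancel hnpos]
    rw [e, mul_pow]
    field_simp
  have hne : v * v' ≠ 0 := fun h0 => (hi v (hV.le _ hv) v' (hV.le _ hv') h0).elim hv0 hv0'
  obtain ⟨y0, hy0⟩ := Function.ne_iff.mp hne
  have hvy : v y0 ≠ 0 := left_ne_zero_of_mul hy0
  have hvy' : v' y0 ≠ 0 := right_ne_zero_of_mul hy0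
  let Ru : Subgroup E := Gu.comap q
  have hRu : IsGrp (res OE Ru.subtype) := h.hE.resSub Ru (hU.closed.preimage h.qReg)
  have hGu : IsGrp (res OG Gu.subtype) := h.hG.resSub Gu hU.closed
  let qu : Ru →* Gu := q.subgroupComap Gu
  have hqu : Reg (res OE Ru.subtype) (res OG Gu.subtype) qu :=
    reg_to_res (h.qReg.comp (reg_res OE Ru.subtype))
  have hqs : Function.Surjective qu := by
    rintro ⟨g, hg⟩
    obtain ⟨e, rfl⟩ := h.q_surj g
    exact ⟨⟨e, hg⟩, rfl⟩
  obtain ⟨F', hF', eF⟩ := descent hRu hGu hU.conn qu hqu hqs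
    (f := fun r : Ru => F (y0 * r)) ⟨_, h.hE.left y0 F hF, rfl⟩ (by
      intro r r' hrr
      have : q ((r : E) * (r' : E)⁻¹) = 1 := by
        rw [map_mul, map_inv, mul_inv_eq_one]
        exact congrArg Subtype.val hrr
      obtain ⟨a, ha⟩ := (h.exact _).mp this
      have : (r : E) = i a * r' := by rw [ha]; group
      change F (y0 * r) = F (y0 * r')
      rw [this, ← mul_assoc, ← h.central, mul_assoc, hFa])
  have hF'1 : F' 1 ≠ 0 := by
    have := eF 1
    rw [map_one] at this
    rw [this]
    simp only [OneMemClass.coe_one, mul_one, F, Pi.mul_apply, Pi.pow_apply]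
    exact mul_ne_zero (mul_ne_zero hvy (pow_ne_zero _ hvy')) (hV.delta_ne_zero _)
  have key := hU.unip.eigenvalue hGu hU.conn hF' (fun h0 => hF'1 (by rw [h0]; rfl))
    (g := ⟨q x, hx⟩) (μ := l * l' ^ (n - 1) * (hV.delta x)⁻¹) (by
      intro g
      obtain ⟨r, rfl⟩ := hqs g
      have e1 : qu r * ⟨q x, hx⟩ = qu (r * ⟨x, hx⟩) := by rw [map_mul]; rfl
      rw [e1, eF, eF]
      have ev := congrFun hl (y0 * r)
      have ev' := congrFun hl' (y0 * r)
      simp only [rtrans_apply, Pi.smul_apply, smul_eq_mul] at ev ev'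
      simp only [F, δ', Pi.mul_apply, Pi.pow_apply, Subgroup.coe_mul, ← mul_assoc, ev, ev', hδinv,
        map_mul, mul_inv, mul_pow]
      ring)
  rwa [mul_inv_eq_one₀ (hV.delta_ne_zero x)] at key

lemma WtSp.eig_unique (hV : WtSp OE i χ V) (h : TorExt OA OE OG u i q) (hU : UnipSub OG Gu φ)
    {x : E} (hx : q x ∈ Gu) {v v' : E → ℂ} (hv : v ∈ V) (hv' : v' ∈ V) (hv0 : v ≠ 0) (hv0' : v' ≠ 0)
    {l l' : ℂ} (hl : rtrans x v = l • v) (hl' : rtrans x v' = l' • v') : l = l' := by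
  have h1 := hV.eig_aux h hU hx hv hv' hv0 hv0' hl hl'
  have h2 := hV.eig_aux h hU hx hv' hv' hv0' hv0' hl' hl'
  have h3 : l' ^ (Module.finrank ℂ V - 1) ≠ 0 := fun h0 => by
    rw [h0, mul_zero] at h2
    exact hV.delta_ne_zero x h2.symm
  exact mul_right_cancel₀ h3 (h1.trans h2.symm)

lemma IrrSp.exists_eigen (hV : IrrSp OE V) {W : Submodule ℂ (E → ℂ)} (hWV : W ≤ V) (hW : W ≠ ⊥)
    {x : E} (hx : ∀ w ∈ W, rtrans x w ∈ W) : ∃ w ∈ W, w ≠ 0 ∧ ∃ l : ℂ, rtrans x w = l • w := by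
  have := hV.fd
  have : FiniteDimensional ℂ W := Submodule.finiteDimensional_of_le hWV
  have : Nontrivial W := Submodule.nontrivial_iff_ne_bot.mpr hW
  obtain ⟨l, hl⟩ := Module.End.exists_eigenvalue ((rtrans x).toLinearMap.restrict hx)
  obtain ⟨w, hw⟩ := hl.exists_hasEigenvector
  refine ⟨w.1, w.2, fun h0 => hw.2 (Subtype.ext h0), l, ?_⟩
  exact congrArg Subtype.val hw.apply_eq_smul

/-- A commuting set of group elements has a common eigenvector. -/
lemma IrrSp.exists_common_eigen (hV : IrrSp OE V) (M : Set E)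
    (hM : ∀ x ∈ M, ∀ y ∈ M, ∀ w ∈ V, rtrans x (rtrans y w) = rtrans y (rtrans x w)) :
    ∃ w ∈ V, w ≠ 0 ∧ ∀ x ∈ M, ∃ l : ℂ, rtrans x w = l • w := by
  classical
  have := hV.fd
  let P : ℕ → Prop := fun n => ∃ W ≤ V, W ≠ ⊥ ∧ (∀ x ∈ M, ∀ w ∈ W, rtrans x w ∈ W) ∧
    Module.finrank ℂ W = n
  have hex : ∃ n, P n := ⟨_, V, le_rfl, hV.ne, fun x _ => hV.stable x, rfl⟩
  obtain ⟨W, hWV, hW0, hWM, hn⟩ := Nat.find_spec hex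
  have hWfd : FiniteDimensional ℂ W := Submodule.finiteDimensional_of_le hWV
  obtain ⟨w, hw, hw0⟩ := Submodule.exists_mem_ne_zero_of_ne_bot hW0
  refine ⟨w, hWV hw, hw0, fun x hx => ?_⟩
  obtain ⟨v, hv, hv0, l, hl⟩ := hV.exists_eigen hWV hW0 (hWM x hx)
  let W' : Submodule ℂ (E → ℂ) := W ⊓ LinearMap.ker ((rtrans x).toLinearMap - l • LinearMap.id)
  have hmem : ∀ w, w ∈ W' ↔ w ∈ W ∧ rtrans x w = l • w := fun w => by
    simp [W', sub_eq_zero]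
  have hW'0 : W' ≠ ⊥ := fun h0 => hv0 ((Submodule.mem_bot ℂ).mp (h0 ▸ (hmem v).mpr ⟨hv, hl⟩))
  have hst : ∀ y ∈ M, ∀ w ∈ W', rtrans y w ∈ W' := by
    intro y hy w hw
    obtain ⟨h1, h2⟩ := (hmem w).mp hw
    refine (hmem _).mpr ⟨hWM y hy w h1, ?_⟩
    rw [hM x hx y hy w (hWV h1), h2, map_smul]
  have hle := Nat.find_min' hex ⟨W', inf_le_left.trans hWV, hW'0, hst, rfl⟩
  rw [← hn] at hle
  have : W' = W := Submodule.eq_of_le_of_finrank_le inf_le_left hle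
  exact ⟨l, ((hmem w).mp (this ▸ hw)).2⟩

end Wt

end AlgGrp

namespace AlgGrp

open scoped commutatorElement

section Level
variable {m : ℕ}

/-- Matrices supported on the diagonals with offset at least `k`. -/
def Up (k : ℕ) (a : Matrix (Fin m) (Fin m) ℂ) : Prop := ∀ i j : Fin m, (j : ℕ) < i + k → a i j = 0

lemma Up.mul {k l : ℕ} {a b : Matrix (Fin m) (Fin m) ℂ} (ha : Up k a) (hb : Up l b) :
    Up (k + l) (a * b) := by
  intro i j hij
  rw [Matrix.mul_apply]
  refine Finset.sum_eq_zero fun n _ => ?_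
  by_cases h : (n : ℕ) < i + k
  · rw [ha i n h, zero_mul]
  · rw [hb n j (by omega), mul_zero]

lemma Up.sub {k : ℕ} {a b : Matrix (Fin m) (Fin m) ℂ} (ha : Up k a) (hb : Up k b) :
    Up k (a - b) := fun i j hij => by simp [ha i j hij, hb i j hij]

lemma IsUnip.up_zero {U : Type} [Group U] {O : Subalgebra ℂ (U → ℂ)}
    {φ : U →* Matrix (Fin m) (Fin m) ℂ} (h : IsUnip O φ) (x : U) : Up 0 (φ x) :=
  fun i j hij => h.low x i j (by simpa using hij)

lemma IsUnip.up_one {U : Type} [Group U] {O : Subalgebra ℂ (U → ℂ)}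
    {φ : U →* Matrix (Fin m) (Fin m) ℂ} (h : IsUnip O φ) (x : U) : Up 1 (φ x - 1) := by
  intro i j hij
  rcases eq_or_ne i j with rfl | hne
  · simp [h.diag]
  · have : j < i := lt_of_le_of_ne (Fin.le_def.mpr (by omega)) hne.symm
    simp [h.low x i j this, Matrix.one_apply_ne hne]

lemma IsUnip.up_commutator {U : Type} [Group U] {O : Subalgebra ℂ (U → ℂ)}
    {φ : U →* Matrix (Fin m) (Fin m) ℂ} (h : IsUnip O φ) {k : ℕ} {x : U} (hx : Up k (φ x - 1))
    (y : U) : Up (k + 1) (φ ⁅x, y⁆ - 1) := by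
  have e : φ ⁅x, y⁆ - 1 = ((φ x - 1) * (φ y - 1) - (φ y - 1) * (φ x - 1)) * φ (x⁻¹ * y⁻¹) := by
    have h1 : φ y * φ x * φ (x⁻¹ * y⁻¹) = 1 := by
      rw [← map_mul, ← map_mul, ← map_one φ]
      congr 1
      group
    have h2 : φ ⁅x, y⁆ = φ x * φ y * φ (x⁻¹ * y⁻¹) := by
      rw [← map_mul, ← map_mul, commutatorElement_def]
      congr 1
      group
    rw [h2]
    nth_rewrite 1 [← h1]
    noncomm_ring
  rw [e]
  have hy := h.up_one y
  refine ((hx.mul hy).sub ?_).mul (h.up_zero _)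
  rw [add_comm]
  exact hy.mul hx

end Level

section Psi
variable {A E G : Type} [CommGroup A] [Group E] [Group G] {k : ℕ}
  {OA : Subalgebra ℂ (A → ℂ)} {OE : Subalgebra ℂ (E → ℂ)} {OG : Subalgebra ℂ (G → ℂ)}
  {u : Fin k → A →* ℂˣ} {i : A →* E} {q : E →* G} {χ : A →* ℂˣ} {V : Submodule ℂ (E → ℂ)}
  {Gu : Subgroup G} {m : ℕ} {φ : Gu →* Matrix (Fin m) (Fin m) ℂ}

lemma WtSp.commute_of_commutator_scalar (hV : WtSp OE i χ V) (h : TorExt OA OE OG u i q)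
    (hU : UnipSub OG Gu φ) {x y : E} (hy : q y ∈ Gu) {c : ℂ}
    (hc : ∀ w ∈ V, rtrans ⁅x, y⁆ w = c • w) :
    ∀ w ∈ V, rtrans x (rtrans y w) = rtrans y (rtrans x w) := by
  have key : ∀ w ∈ V, rtrans x (rtrans y w) = c • rtrans y (rtrans x w) := by
    intro w hw
    rw [← rtrans_mul, ← rtrans_mul, ← hc _ (hV.stable _ _ hw), ← rtrans_mul]
    congr 1
    rw [commutatorElement_def]
    congr 1
    group
  obtain ⟨v, hv, hv0, l, hl⟩ := hV.exists_eigen le_rfl hV.ne (hV.stable y)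
  have hxv : rtrans x v ≠ 0 := fun h0 => hv0 (by
    have := congrArg (rtrans x⁻¹) h0
    rwa [← rtrans_mul, inv_mul_cancel, rtrans_one, map_zero] at this)
  have hc0 : c ≠ 0 := by
    rintro rfl
    have := key v hv
    rw [hl, map_smul, zero_smul, smul_eq_zero] at this
    rcases this with h0 | h0
    · have h2 := congrArg (rtrans y⁻¹) hl
      rw [← rtrans_mul, inv_mul_cancel, rtrans_one, h0, zero_smul, map_zero] at h2
      exact hv0 h2
    · exact hxv h0
  have h1 : rtrans y (rtrans x v) = (c⁻¹ * l) • rtrans x v := by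
    rw [mul_smul, ← map_smul, ← hl, key v hv, smul_smul, inv_mul_cancel₀ hc0, one_smul]
  have h2 := hV.eig_unique h hU hy (hV.stable _ _ hv) hv hxv hv0 h1 hl
  have hl0 : l ≠ 0 := by
    rintro rfl
    have h2 := congrArg (rtrans y⁻¹) hl
    rw [← rtrans_mul, inv_mul_cancel, rtrans_one, zero_smul, map_zero] at h2
    exact hv0 h2
  have hc1 : c = 1 := by
    have := mul_right_cancel₀ hl0 (h2.trans (one_mul l).symm)
    exact inv_eq_one.mp this
  intro w hw
  rw [key w hw, hc1, one_smul]

/-- Elements of the unipotent part commuting with it act by scalars. -/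
lemma WtSp.scalar_of_commute (hV : WtSp OE i χ V) (h : TorExt OA OE OG u i q)
    (hU : UnipSub OG Gu φ) {x : E} (hx : q x ∈ Gu)
    (hc : ∀ y, q y ∈ Gu → ∀ w ∈ V, rtrans x (rtrans y w) = rtrans y (rtrans x w)) :
    ∃ c : ℂ, ∀ w ∈ V, rtrans x w = c • w := by
  let M : Set E := {x | q x ∈ Gu ∧
    ∀ y, q y ∈ Gu → ∀ w ∈ V, rtrans x (rtrans y w) = rtrans y (rtrans x w)}
  have hconj : ∀ g, ∀ x ∈ M, g * x * g⁻¹ ∈ M := by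
    rintro g x ⟨hx, hxc⟩
    refine ⟨?_, fun y hy w hw => ?_⟩
    · rw [map_mul, map_mul, map_inv]
      exact hU.normal.conj_mem _ hx _
    · have hy' : q (g⁻¹ * y * g) ∈ Gu := by
        rw [map_mul, map_mul, map_inv]
        simpa using hU.normal.conj_mem _ hy (q g)⁻¹
      have := congrArg (rtrans g) (hxc _ hy' (rtrans g⁻¹ w) (hV.stable _ _ hw))
      simp only [← rtrans_mul] at this ⊢
      convert this using 2 <;> group
  obtain ⟨v, hv, hv0, hvM⟩ := hV.exists_common_eigen M fun x hx y hy => hx.2 y hy.1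
  choose! l hl using hvM
  let W : Submodule ℂ (E → ℂ) :=
    { carrier := {w | w ∈ V ∧ ∀ x ∈ M, rtrans x w = l x • w}
      zero_mem' := ⟨zero_mem _, fun x _ => by simp⟩
      add_mem' := fun {a b} ha hb => ⟨add_mem ha.1 hb.1, fun x hx => by
        rw [map_add, ha.2 x hx, hb.2 x hx, smul_add]⟩
      smul_mem' := fun c a ha => ⟨V.smul_mem c ha.1, fun x hx => by
        rw [map_smul, ha.2 x hx, smul_comm]⟩ }
  have hWV : W = V := by
    refine hV.irr W (fun w hw => hw.1) (fun h0 => ?_) fun g w hw => ?_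
    · have : v ∈ W := ⟨hv, hl⟩
      rw [h0] at this
      exact hv0 this
    · refine ⟨hV.stable _ _ hw.1, fun x hx => ?_⟩
      by_cases hw0 : rtrans g w = 0
      · rw [hw0, map_zero, smul_zero]
      have hx' : g⁻¹ * x * g ∈ M := by simpa using hconj g⁻¹ x hx
      have e : rtrans x (rtrans g w) = l (g⁻¹ * x * g) • rtrans g w := by
        rw [← map_smul, ← hw.2 _ hx', ← rtrans_mul, ← rtrans_mul]
        congr 2
        group
      rw [e, hV.eig_unique h hU hx.1 (hV.stable _ _ hw.1) hv hw0 hv0 e (hl x hx)]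
  refine ⟨l x, fun w hw => ?_⟩
  rw [← hWV] at hw
  exact hw.2 x ⟨hx, hc⟩

/-- The preimage of the unipotent subgroup acts by scalars. -/
lemma WtSp.scalar_unip (hV : WtSp OE i χ V) (h : TorExt OA OE OG u i q) (hU : UnipSub OG Gu φ) :
    ∀ {x : E}, q x ∈ Gu → ∃ c : ℂ, ∀ w ∈ V, rtrans x w = c • w := by
  suffices H : ∀ n k, k + n = m → ∀ x (hx : q x ∈ Gu), Up k (φ ⟨q x, hx⟩ - 1) →
      ∃ c : ℂ, ∀ w ∈ V, rtrans x w = c • w from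
    fun {x} hx => H m 0 (zero_add m) x hx (fun i j hij => hU.unip.up_one _ i j (by omega))
  intro n
  induction n with
  | zero =>
    intro k hk x hx hlev
    have : φ ⟨q x, hx⟩ = 1 := by
      ext i j
      have := hlev i j (by omega)
      simpa [sub_eq_zero] using this
    have := hU.unip.inj (this.trans (map_one φ).symm)
    obtain ⟨a, rfl⟩ := (h.exact x).mp (congrArg Subtype.val this)
    exact ⟨χ a, fun w hw => hV.rtrans_i h a hw⟩
  | succ n ih =>
    intro k hk x hx hlev
    refine hV.scalar_of_commute h hU hx fun y hy => ?_
    have hxy : (⟨q x, hx⟩ : Gu).1 * q y * (q x)⁻¹ * (q y)⁻¹ = q ⁅x, y⁆ := by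
      rw [map_commutatorElement, commutatorElement_def]
    have hm : q ⁅x, y⁆ ∈ Gu := by
      rw [← hxy]
      exact mul_mem (mul_mem (mul_mem hx hy) (inv_mem hx)) (inv_mem hy)
    have e : (⟨q ⁅x, y⁆, hm⟩ : Gu) = ⁅(⟨q x, hx⟩ : Gu), (⟨q y, hy⟩ : Gu)⁆ := Subtype.ext hxy.symm
    obtain ⟨c, hc⟩ := ih (k + 1) (by omega) ⁅x, y⁆ hm (by
      rw [e]; exact hU.unip.up_commutator hlev _)
    exact hV.commute_of_commutator_scalar h hU hy hc

/-- Elements that are central modulo the unipotent subgroup act by scalars. -/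
lemma WtSp.scalar (hV : WtSp OE i χ V) (h : TorExt OA OE OG u i q) (hU : UnipSub OG Gu φ) {r : E}
    (hr : ∀ g : E, q ⁅g, r⁆ ∈ Gu) : ∃ c : ℂ, ∀ w ∈ V, rtrans r w = c • w := by
  choose c hc using fun g => hV.scalar_unip h hU (hr g)
  obtain ⟨w0, hw0, y0, hy0⟩ := hV.exists_point
  have hcval : ∀ g, c g = w0 (y0 * ⁅g, r⁆) * (w0 y0)⁻¹ := by
    intro g
    have := congrFun (hc g w0 hw0) y0
    simp only [rtrans_apply, Pi.smul_apply, smul_eq_mul] at this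
    rw [this, mul_inv_cancel_right₀ hy0]
  have hreg : Reg OE OE (fun g => y0 * ⁅g, r⁆) := by
    simp only [commutatorElement_def]
    exact h.hE.mulReg (Reg.const _ _ _) (h.hE.mulReg (h.hE.mulReg (h.hE.mulReg (Reg.id _)
      (Reg.const _ _ _)) (h.hE.invReg (Reg.id _))) (Reg.const _ _ _))
  have hcm : c ∈ OE := by
    have : c = (w0 y0)⁻¹ • (w0 ∘ fun g => y0 * ⁅g, r⁆) := by
      funext g
      rw [hcval, mul_comm]
      rfl
    rw [this]
    exact OE.smul_mem (hreg _ (hV.le _ hw0)) _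
  have hpow : ∀ g, c g ^ Module.finrank ℂ V = 1 := by
    intro g
    rw [← hV.delta_of_scalar (hc g), commutatorElement_def, map_mul, map_mul, map_mul,
      mul_right_comm (hV.delta g), ← map_mul, mul_inv_cancel, map_one, one_mul, ← map_mul,
      mul_inv_cancel, map_one]
  have hc1 : ∀ g, c g = 1 := by
    intro g
    have := const_of_finite_values (h.hE.irr h.conn) hcm
      (S := (Polynomial.nthRoots (Module.finrank ℂ V) (1 : ℂ)).toFinset)
      (fun g => by
        rw [Multiset.mem_toFinset, Polynomial.mem_nthRoots hV.finrank_pos]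
        exact hpow g) g 1
    rw [this, hcval, commutatorElement_one_left, mul_one, mul_inv_cancel₀ hy0]
  have hcomm : ∀ g, ∀ w ∈ V, rtrans g (rtrans r w) = rtrans r (rtrans g w) := by
    intro g w hw
    have := hc g _ (hV.stable (r * g) w hw)
    rw [hc1, one_smul, ← rtrans_mul] at this
    rw [← rtrans_mul, ← rtrans_mul, ← this]
    congr 1
    rw [commutatorElement_def]
    congr 1
    group
  obtain ⟨v, hv, hv0, l, hl⟩ := hV.exists_eigen le_rfl hV.ne (hV.stable r)
  let W : Submodule ℂ (E → ℂ) :=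
    { carrier := {w | w ∈ V ∧ rtrans r w = l • w}
      zero_mem' := ⟨zero_mem _, by simp⟩
      add_mem' := fun {a b} ha hb => ⟨add_mem ha.1 hb.1, by rw [map_add, ha.2, hb.2, smul_add]⟩
      smul_mem' := fun c a ha => ⟨V.smul_mem c ha.1, by rw [map_smul, ha.2, smul_comm]⟩ }
  have hWV : W = V := by
    refine hV.irr W (fun w hw => hw.1) (fun h0 => ?_) fun g w hw => ⟨hV.stable _ _ hw.1, ?_⟩
    · have : v ∈ W := ⟨hv, hl⟩
      rw [h0] at this
      exact hv0 this
    · rw [← hcomm g w hw.1, hw.2, map_smul]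
  refine ⟨l, fun w hw => ?_⟩
  rw [← hWV] at hw
  exact hw.2

/-- A retraction onto the torus of any subgroup that is central modulo the unipotent subgroup. -/
theorem TorExt.exists_psi (h : TorExt OA OE OG u i q) (hU : UnipSub OG Gu φ) (R : Subgroup E)
    (hR : ∀ r ∈ R, ∀ g : E, q ⁅g, r⁆ ∈ Gu) : ∃ ψ : R →* A, Reg (res OE R.subtype) OA ψ ∧
      (∀ a (ha : i a ∈ R), ψ ⟨i a, ha⟩ = a) ∧
      ∀ g (r r' : R), (r' : E) = g * r * g⁻¹ → ψ r' = ψ r := by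
  choose V hV using h.exists_wtSp
  choose c hc using fun (j : Fin k) (r : R) => (hV j).scalar h hU (hR r.1 r.2)
  choose w0 hw0 y0 hy0 using fun j => (hV j).exists_point
  have hcval : ∀ j (r : R) , c j r = w0 j (y0 j * r) * (w0 j (y0 j))⁻¹ := by
    intro j r
    have := congrFun (hc j r _ (hw0 j)) (y0 j)
    simp only [rtrans_apply, Pi.smul_apply, smul_eq_mul] at this
    rw [this, mul_inv_cancel_right₀ (hy0 j)]
  have huniq : ∀ j (r : R) (l : ℂ), rtrans (r : E) (w0 j) = l • w0 j → c j r = l := by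
    intro j r l hl
    have := congrFun hl (y0 j)
    simp only [rtrans_apply, Pi.smul_apply, smul_eq_mul] at this
    rw [hcval, this, mul_inv_cancel_right₀ (hy0 j)]
  have hmul : ∀ j r r', c j (r * r') = c j r * c j r' := by
    intro j r r'
    refine huniq _ _ _ ?_
    rw [Subgroup.coe_mul, rtrans_mul, hc j r' _ (hw0 j), map_smul, hc j r _ (hw0 j), smul_smul,
      mul_comm]
  have hone : ∀ j, c j 1 = 1 := fun j => huniq _ _ _ (by
    rw [OneMemClass.coe_one, rtrans_one, one_smul])
  let cH : Fin k → R →* ℂ := fun j => ⟨⟨c j, hone j⟩, hmul j⟩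
  let e : A ≃* (Fin k → ℂˣ) := MulEquiv.ofBijective
    (⟨⟨fun a j => u j a, by funext j; simp⟩, fun a b => by funext j; simp⟩ : A →* (Fin k → ℂˣ))
    h.tor.bij
  have he : ∀ a j, e a j = u j a := fun _ _ => rfl
  let ψ : R →* A := e.symm.toMonoidHom.comp (MonoidHom.pi fun j => (cH j).toHomUnits)
  have hψ : ∀ j r, (u j (ψ r) : ℂ) = c j r := by
    intro j r
    rw [← he]
    change ((e (e.symm _)) j : ℂ) = _
    rw [MulEquiv.apply_symm_apply]
    rfl
  have hext : ∀ a b : A, (∀ j, (u j a : ℂ) = u j b) → a = b := fun a b hab =>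
    h.tor.bij.1 (funext fun j => Units.ext (hab j))
  have hcm : ∀ j, c j ∈ res OE R.subtype := by
    intro j
    refine ⟨(w0 j (y0 j))⁻¹ • (w0 j ∘ fun g => y0 j * g),
      OE.smul_mem (h.hE.left _ _ ((hV j).le _ (hw0 j))) _, ?_⟩
    funext r
    rw [hcval, mul_comm]
    rfl
  refine ⟨ψ, h.tor.reg (fun j => ?_) (fun j => ?_), fun a ha => ?_, fun g r r' hr => ?_⟩
  · simp only [hψ]
    exact hcm j
  · obtain ⟨f, hf, e⟩ := hcm j
    refine ⟨_, h.hE.inv f hf, ?_⟩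
    funext r
    rw [← map_inv, ← map_inv, hψ, ← e]
    rfl
  · refine hext _ _ fun j => ?_
    rw [hψ]
    exact huniq _ _ _ ((hV j).rtrans_i h a (hw0 j))
  · refine hext _ _ fun j => ?_
    rw [hψ, hψ]
    refine huniq _ _ _ ?_
    rw [hr, rtrans_mul, rtrans_mul, hc j r _ ((hV j).stable _ _ (hw0 j)), map_smul, ← rtrans_mul,
      mul_inv_cancel, rtrans_one]

end Psi

end AlgGrp

namespace AlgGrp

section Grading
variable {B : Type} [CommRing B] [Algebra ℂ B]

/-- The operator `D - lam`. -/
def shiftEnd (D : Derivation ℂ B B) (lam : ℂ) : Module.End ℂ B :=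
  (D : B →ₗ[ℂ] B) - lam • 1

lemma shiftEnd_apply (D : Derivation ℂ B B) (lam : ℂ) (a : B) :
    shiftEnd D lam a = D a - lam • a := rfl

lemma shiftEnd_mul (D : Derivation ℂ B B) (lam mu : ℂ) (a b : B) :
    shiftEnd D (lam + mu) (a * b) = shiftEnd D lam a * b + a * shiftEnd D mu b := by
  simp only [shiftEnd_apply, Derivation.leibniz, smul_eq_mul, add_smul, sub_mul, mul_sub,
    smul_mul_assoc, mul_smul_comm, mul_comm b]
  ring

open TensorProduct in
lemma shiftEnd_pow_mul (D : Derivation ℂ B B) (lam mu : ℂ) (n : ℕ) (a b : B) :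
    (shiftEnd D (lam + mu) ^ n) (a * b) = ∑ p ∈ Finset.HasAntidiagonal.antidiagonal n,
      n.choose p.1 • ((shiftEnd D lam ^ p.1) a * (shiftEnd D mu ^ p.2) b) := by
  let S : Module.End ℂ (B ⊗[ℂ] B) := (shiftEnd D lam).rTensor B
  let T : Module.End ℂ (B ⊗[ℂ] B) := (shiftEnd D mu).lTensor B
  have hST : Commute S T := by
    refine TensorProduct.ext' fun x y => ?_
    simp [S, T]
  have key : ∀ (n : ℕ) (t : B ⊗[ℂ] B), LinearMap.mul' ℂ B (((S + T) ^ n) t) =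
      (shiftEnd D (lam + mu) ^ n) (LinearMap.mul' ℂ B t) := by
    intro n
    induction n with
    | zero => intro t; simp
    | succ n ih =>
      intro t
      rw [pow_succ, pow_succ, Module.End.mul_apply, Module.End.mul_apply, ih]
      congr 1
      induction t with
      | zero => simp
      | add x y hx hy => simp only [map_add, hx, hy]
      | tmul x y => simp [S, T, shiftEnd_mul]
  have h := key n (a ⊗ₜ b)
  rw [LinearMap.mul'_apply] at h
  rw [← h, hST.add_pow']
  rw [LinearMap.sum_apply, map_sum]
  refine Finset.sum_congr rfl fun p _ => ?_
  rw [LinearMap.smul_apply, map_nsmul, Module.End.mul_apply]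
  congr 1
  simp only [S, T, LinearMap.rTensor_pow, LinearMap.lTensor_pow, LinearMap.lTensor_tmul,
    LinearMap.rTensor_tmul, LinearMap.mul'_apply]

/-- The generalized weight space. -/
abbrev wtsp (D : Derivation ℂ B B) (lam : ℂ) : Submodule ℂ B :=
  Module.End.maxGenEigenspace (D : B →ₗ[ℂ] B) lam

lemma mem_wtsp {D : Derivation ℂ B B} {lam : ℂ} {a : B} :
    a ∈ wtsp D lam ↔ ∃ k, (shiftEnd D lam ^ k) a = 0 :=
  Module.End.mem_maxGenEigenspace _ _ _

lemma pow_apply_eq_zero_of_le {E : Module.End ℂ B} {a : B} {k n : ℕ} (h : (E ^ k) a = 0)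
    (hn : k ≤ n) : (E ^ n) a = 0 := by
  obtain ⟨m, rfl⟩ := Nat.exists_eq_add_of_le' hn
  rw [pow_add, Module.End.mul_apply, h, map_zero]

lemma wtsp_mul (D : Derivation ℂ B B) {lam mu : ℂ} {a b : B} (ha : a ∈ wtsp D lam)
    (hb : b ∈ wtsp D mu) : a * b ∈ wtsp D (lam + mu) := by
  obtain ⟨k, hk⟩ := mem_wtsp.mp ha
  obtain ⟨l, hl⟩ := mem_wtsp.mp hb
  refine mem_wtsp.mpr ⟨k + l, ?_⟩
  rw [shiftEnd_pow_mul]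
  refine Finset.sum_eq_zero fun p hp => ?_
  rw [Finset.HasAntidiagonal.mem_antidiagonal] at hp
  rcases le_or_gt k p.1 with h | h
  · rw [pow_apply_eq_zero_of_le hk h, zero_mul, smul_zero]
  · rw [pow_apply_eq_zero_of_le hl (by lia), mul_zero, smul_zero]

lemma wtsp_one (D : Derivation ℂ B B) : (1 : B) ∈ wtsp D 0 :=
  mem_wtsp.mpr ⟨1, by simp [shiftEnd_apply]⟩

/-- Local finiteness. -/
def LocFin (D : Derivation ℂ B B) : Prop :=
  ∀ f, ∃ W : Submodule ℂ B, FiniteDimensional ℂ W ∧ f ∈ W ∧ ∀ w ∈ W, D w ∈ W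

lemma LocFin.iSup_wtsp {D : Derivation ℂ B B} (h : LocFin D) : ⨆ lam, wtsp D lam = ⊤ := by
  refine eq_top_iff.mpr fun f _ => ?_
  obtain ⟨W, hfin, hf, hW⟩ := h f
  let DW : Module.End ℂ W := (D : B →ₗ[ℂ] B).restrict hW
  have h1 := Module.End.iSup_maxGenEigenspace_eq_top DW
  have h2 : (⟨f, hf⟩ : W) ∈ ⨆ lam, Module.End.maxGenEigenspace DW lam := by rw [h1]; trivial
  have h3 : ∀ w ∈ ⨆ lam, Module.End.maxGenEigenspace DW lam, (w : B) ∈ ⨆ lam, wtsp D lam := by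
    have : (⨆ lam, Module.End.maxGenEigenspace DW lam) ≤ (⨆ lam, wtsp D lam).comap W.subtype := by
      refine iSup_le fun lam w hw => ?_
      refine Submodule.mem_iSup_of_mem lam ?_
      obtain ⟨k, hk⟩ := (Module.End.mem_maxGenEigenspace _ _ _).mp hw
      refine mem_wtsp.mpr ⟨k, ?_⟩
      have h4 : ∀ (k : ℕ) (w : W), (shiftEnd D lam ^ k) (w : B) = (((DW - lam • 1) ^ k) w : W) := by
        intro k
        induction k with
        | zero => intro w; simp
        | succ k ih =>
          intro w
          rw [pow_succ, pow_succ, Module.End.mul_apply, Module.End.mul_apply, ← ih]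
          rfl
      rw [Submodule.subtype_apply, h4, hk]; rfl
    exact fun w hw => this hw
  exact h3 _ h2

/-- Finitely many weights generate all of them. -/
lemma LocFin.exists_lattice [Algebra.FiniteType ℂ B] {D : Derivation ℂ B B} (h : LocFin D) :
    ∃ Λ : AddSubgroup ℂ, Λ.FG ∧ ⨆ lam : Λ, wtsp D lam.1 = ⊤ := by
  classical
  obtain ⟨S, hS⟩ := (Algebra.FiniteType.out : (⊤ : Subalgebra ℂ B).FG)
  have h1 : ∀ s : B, ∃ F : Finset ℂ, s ∈ ⨆ lam ∈ F, wtsp D lam := by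
    intro s
    have : s ∈ ⨆ lam, wtsp D lam := by rw [h.iSup_wtsp]; trivial
    rwa [Submodule.mem_iSup_iff_exists_finset] at this
  choose F hF using h1
  let Λ : AddSubgroup ℂ := AddSubgroup.closure (S.biUnion F : Finset ℂ)
  refine ⟨Λ, ⟨_, rfl⟩, ?_⟩
  let M : Submodule ℂ B := ⨆ lam : Λ, wtsp D lam.1
  have hmul : ∀ a ∈ M, ∀ b ∈ M, a * b ∈ M := by
    intro a ha b hb
    induction ha using Submodule.iSup_induction' with
    | zero => simp
    | add x y _ _ hx hy => rw [add_mul]; exact add_mem hx hy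
    | mem i x hx =>
      induction hb using Submodule.iSup_induction' with
      | zero => simp
      | add u v _ _ hu hv => rw [mul_add]; exact add_mem hu hv
      | mem j y hy =>
        exact Submodule.mem_iSup_of_mem (i + j) (wtsp_mul D hx hy)
  let N : Subalgebra ℂ B := M.toSubalgebra (Submodule.mem_iSup_of_mem 0 (wtsp_one D)) fun a b ha hb => hmul a ha b hb
  have hN : Algebra.adjoin ℂ (S : Set B) ≤ N := by
    refine Algebra.adjoin_le fun s hs => ?_
    have : (⨆ lam ∈ F s, wtsp D lam) ≤ M := by
      refine iSup₂_le fun lam hlam => ?_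
      exact le_iSup (fun lam : Λ => wtsp D lam.1)
        ⟨lam, AddSubgroup.subset_closure (by
          rw [Finset.mem_coe, Finset.mem_biUnion]; exact ⟨s, hs, hlam⟩)⟩
    exact this (hF s)
  refine eq_top_iff.mpr fun f _ => ?_
  exact hN (by rw [hS]; trivial : f ∈ Algebra.adjoin ℂ (S : Set B))

open DirectSum

/-- The grading by a lattice of weights. -/
lemma LocFin.exists_graded {D : Derivation ℂ B B} {Λ : AddSubgroup ℂ}
    (hΛ : ⨆ lam : Λ, wtsp D lam.1 = ⊤) : Nonempty (GradedAlgebra fun lam : Λ => wtsp D lam.1) := by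
  classical
  have hinternal : DirectSum.IsInternal (fun lam : Λ => wtsp D lam.1) := by
    rw [DirectSum.isInternal_submodule_iff_iSupIndep_and_iSup_eq_top]
    exact ⟨(Module.End.independent_maxGenEigenspace (D : B →ₗ[ℂ] B)).comp
      Subtype.val_injective, hΛ⟩
  have : SetLike.GradedMonoid fun lam : Λ => wtsp D lam.1 :=
    { one_mem := wtsp_one D
      mul_mem := fun _ _ _ _ hx hy => wtsp_mul D hx hy }
  let := hinternal.chooseDecomposition
  exact ⟨{ __ := this, __ := hinternal.chooseDecomposition }⟩

end Grading

end AlgGrp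

namespace AlgGrp

/-- Laurent polynomial functions on `ℂˣ`. -/
def laur : Subalgebra ℂ (ℂˣ → ℂ) :=
  Algebra.adjoin ℂ (Set.range (fun (_ : Fin 1) (a : ℂˣ) => (a : ℂ)) ∪
    Set.range (fun (_ : Fin 1) (a : ℂˣ) => ((a⁻¹ : ℂˣ) : ℂ)))

lemma coe_mem_laur : (fun z : ℂˣ => (z : ℂ)) ∈ laur :=
  Algebra.subset_adjoin (Or.inl ⟨0, rfl⟩)

lemma zpow_mem_laur (n : ℤ) : (fun z : ℂˣ => ((z ^ n : ℂˣ) : ℂ)) ∈ laur := by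
  rcases n with n | n
  · have := pow_mem coe_mem_laur n
    convert this using 1
    funext z; simp
  · have h : (fun z : ℂˣ => ((z⁻¹ : ℂˣ) : ℂ)) ∈ laur := Algebra.subset_adjoin (Or.inr ⟨0, rfl⟩)
    have := pow_mem h (n + 1)
    convert this using 1
    funext z; simp [zpow_negSucc]

lemma sum_zpow_deriv {ι : Type*} (s : Finset ι) (l : ι → ℤ) (c : ι → ℂ)
    (h : ∀ z : ℂˣ, ∑ i ∈ s, ((z ^ l i : ℂˣ) : ℂ) * c i = 0) : ∑ i ∈ s, (l i : ℂ) * c i = 0 := by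
  have h1 : HasDerivAt (fun z : ℂ => ∑ i ∈ s, z ^ l i * c i) (∑ i ∈ s, (l i : ℂ) * c i) 1 := by
    refine HasDerivAt.fun_sum fun i _ => ?_
    have := (hasDerivAt_zpow (l i) (1 : ℂ) (Or.inl one_ne_zero)).mul_const (c i)
    simpa using this
  have h2 : (fun z : ℂ => ∑ i ∈ s, z ^ l i * c i) =ᶠ[nhds 1] fun _ => 0 := by
    filter_upwards [isOpen_ne.mem_nhds (one_ne_zero : (1 : ℂ) ≠ 0)] with z hz
    have := h (Units.mk0 z hz)
    simpa using this
  exact (h1.congr_of_eventuallyEq h2.symm).unique (hasDerivAt_const _ _)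

section Flow
variable {B : Type} [CommRing B] [Algebra ℂ B]

/-- An algebraic family of automorphisms commuting with everything commuting with `D`, with
infinitesimal generator `d`. -/
structure Flow (D : Derivation ℂ B B) (θ : ℂˣ → B →ₐ[ℂ] B) (d : B → B) : Prop where
  one : ∀ f, θ 1 f = f
  reg : ∀ (α : B →ₗ[ℂ] ℂ) (f : B), (fun z => α (θ z f)) ∈ laur
  der : ∀ (α : B →ₗ[ℂ] ℂ) (f : B), (∀ z, α (θ z f) = 0) → α (d f) = 0
  nat : ∀ L : B →ₗ[ℂ] B, (∀ b, D (L b) = L (D b)) → ∀ z f, θ z (L f) = L (θ z f)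

open DirectSum
variable {D : Derivation ℂ B B} {Λ : AddSubgroup ℂ}

lemma exists_linear_of_graded (hΛ : ⨆ lam : Λ, wtsp D lam.1 = ⊤) {C : Type} [AddCommGroup C]
    [Module ℂ C] (f : Λ → B →ₗ[ℂ] C) : ∃ θ : B →ₗ[ℂ] C, ∀ i, ∀ a ∈ wtsp D i.1, θ a = f i a := by
  classical
  obtain ⟨hg⟩ := LocFin.exists_graded hΛ
  let 𝒜 : Λ → Submodule ℂ B := fun lam => wtsp D lam.1
  let : Decomposition 𝒜 := hg.toDecomposition
  let T : (⨁ i, 𝒜 i) →ₗ[ℂ] C := DirectSum.toModule ℂ Λ C fun i => (f i).comp (𝒜 i).subtype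
  refine ⟨T.comp (decomposeLinearEquiv 𝒜).toLinearMap, fun i a ha => ?_⟩
  have : decompose 𝒜 a = DirectSum.of _ i ⟨a, ha⟩ := decompose_of_mem 𝒜 ha
  simp only [LinearMap.comp_apply, LinearEquiv.coe_coe, decomposeLinearEquiv_apply, this]
  exact DirectSum.toModule_lof ℂ i _

lemma graded_induction (hΛ : ⨆ lam : Λ, wtsp D lam.1 = ⊤) {p : B → Prop}
    (h0 : p 0) (hadd : ∀ a b, p a → p b → p (a + b)) (h : ∀ (i : Λ), ∀ a ∈ wtsp D i.1, p a)
    (a : B) : p a :=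
  Submodule.iSup_induction _ (motive := p) (by rw [hΛ]; trivial) h h0 hadd

lemma graded_sum (hΛ : ⨆ lam : Λ, wtsp D lam.1 = ⊤) (f : B) :
    ∃ (s : Finset Λ) (g : Λ → B), (∀ i, g i ∈ wtsp D i.1) ∧ f = ∑ i ∈ s, g i := by
  classical
  obtain ⟨hg⟩ := LocFin.exists_graded hΛ
  exact ⟨_, fun i => decompose (fun lam : Λ => wtsp D lam.1) f i, fun i => SetLike.coe_mem _,
    (sum_support_decompose (fun lam : Λ => wtsp D lam.1) f).symm⟩

lemma exists_algHom_of_graded (hΛ : ⨆ lam : Λ, wtsp D lam.1 = ⊤) {C : Type} [CommRing C]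
    [Algebra ℂ C] (f : Λ → B →ₗ[ℂ] C) (hone : f 0 1 = 1)
    (hmul : ∀ i j : Λ, ∀ a ∈ wtsp D i.1, ∀ b ∈ wtsp D j.1, f (i + j) (a * b) = f i a * f j b) :
    ∃ θ : B →ₐ[ℂ] C, ∀ i, ∀ a ∈ wtsp D i.1, θ a = f i a := by
  obtain ⟨θ, hθ⟩ := exists_linear_of_graded hΛ f
  refine ⟨AlgHom.ofLinearMap θ ?_ ?_, hθ⟩
  · rw [hθ 0 1 (wtsp_one D), hone]
  · intro a b
    induction a using graded_induction hΛ with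
    | h0 => simp
    | hadd x y hx hy => rw [add_mul, map_add, hx, hy, map_add, add_mul]
    | h i a ha =>
      induction b using graded_induction hΛ with
      | h0 => simp
      | hadd x y hx hy => rw [mul_add, map_add, hx, hy, map_add, mul_add]
      | h j b hb => rw [hθ (i + j) _ (wtsp_mul D ha hb), hθ i a ha, hθ j b hb, hmul i j a ha b hb]

lemma shiftEnd_pow_nat {L : B →ₗ[ℂ] B} (hL : ∀ b, D (L b) = L (D b)) (lam : ℂ) (k : ℕ) (b : B) :
    (shiftEnd D lam ^ k) (L b) = L ((shiftEnd D lam ^ k) b) := by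
  induction k generalizing b with
  | zero => simp
  | succ k ih =>
    rw [pow_succ, Module.End.mul_apply, Module.End.mul_apply, ← ih]
    simp [shiftEnd_apply, hL]

lemma wtsp_nat {L : B →ₗ[ℂ] B} (hL : ∀ b, D (L b) = L (D b)) {lam : ℂ} {a : B}
    (ha : a ∈ wtsp D lam) : L a ∈ wtsp D lam := by
  obtain ⟨k, hk⟩ := mem_wtsp.mp ha
  exact mem_wtsp.mpr ⟨k, by rw [shiftEnd_pow_nat hL, hk, map_zero]⟩

/-- The semisimple flow attached to an integral functional on the weights. -/
lemma exists_flow_ss (hΛ : ⨆ lam : Λ, wtsp D lam.1 = ⊤) (l : Λ →+ ℤ) :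
    ∃ (θ : ℂˣ → B →ₐ[ℂ] B) (d : B →ₗ[ℂ] B), Flow D θ d ∧
      ∀ i : Λ, ∀ a ∈ wtsp D i.1, d a = (l i : ℂ) • a := by
  have h1 : ∀ z : ℂˣ, ∃ θ : B →ₐ[ℂ] B, ∀ i, ∀ a ∈ wtsp D i.1, θ a =
      (((z ^ l i : ℂˣ) : ℂ) • (LinearMap.id : B →ₗ[ℂ] B)) a := by
    intro z
    refine exists_algHom_of_graded hΛ _ (by simp) fun i j a _ b _ => ?_
    simp only [LinearMap.smul_apply, LinearMap.id_apply, map_add, zpow_add, Units.val_mul,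
      smul_mul_smul_comm]
  choose θ hθ using h1
  obtain ⟨d, hd⟩ := exists_linear_of_graded hΛ fun i => (l i : ℂ) • (LinearMap.id : B →ₗ[ℂ] B)
  refine ⟨θ, d, ⟨?_, ?_, ?_, ?_⟩, hd⟩
  · intro f
    induction f using graded_induction hΛ with
    | h0 => simp
    | hadd x y hx hy => rw [map_add, hx, hy]
    | h i a ha => simp [hθ 1 i a ha]
  · intro α f
    obtain ⟨s, g, hg, rfl⟩ := graded_sum hΛ f
    have : (fun z => α (θ z (∑ i ∈ s, g i))) =
        ∑ i ∈ s, α (g i) • fun z : ℂˣ => ((z ^ l i : ℂˣ) : ℂ) := by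
      funext z
      rw [map_sum, map_sum, Finset.sum_apply]
      refine Finset.sum_congr rfl fun i _ => ?_
      rw [hθ z i _ (hg i)]
      simp [mul_comm]
    rw [this]
    exact sum_mem fun i _ => Subalgebra.smul_mem _ (zpow_mem_laur _) _
  · intro α f hf
    obtain ⟨s, g, hg, rfl⟩ := graded_sum hΛ f
    have := sum_zpow_deriv s (fun i => l i) (fun i => α (g i)) fun z => by
      rw [← hf z, map_sum, map_sum]
      refine Finset.sum_congr rfl fun i _ => ?_
      rw [hθ z i _ (hg i)]
      simp
    rw [map_sum, map_sum, ← this]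
    refine Finset.sum_congr rfl fun i _ => ?_
    rw [hd i _ (hg i)]
    simp
  · intro L hL z f
    induction f using graded_induction hΛ with
    | h0 => simp
    | hadd x y hx hy => simp only [map_add, hx, hy]
    | h i a ha => rw [hθ z i a ha, hθ z i _ (wtsp_nat hL ha)]; simp

lemma divPow_mul (D : Derivation ℂ B B) (lam mu : ℂ) (n : ℕ) (a b : B) :
    (n.factorial : ℂ)⁻¹ • (shiftEnd D (lam + mu) ^ n) (a * b) =
      ∑ p ∈ Finset.HasAntidiagonal.antidiagonal n,
      ((p.1.factorial : ℂ)⁻¹ • (shiftEnd D lam ^ p.1) a) *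
        ((p.2.factorial : ℂ)⁻¹ • (shiftEnd D mu ^ p.2) b) := by
  rw [shiftEnd_pow_mul, Finset.smul_sum]
  refine Finset.sum_congr rfl fun p hp => ?_
  rw [Finset.HasAntidiagonal.mem_antidiagonal] at hp
  rw [smul_mul_smul_comm, ← Nat.cast_smul_eq_nsmul ℂ, smul_smul]
  congr 1
  subst hp
  have h1 : ((p.1 + p.2).factorial : ℂ) ≠ 0 := Nat.cast_ne_zero.mpr (Nat.factorial_ne_zero _)
  have h2 : (p.1.factorial : ℂ) ≠ 0 := Nat.cast_ne_zero.mpr (Nat.factorial_ne_zero _)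
  have h3 : (p.2.factorial : ℂ) ≠ 0 := Nat.cast_ne_zero.mpr (Nat.factorial_ne_zero _)
  have h4 : ((p.1 + p.2).choose p.1 : ℂ) * p.1.factorial * p.2.factorial =
      (p.1 + p.2).factorial := by
    rw [Nat.choose_symm_add]
    exact_mod_cast Nat.add_choose_mul_factorial_mul_factorial p.1 p.2
  field_simp
  linear_combination h4

/-- The exponential of the locally nilpotent part, as polynomial coaction. -/
lemma exists_nilp_coaction (hΛ : ⨆ lam : Λ, wtsp D lam.1 = ⊤) :
    ∃ P : B →ₐ[ℂ] Polynomial B, ∀ i : Λ, ∀ a ∈ wtsp D i.1, ∀ k,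
      (P a).coeff k = (k.factorial : ℂ)⁻¹ • (shiftEnd D i.1 ^ k) a := by
  let f : Λ → B →ₗ[ℂ] PowerSeries B := fun i =>
    { toFun := fun a => PowerSeries.mk fun k => (k.factorial : ℂ)⁻¹ • (shiftEnd D i.1 ^ k) a
      map_add' := fun a b => by ext k; simp
      map_smul' := fun c a => by ext k; simp [smul_comm c] }
  obtain ⟨Q, hQ⟩ := exists_algHom_of_graded hΛ f (by
      ext k
      rcases k with _ | k
      · simp [f]
      · simp only [f, LinearMap.coe_mk, AddHom.coe_mk, PowerSeries.coeff_mk, PowerSeries.coeff_one]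
        rw [pow_succ, Module.End.mul_apply]
        simp [shiftEnd_apply]) (by
      intro i j a _ b _
      ext k
      simp only [f, LinearMap.coe_mk, AddHom.coe_mk, PowerSeries.coeff_mk, PowerSeries.coeff_mul]
      exact divPow_mul D i.1 j.1 k a b)
  have hpoly : ∀ a, ∃ p : Polynomial B, (p : PowerSeries B) = Q a := by
    intro a
    induction a using graded_induction hΛ with
    | h0 => exact ⟨0, by simp⟩
    | hadd x y hx hy =>
      obtain ⟨p, hp⟩ := hx
      obtain ⟨q, hq⟩ := hy
      exact ⟨p + q, by simp [hp, hq]⟩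
    | h i a ha =>
      obtain ⟨k, hk⟩ := mem_wtsp.mp ha
      refine ⟨PowerSeries.trunc k (Q a), ?_⟩
      ext n
      rw [Polynomial.coeff_coe, PowerSeries.coeff_trunc]
      split_ifs with h
      · rfl
      · rw [hQ i a ha]
        simp [f, pow_apply_eq_zero_of_le hk (not_lt.mp h)]
  choose p hp using hpoly
  refine ⟨
    { toFun := p
      map_one' := Polynomial.coe_injective B (by simp [hp])
      map_mul' := fun a b => Polynomial.coe_injective B (by simp [hp])
      map_zero' := Polynomial.coe_injective B (by simp [hp])
      map_add' := fun a b => Polynomial.coe_injective B (by simp [hp])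
      commutes' := fun r => Polynomial.coe_injective B (by
        rw [hp, AlgHom.commutes]
        ext k
        simp [Polynomial.algebraMap_apply, PowerSeries.algebraMap_apply]) }, ?_⟩
  intro i a ha k
  change (p a).coeff k = _
  rw [← Polynomial.coeff_coe, hp, hQ i a ha]
  simp [f]

lemma exists_flow_nilp (hΛ : ⨆ lam : Λ, wtsp D lam.1 = ⊤) :
    ∃ (θ : ℂˣ → B →ₐ[ℂ] B) (d : B →ₗ[ℂ] B), Flow D θ d ∧
      ∀ i : Λ, ∀ a ∈ wtsp D i.1, d a = shiftEnd D i.1 a := by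
  obtain ⟨P, hP⟩ := exists_nilp_coaction hΛ
  let θ : ℂˣ → B →ₐ[ℂ] B := fun z =>
    ((Polynomial.aeval (algebraMap ℂ B ((z : ℂ) - 1)) : Polynomial B →ₐ[B] B).restrictScalars
      ℂ).comp P
  let d : B →ₗ[ℂ] B := ((Polynomial.lcoeff B 1).restrictScalars ℂ).comp P.toLinearMap
  have hd : ∀ f, d f = (P f).coeff 1 := fun f => rfl
  have hθ : ∀ (α : B →ₗ[ℂ] ℂ) z f, α (θ z f) = ∑ k ∈ Finset.range ((P f).natDegree + 1),
      α ((P f).coeff k) * ((z : ℂ) - 1) ^ k := by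
    intro α z f
    change α (Polynomial.aeval (algebraMap ℂ B ((z : ℂ) - 1)) (P f)) = _
    rw [Polynomial.aeval_eq_sum_range, map_sum]
    refine Finset.sum_congr rfl fun k _ => ?_
    rw [← map_pow, smul_eq_mul, mul_comm, ← Algebra.smul_def, map_smul, smul_eq_mul, mul_comm]
  refine ⟨θ, d, ⟨?_, ?_, ?_, ?_⟩, ?_⟩
  · intro f
    induction f using graded_induction hΛ with
    | h0 => simp
    | hadd x y hx hy => rw [map_add, hx, hy]
    | h i a ha =>
      change Polynomial.aeval (algebraMap ℂ B (((1 : ℂˣ) : ℂ) - 1)) (P a) = a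
      rw [Units.val_one, sub_self, map_zero, ← Polynomial.coeff_zero_eq_aeval_zero, hP i a ha]
      simp
  · intro α f
    have : (fun z => α (θ z f)) = ∑ k ∈ Finset.range ((P f).natDegree + 1),
        α ((P f).coeff k) • ((fun z : ℂˣ => (z : ℂ)) - 1) ^ k := by
      funext z
      rw [hθ, Finset.sum_apply]
      rfl
    rw [this]
    exact sum_mem fun i _ => Subalgebra.smul_mem _
      (pow_mem (sub_mem coe_mem_laur (one_mem _)) _) _
  · intro α f hf
    rw [hd]
    let q : Polynomial ℂ := ∑ k ∈ Finset.range ((P f).natDegree + 1),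
      Polynomial.monomial k (α ((P f).coeff k))
    have hq : q = 0 := by
      refine Polynomial.eq_zero_of_infinite_isRoot _ (Set.Infinite.mono (s := {(-1 : ℂ)}ᶜ) ?_
        (Set.finite_singleton _).infinite_compl)
      intro w hw
      have hw' : w + 1 ≠ 0 := fun h => hw (eq_neg_of_add_eq_zero_left h)
      have := hf (Units.mk0 (w + 1) hw')
      rw [hθ] at this
      change Polynomial.eval w q = 0
      simpa [q, Polynomial.eval_finsetSum] using this
    have hc : q.coeff 1 = α ((P f).coeff 1) := by
      simp only [q, Polynomial.finsetSum_coeff, Polynomial.coeff_monomial]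
      rw [Finset.sum_ite_eq' (Finset.range ((P f).natDegree + 1)) 1]
      split_ifs with h
      · rfl
      · rw [Polynomial.coeff_eq_zero_of_natDegree_lt, map_zero]
        simpa using h
    rw [← hc, hq, Polynomial.coeff_zero]
  · intro L hL z f
    induction f using graded_induction hΛ with
    | h0 => simp
    | hadd x y hx hy => simp only [map_add, hx, hy]
    | h i a ha =>
      have hc : ∀ k, (P (L a)).coeff k = L ((P a).coeff k) := fun k => by
        rw [hP i a ha, hP i _ (wtsp_nat hL ha), shiftEnd_pow_nat hL, map_smul]
      change Polynomial.aeval (algebraMap ℂ B ((z : ℂ) - 1)) (P (L a)) =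
        L (Polynomial.aeval (algebraMap ℂ B ((z : ℂ) - 1)) (P a))
      have hdeg : (P (L a)).natDegree < (P a).natDegree + 1 := by
        refine Nat.lt_succ_of_le (Polynomial.natDegree_le_iff_coeff_eq_zero.mpr fun N hN => ?_)
        rw [hc, Polynomial.coeff_eq_zero_of_natDegree_lt hN, map_zero]
      rw [Polynomial.aeval_eq_sum_range' hdeg, Polynomial.aeval_eq_sum_range, map_sum]
      refine Finset.sum_congr rfl fun k _ => ?_
      rw [hc, ← map_pow, smul_eq_mul, smul_eq_mul, mul_comm, ← Algebra.smul_def, mul_comm,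
        ← Algebra.smul_def, map_smul]
  · intro i a ha
    rw [hd, hP i a ha]
    simp

/-- A locally finite derivation is a combination of generators of algebraic flows. -/
theorem LocFin.mem_of_flows [Algebra.FiniteType ℂ B] (h : LocFin D) (I : Submodule ℂ B) (f : B)
    (hI : ∀ θ d, Flow D θ d → d f ∈ I) : D f ∈ I := by
  obtain ⟨Λ, hfg, hΛ⟩ := h.exists_lattice
  have : Module.Finite ℤ Λ := by
    rw [Module.Finite.iff_addGroup_fg]
    exact (AddGroup.fg_iff_addSubgroup_fg Λ).mpr hfg
  let b := Module.Free.chooseBasis ℤ Λ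
  have h1 := fun j => exists_flow_ss hΛ (b.coord j).toAddMonoidHom
  choose θ d hfl hd using h1
  obtain ⟨θ₀, d₀, hfl₀, hd₀⟩ := exists_flow_nilp hΛ
  have key : ∀ f, D f = d₀ f + ∑ j, (b j : ℂ) • d j f := by
    intro f
    induction f using graded_induction hΛ with
    | h0 => simp
    | hadd x y hx hy =>
      simp only [map_add, hx, hy, smul_add, Finset.sum_add_distrib]
      abel
    | h i a ha =>
      rw [hd₀ i a ha, shiftEnd_apply]
      have h2 : ∑ j, (b j : ℂ) • d j a = (i : ℂ) • a := by
        have h3 : (i : ℂ) = ∑ j, (b.repr i j : ℂ) * (b j : ℂ) := by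
          conv_lhs => rw [← b.sum_repr i]
          push_cast
          simp
        rw [h3, Finset.sum_smul]
        refine Finset.sum_congr rfl fun j _ => ?_
        rw [hd j i a ha, smul_smul, mul_comm]
        rfl
      rw [h2]; abel
  rw [key]
  exact add_mem (hI _ _ hfl₀) (sum_mem fun j _ => I.smul_mem _ (hI _ _ (hfl j)))

end Flow

end AlgGrp

namespace AlgGrp

section PointDer
variable {H : Type} [Group H] {O : Subalgebra ℂ (H → ℂ)}

/-- Left translation of regular functions. -/
def ltransO (h : IsGrp O) (g : H) : O →ₐ[ℂ] O :=
  ((pull fun x => g * x).comp O.val).codRestrict O fun f => h.left g f.1 f.2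

@[simp] lemma ltransO_apply (h : IsGrp O) (g : H) (f : O) (x : H) :
    (ltransO h g f).1 x = f.1 (g * x) := rfl

/-- Point derivations at the identity. -/
def IsPtDer (X : O →ₗ[ℂ] ℂ) : Prop := ∀ a b : O, X (a * b) = a.1 1 * X b + b.1 1 * X a

lemma IsGrp.exists_split (h : IsGrp O) (f : O) :
    ∃ S : Finset (O × O), ∀ x, ltransO h x f = ∑ i ∈ S, i.1.1 x • i.2 := by
  obtain ⟨S, hS⟩ := mem_prodAlg_iff.mp (h.mul f.1 f.2)
  refine ⟨S, fun x => Subtype.ext (funext fun y => ?_)⟩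
  have := hS x y
  simp only [ltransO_apply, AddSubmonoidClass.coe_finsetSum, Finset.sum_apply]
  exact this

lemma derivAt_mem (h : IsGrp O) (X : O →ₗ[ℂ] ℂ) (f : O) : (fun x => X (ltransO h x f)) ∈ O := by
  obtain ⟨S, hS⟩ := h.exists_split f
  have : (fun x => X (ltransO h x f)) = ∑ i ∈ S, X i.2 • i.1.1 := by
    funext x
    rw [hS, map_sum, Finset.sum_apply]
    refine Finset.sum_congr rfl fun i _ => ?_
    simp [mul_comm]
  rw [this]
  exact sum_mem fun i _ => Subalgebra.smul_mem _ i.1.2 _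

/-- The left invariant derivation attached to a point derivation. -/
def linvDer (h : IsGrp O) (X : O →ₗ[ℂ] ℂ) (hX : IsPtDer X) : Derivation ℂ O O :=
  Derivation.mk' 
    { toFun := fun f => ⟨fun x => X (ltransO h x f), derivAt_mem h X f⟩
      map_add' := fun a b => Subtype.ext (funext fun x => by simp)
      map_smul' := fun c a => Subtype.ext (funext fun x => by simp) }
    (fun a b => Subtype.ext (funext fun x => by
      simp [hX (ltransO h x a) (ltransO h x b)]))

lemma linvDer_apply (h : IsGrp O) (X : O →ₗ[ℂ] ℂ) (hX : IsPtDer X) (f : O) (x : H) :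
    (linvDer h X hX f).1 x = X (ltransO h x f) := rfl

lemma ltransO_ltransO (h : IsGrp O) (x y : H) (f : O) :
    ltransO h x (ltransO h y f) = ltransO h (y * x) f :=
  Subtype.ext (funext fun z => by simp [mul_assoc])

lemma ltransO_one (h : IsGrp O) (f : O) : ltransO h 1 f = f :=
  Subtype.ext (funext fun z => by simp)

lemma linvDer_ltransO (h : IsGrp O) (X : O →ₗ[ℂ] ℂ) (hX : IsPtDer X) (g : H) (f : O) :
    linvDer h X hX (ltransO h g f) = ltransO h g (linvDer h X hX f) :=
  Subtype.ext (funext fun x => by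
    rw [linvDer_apply, ltransO_ltransO, ltransO_apply, linvDer_apply])

lemma linvDer_locFin (h : IsGrp O) (X : O →ₗ[ℂ] ℂ) (hX : IsPtDer X) :
    LocFin (linvDer h X hX) := by
  classical
  intro f
  obtain ⟨S, hS⟩ := h.exists_split f
  let D := linvDer h X hX
  let W : Submodule ℂ O := Submodule.span ℂ (Set.range fun k : ℕ => (D^[k]) f)
  have hk : ∀ k : ℕ, ∀ x, ltransO h x (D^[k] f) = D^[k] (ltransO h x f) := by
    intro k
    induction k with
    | zero => intro x; rfl
    | succ k ih =>
      intro x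
      rw [Function.iterate_succ_apply', Function.iterate_succ_apply', ← ih]
      exact (linvDer_ltransO h X hX x _).symm
  have hlin : ∀ k : ℕ, ∀ b, D^[k] b = (((D : O →ₗ[ℂ] O) ^ k : Module.End ℂ O)) b := by
    intro k b
    rw [Module.End.pow_apply]; rfl
  have hle : W ≤ Submodule.span ℂ ((S.image Prod.fst : Finset O) : Set O) := by
    refine Submodule.span_le.mpr ?_
    rintro _ ⟨k, rfl⟩
    have : D^[k] f = ∑ i ∈ S, (D^[k] i.2).1 1 • i.1 := by
      refine Subtype.ext (funext fun x => ?_)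
      have h1 : (D^[k] f).1 x = (ltransO h x (D^[k] f)).1 1 := by simp
      rw [h1, hk, hS, hlin, map_sum]
      simp only [AddSubmonoidClass.coe_finsetSum, Finset.sum_apply, map_smul, hlin]
      refine Finset.sum_congr rfl fun i _ => ?_
      simp [mul_comm]
    change D^[k] f ∈ _
    rw [this]
    exact sum_mem fun i hi => Submodule.smul_mem _ _
      (Submodule.subset_span (Finset.mem_coe.mpr (Finset.mem_image_of_mem _ hi)))
  refine ⟨W, Submodule.finiteDimensional_of_le hle, Submodule.subset_span ⟨0, rfl⟩, ?_⟩
  have : W ≤ W.comap (D : O →ₗ[ℂ] O) := by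
    refine Submodule.span_le.mpr ?_
    rintro _ ⟨k, rfl⟩
    refine Submodule.subset_span ⟨k + 1, ?_⟩
    simp only [Function.iterate_succ_apply']
    rfl
  exact fun w hw => this hw

/-- The curve of group elements attached to a flow. -/
lemma Flow.exists_curve (h : IsGrp O) {X : O →ₗ[ℂ] ℂ} {hX : IsPtDer X} {θ : ℂˣ → O →ₐ[ℂ] O}
    {d : O → O} (hF : Flow (linvDer h X hX) θ d) :
    ∃ c : ℂˣ → H, c 1 = 1 ∧ Reg laur O c ∧
      ∀ (x : H) (f : O), (∀ z, f.1 (x * c z) = 0) → (d f).1 x = 0 := by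
  have h1 := fun z => h.point ((evalAt O 1).comp (θ z))
  choose c hc using h1
  have hmul : ∀ z x (f : O), f.1 (x * c z) = (θ z f).1 x := by
    intro z x f
    have h2 := hc z (ltransO h x f)
    have h3 := hF.nat (ltransO h x).toLinearMap (fun b => linvDer_ltransO h X hX x b) z f
    simp only [AlgHom.toLinearMap_apply] at h3
    rw [AlgHom.comp_apply, h3, evalAt_apply, ltransO_apply, ltransO_apply, mul_one] at h2
    exact h2.symm
  refine ⟨c, ?_, ?_, ?_⟩
  · refine h.sep _ _ fun f hf => ?_
    have := hc 1 ⟨f, hf⟩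
    rw [AlgHom.comp_apply, hF.one] at this
    exact this.symm
  · intro f hf
    have := hF.reg (evalAt O 1).toLinearMap ⟨f, hf⟩
    convert this using 1
    funext z
    exact (hc z ⟨f, hf⟩).symm
  · intro x f hf
    exact hF.der (evalAt O x).toLinearMap f fun z => by
      have := hf z
      rw [hmul] at this
      exact this

end PointDer

section Euler
variable {H : Type} [Group H] {O : Subalgebra ℂ (H → ℂ)}

/-- Enough point derivations to span the cotangent space. -/
lemma exists_cotangent (h : IsGrp O) : ∃ (n : ℕ) (x : Fin n → O) (X : Fin n → O →ₗ[ℂ] ℂ),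
    (∀ i, IsPtDer (X i)) ∧ (∀ i, (x i).1 1 = 0) ∧ ∀ g : O, g.1 1 = 0 →
      g - ∑ i, X i g • x i ∈ (RingHom.ker (evalAt O 1)) ^ 2 := by
  classical
  have := h.noeth
  set m : Ideal O := RingHom.ker (evalAt O 1) with hm
  have hmem : ∀ g : O, g ∈ m ↔ g.1 1 = 0 := fun g => RingHom.mem_ker
  let M2 : Submodule ℂ O := (m ^ 2).restrictScalars ℂ
  let π : O →ₗ[ℂ] O ⧸ M2 := M2.mkQ
  let U : Submodule ℂ (O ⧸ M2) := (m.restrictScalars ℂ).map π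
  have hπ : ∀ a : O, ∀ x ∈ m, π (a * x) = a.1 1 • π x := by
    intro a x hx
    rw [← map_smul, ← sub_eq_zero, ← map_sub]
    refine (Submodule.Quotient.mk_eq_zero _).mpr ?_
    change a * x - a.1 1 • x ∈ m ^ 2
    have : a * x - a.1 1 • x = (a - algebraMap ℂ O (a.1 1)) * x := by
      rw [sub_mul, Algebra.smul_def]
    rw [this, pow_two]
    refine Ideal.mul_mem_mul ((hmem _).mpr ?_) hx
    simp
  have hfin : FiniteDimensional ℂ U := by
    obtain ⟨S, hS⟩ := (isNoetherianRing_iff_ideal_fg O).mp this m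
    refine Submodule.finiteDimensional_of_le (S₂ := Submodule.span ℂ
      ((S.image π : Finset _) : Set (O ⧸ M2))) ?_
    rintro _ ⟨g, hg, rfl⟩
    have hg' : g ∈ Submodule.span O (S : Set O) := by
      have : g ∈ m := hg
      rwa [← hS] at this
    induction hg' using Submodule.span_induction with
    | mem x hx => exact Submodule.subset_span (Finset.mem_coe.mpr (Finset.mem_image_of_mem _ hx))
    | zero => simp
    | add a b ha hb iha ihb =>
      rw [map_add]
      exact add_mem (iha (hS.le ha)) (ihb (hS.le hb))
    | smul a x hx ih =>
      rw [smul_eq_mul, hπ a x (hS.le hx)]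
      exact Submodule.smul_mem _ _ (ih (hS.le hx))
  have hfree : Module.Free ℂ U := Module.Free.of_divisionRing ℂ U
  let b := Module.finBasis ℂ U
  have hlift : ∀ i, ∃ x ∈ m, π x = (b i).1 := fun i => (b i).2
  choose x hx hxb using hlift
  let r : O →ₗ[ℂ] O :=
    { toFun := fun a => a - algebraMap ℂ O (a.1 1)
      map_add' := fun a b => by simp only [Subalgebra.coe_add, Pi.add_apply, map_add]; ring
      map_smul' := fun c a => by
        simp only [Subalgebra.coe_smul, Pi.smul_apply, smul_eq_mul, map_mul, RingHom.id_apply,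
          smul_sub]
        rw [Algebra.smul_def c (algebraMap ℂ O (a.1 1))] }
  have hr : ∀ a, r a ∈ m := fun a => (hmem _).mpr (by simp [r])
  let κ : O →ₗ[ℂ] U := (π.comp r).codRestrict U fun a => ⟨r a, hr a, rfl⟩
  refine ⟨_, x, fun i => (b.coord i).comp κ, fun i => ?_, fun i => (hmem _).mp (hx i), ?_⟩
  · intro a c
    have : κ (a * c) = a.1 1 • κ c + c.1 1 • κ a := by
      refine Subtype.ext ?_
      change π (r (a * c)) = a.1 1 • π (r c) + c.1 1 • π (r a)
      have h1 : r (a * c) = a * r c + algebraMap ℂ O (c.1 1) * r a := by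
        simp only [r, LinearMap.coe_mk, AddHom.coe_mk, Subalgebra.coe_mul, Pi.mul_apply, map_mul]
        ring
      rw [h1, map_add, hπ a _ (hr c), hπ _ _ (hr a)]
      rfl
    simp [this]
  · intro g hg
    have hrg : r g = g := by simp [r, hg]
    have h1 : κ g = ∑ i, b.coord i (κ g) • b i := (b.sum_repr (κ g)).symm
    have h2 : π g = ∑ i, b.coord i (κ g) • π (x i) := by
      have := congrArg Subtype.val h1
      simp only [AddSubmonoidClass.coe_finsetSum, Submodule.coe_smul, ← hxb] at this
      rw [← this]
      change π g = π (r g)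
      rw [hrg]
    have h3 : π (g - ∑ i, b.coord i (κ g) • x i) = 0 := by
      rw [map_sub, h2, map_sum]
      simp
    exact (Submodule.Quotient.mk_eq_zero _).mp h3

/-- An ideal in the ideal of the identity stable under invariant derivations vanishes. -/
theorem eq_bot_of_stable (h : IsGrp O) (hirr : ZIrr O) (P : Ideal O)
    (h1 : ∀ f ∈ P, f.1 1 = 0)
    (hD : ∀ (X : O →ₗ[ℂ] ℂ) (hX : IsPtDer X), ∀ f ∈ P, linvDer h X hX f ∈ P) : P = ⊥ := by
  have := h.noeth
  have := hirr.isDomain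
  obtain ⟨n, x, X, hX, hx, hg⟩ := exists_cotangent h
  set m : Ideal O := RingHom.ker (evalAt O 1) with hm
  have hmem : ∀ g : O, g ∈ m ↔ g.1 1 = 0 := fun g => RingHom.mem_ker
  let L : O → O := fun f => ∑ i, x i * linvDer h (X i) (hX i) f
  have hLadd : ∀ a b, L (a + b) = L a + L b := fun a b => by
    simp [L, mul_add, Finset.sum_add_distrib]
  have hLmul : ∀ a b, L (a * b) = a * L b + b * L a := fun a b => by
    simp only [L, Derivation.leibniz, smul_eq_mul, Finset.mul_sum, ← Finset.sum_add_distrib]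
    exact Finset.sum_congr rfl fun i _ => by ring
  have hL1 : ∀ g ∈ m, L g - g ∈ m ^ 2 := by
    intro g hgm
    have e : L g - g = ∑ i, x i * (linvDer h (X i) (hX i) g - algebraMap ℂ O (X i g)) -
        (g - ∑ i, X i g • x i) := by
      have e0 : ∀ i, X i g • x i = x i * algebraMap ℂ O (X i g) := fun i => by
        rw [Algebra.smul_def, mul_comm]
      simp only [L, mul_sub, Finset.sum_sub_distrib, e0]
      ring
    rw [e]
    refine sub_mem (sum_mem fun i _ => ?_) (hg g ((hmem g).mp hgm))
    rw [pow_two]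
    refine Ideal.mul_mem_mul ((hmem _).mpr (hx i)) ((hmem _).mpr ?_)
    simp [linvDer_apply, ltransO_one]
  have hLk : ∀ k : ℕ, ∀ f ∈ m ^ k, L f - (k : O) * f ∈ m ^ (k + 1) := by
    intro k
    induction k with
    | zero =>
      intro f _
      simp only [Nat.cast_zero, zero_mul, sub_zero, zero_add, pow_one]
      exact sum_mem fun i _ => Ideal.mul_mem_right _ _ ((hmem _).mpr (hx i))
    | succ k ih =>
      intro f hf
      rw [pow_succ] at hf
      induction hf using Submodule.mul_induction_on' with
      | mem_mul_mem a ha b hb =>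
        have e : L (a * b) - ((k + 1 : ℕ) : O) * (a * b) =
            a * (L b - b) + (L a - k * a) * b := by
          rw [hLmul]; push_cast; ring
        rw [e]
        refine add_mem ?_ ?_
        · have := Ideal.mul_mem_mul ha (hL1 b hb)
          rwa [← pow_add] at this
        · have := Ideal.mul_mem_mul (ih a ha) hb
          rwa [← pow_succ] at this
      | add a _ b _ iha ihb =>
        have e : L (a + b) - ((k + 1 : ℕ) : O) * (a + b) =
          (L a - ((k + 1 : ℕ) : O) * a) + (L b - ((k + 1 : ℕ) : O) * b) := by
          rw [hLadd]; ring
        rw [e]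
        exact add_mem iha ihb
  have hP : ∀ k : ℕ, P ≤ m ^ k := by
    intro k
    induction k with
    | zero => simp
    | succ k ih =>
      intro f hf
      rcases Nat.eq_zero_or_pos k with rfl | hk
      · simpa using (hmem f).mpr (h1 f hf)
      have e1 : L f ∈ m ^ (k + 1) := by
        refine sum_mem fun i _ => ?_
        have := Ideal.mul_mem_mul (ih (hD (X i) (hX i) f hf)) ((hmem _).mpr (hx i))
        rw [← pow_succ] at this
        rwa [mul_comm]
      have e2 : (k : O) * f ∈ m ^ (k + 1) := by
        have := sub_mem e1 (hLk k f (ih hf))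
        simpa using this
      have e3 : f = algebraMap ℂ O (k : ℂ)⁻¹ * ((k : O) * f) := by
        have : (k : O) = algebraMap ℂ O (k : ℂ) := by simp
        rw [this, ← mul_assoc, ← map_mul, inv_mul_cancel₀ (Nat.cast_ne_zero.mpr hk.ne'), map_one,
          one_mul]
      rw [e3]
      exact Ideal.mul_mem_left _ _ e2
  have htop : m ≠ ⊤ := fun ht => by
    have : (1 : O) ∈ m := ht ▸ Submodule.mem_top
    simpa using (hmem 1).mp this
  refine eq_bot_iff.mpr ?_
  rw [← Ideal.iInf_pow_eq_bot_of_isDomain m htop]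
  exact le_iInf hP

end Euler

end AlgGrp

namespace AlgGrp

section Laur
variable {Y : Type} {O₂ : Subalgebra ℂ (Y → ℂ)}

lemma laur_le {S : Subalgebra ℂ (ℂˣ → ℂ)} (h1 : (fun z : ℂˣ => (z : ℂ)) ∈ S)
    (h2 : (fun z : ℂˣ => ((z⁻¹ : ℂˣ) : ℂ)) ∈ S) : laur ≤ S := by
  refine Algebra.adjoin_le ?_
  rintro _ (⟨_, rfl⟩ | ⟨_, rfl⟩)
  · exact h1
  · exact h2

lemma inv_mem_laur : (fun z : ℂˣ => ((z⁻¹ : ℂˣ) : ℂ)) ∈ laur :=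
  Algebra.subset_adjoin (Or.inr ⟨0, rfl⟩)

lemma reg_laur {g : Y → ℂˣ} (h1 : (fun y => (g y : ℂ)) ∈ O₂)
    (h2 : (fun y => (((g y)⁻¹ : ℂˣ) : ℂ)) ∈ O₂) : Reg O₂ laur g :=
  fun _ hf => laur_le (S := O₂.comap (pull g)) h1 h2 hf

lemma isTor_laur : IsTor laur (fun _ : Fin 1 => MonoidHom.id ℂˣ) where
  fg := Subalgebra.fg_def.mpr ⟨_, Set.Finite.union (Set.finite_range _) (Set.finite_range _), rfl⟩
  point φ := by
    let z : laur := ⟨_, coe_mem_laur⟩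
    let w : laur := ⟨_, inv_mem_laur⟩
    have hzw : z * w = 1 := Subtype.ext (funext fun a => by simp [z, w])
    have h1 : φ z * φ w = 1 := by rw [← map_mul, hzw, map_one]
    let a : ℂˣ := ⟨φ z, φ w, h1, by rw [mul_comm, h1]⟩
    refine ⟨a, fun f => ?_⟩
    obtain ⟨f, hf⟩ := f
    induction hf using Algebra.adjoin_induction with
    | mem x hx =>
      rcases hx with ⟨j, rfl⟩ | ⟨j, rfl⟩
      · rfl
      · rfl
    | algebraMap r => exact φ.commutes r
    | add x y hx hy h1 h2 =>
      have := map_add φ ⟨x, hx⟩ ⟨y, hy⟩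
      rw [h1, h2] at this
      exact this
    | mul x y hx hy h1 h2 =>
      have := map_mul φ ⟨x, hx⟩ ⟨y, hy⟩
      rw [h1, h2] at this
      exact this
  sep x y h := Units.ext (h _ coe_mem_laur)
  mul := by
    refine reg_laur ?_ ?_
    · have := mul_mem (reg_fst (O₁ := laur) (O₂ := laur) _ coe_mem_laur)
        (reg_snd (O₁ := laur) (O₂ := laur) _ coe_mem_laur)
      convert this using 1
      funext p; simp
    · have := mul_mem (reg_fst (O₁ := laur) (O₂ := laur) _ inv_mem_laur)
        (reg_snd (O₁ := laur) (O₂ := laur) _ inv_mem_laur)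
      convert this using 1
      funext p; simp [mul_comm]
  inv := by
    refine reg_laur inv_mem_laur ?_
    simpa using coe_mem_laur
  bij := by
    refine ⟨fun a b hab => congrFun hab 0, fun f => ⟨f 0, funext fun j => ?_⟩⟩
    rw [Subsingleton.elim j 0]; rfl
  gen := rfl

lemma exists_path_units (w : ℂˣ) : ∃ c : ℝ → ℂˣ, c 0 = 1 ∧ c 1 = w ∧
    ∀ b ∈ laur, Continuous (b ∘ c) := by
  have he : Complex.exp (Complex.log w) = w := Complex.exp_log w.ne_zero
  let c : ℝ → ℂˣ := fun t => Units.mk0 (Complex.exp (t * Complex.log w)) (Complex.exp_ne_zero _)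
  refine ⟨c, Units.ext (by simp [c]), Units.ext (by simp [c, he]), ?_⟩
  intro b hb
  let S : Subalgebra ℂ (ℂˣ → ℂ) :=
    { carrier := {b | Continuous (b ∘ c)}
      mul_mem' := fun ha hb => Continuous.mul ha hb
      add_mem' := fun ha hb => Continuous.add ha hb
      algebraMap_mem' := fun r => continuous_const }
  have h1 : laur ≤ S := by
    refine laur_le ?_ ?_
    · change Continuous fun t : ℝ => Complex.exp (t * Complex.log w)
      fun_prop
    · have : (fun z : ℂˣ => ((z⁻¹ : ℂˣ) : ℂ)) ∘ c = fun t : ℝ => Complex.exp (-(t * Complex.log w)) := by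
        funext t
        simp [c, Complex.exp_neg]
      change Continuous ((fun z : ℂˣ => ((z⁻¹ : ℂˣ) : ℂ)) ∘ c)
      rw [this]
      fun_prop
  exact h1 hb

end Laur

section Fam
variable {H : Type} [Group H] {O : Subalgebra ℂ (H → ℂ)}

/-- A family of group elements through the identity, with a path connected base. -/
structure Fam (O : Subalgebra ℂ (H → ℂ)) {Y : Type} (B : Subalgebra ℂ (Y → ℂ)) (y₁ : Y)
    (Φ : Y → H) : Prop where
  aff : IsAff B
  irr : ZIrr B
  reg : Reg B O Φ
  base : Φ y₁ = 1
  path : ∀ y, ∃ c : ℝ → Y, c 0 = y₁ ∧ c 1 = y ∧ ∀ b ∈ B, Continuous (b ∘ c)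

lemma Fam.mul (h : IsGrp O) {Y Y' : Type} {B : Subalgebra ℂ (Y → ℂ)} {B' : Subalgebra ℂ (Y' → ℂ)}
    {y₁ : Y} {y₁' : Y'} {Φ : Y → H} {Φ' : Y' → H} (hF : Fam O B y₁ Φ) (hF' : Fam O B' y₁' Φ') :
    Fam O (prodAlg B B') (y₁, y₁') (fun p => Φ p.1 * Φ' p.2) where
  aff := hF.aff.prod hF'.aff
  irr := hF.irr.prod hF'.irr
  reg := h.mulReg (hF.reg.comp reg_fst) (hF'.reg.comp reg_snd)
  base := by simp [hF.base, hF'.base]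
  path := by
    rintro ⟨y, y'⟩
    obtain ⟨c, h0, h1, hc⟩ := hF.path y
    obtain ⟨c', h0', h1', hc'⟩ := hF'.path y'
    refine ⟨fun t => (c t, c' t), by simp [h0, h0'], by simp [h1, h1'], fun b hb => ?_⟩
    obtain ⟨S, hS⟩ := mem_prodAlg_iff.mp hb
    have : b ∘ (fun t => (c t, c' t)) = fun t => ∑ i ∈ S, i.1.1 (c t) * i.2.1 (c' t) :=
      funext fun t => hS _ _
    rw [this]
    exact continuous_finsetSum _ fun i _ => (hc _ i.1.2).mul (hc' _ i.2.2)

lemma fam_laur {c : ℂˣ → H} (h1 : c 1 = 1) (hc : Reg laur O c) : Fam O laur 1 c where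
  aff := isTor_laur.toIsAff
  irr := isTor_laur.toIsGrp.irr isTor_laur.conn
  reg := hc
  base := h1
  path := exists_path_units

/-- Functions vanishing on a family. -/
def vanIdeal (O : Subalgebra ℂ (H → ℂ)) {Y : Type} (Φ : Y → H) : Ideal O where
  carrier := {f | ∀ y, f.1 (Φ y) = 0}
  zero_mem' _ := rfl
  add_mem' ha hb y := by simp [ha y, hb y]
  smul_mem' c f hf y := by simp [hf y]

lemma Fam.prime {Y : Type} {B : Subalgebra ℂ (Y → ℂ)} {y₁ : Y} {Φ : Y → H}
    (hF : Fam O B y₁ Φ) : (vanIdeal O Φ).IsPrime where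
  ne_top' := fun ht => by
    have : (1 : O) ∈ vanIdeal O Φ := ht ▸ Submodule.mem_top
    simpa using this y₁
  mem_or_mem' := fun {a b} hab => by
    rcases hF.irr _ (hF.reg a.1 a.2) _ (hF.reg b.1 b.2) (funext hab) with h | h
    · exact Or.inl fun y => congrFun h y
    · exact Or.inr fun y => congrFun h y

/-- There is a Zariski dense family. -/
theorem exists_dense_fam (h : IsGrp O) (hirr : ZIrr O) :
    ∃ (Y : Type) (B : Subalgebra ℂ (Y → ℂ)) (y₁ : Y) (Φ : Y → H), Fam O B y₁ Φ ∧
      vanIdeal O Φ = ⊥ := by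
  have := h.noeth
  have := h.finiteType
  let T : Set (Ideal O) := {P | ∃ (Y : Type) (B : Subalgebra ℂ (Y → ℂ)) (y₁ : Y) (Φ : Y → H),
    Fam O B y₁ Φ ∧ vanIdeal O Φ = P}
  have hT : T.Nonempty := by
    refine ⟨_, ℂˣ, laur, 1, fun _ => 1, fam_laur rfl (Reg.const _ _ _), rfl⟩
  obtain ⟨P, ⟨Y, B, y₁, Φ, hF, rfl⟩, hmin⟩ :=
    (InvImage.wf (fun P : Ideal O => P.height) wellFounded_lt).has_min T hT
  refine ⟨Y, B, y₁, Φ, hF, ?_⟩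
  have hmul : ∀ c : ℂˣ → H, c 1 = 1 → Reg laur O c → ∀ f ∈ vanIdeal O Φ, ∀ y z,
      f.1 (Φ y * c z) = 0 := by
    intro c h1 hc f hf y z
    have hF2 := hF.mul h (fam_laur h1 hc)
    have hp1 := hF.prime
    have hp2 := hF2.prime
    have hle : vanIdeal O (fun p : Y × ℂˣ => Φ p.1 * c p.2) ≤ vanIdeal O Φ := by
      intro g hg y
      have := hg (y, 1)
      simpa [h1] using this
    rcases hle.lt_or_eq with hlt | heq
    · exact absurd (Ideal.height_strict_mono_of_isPrime_of_isPrime hlt)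
        (hmin _ ⟨_, _, _, _, hF2, rfl⟩)
    · rw [← heq] at hf
      exact hf (y, z)
  refine eq_bot_of_stable h hirr _ (fun f hf => by rw [← hF.base]; exact hf y₁) ?_
  intro X hX f hf
  refine (linvDer_locFin h X hX).mem_of_flows ((vanIdeal O Φ).restrictScalars ℂ) f ?_
  intro θ d hfl
  obtain ⟨c, h1, hc, hd⟩ := hfl.exists_curve h
  exact fun y => hd (Φ y) f fun z => hmul c h1 hc f hf y z

/-- A dominant map contains a basic open set in its image. -/
lemma exists_basic_open {X Y : Type} {O₁ : Subalgebra ℂ (X → ℂ)} {O₂ : Subalgebra ℂ (Y → ℂ)}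
    [Nonempty X] (h₁ : IsAff O₁) (h₂ : IsAff O₂) (hi : ZIrr O₁) {g : X → Y}
    (hg : Reg O₁ O₂ g) (hdom : ∀ f ∈ O₂, (∀ x, f (g x) = 0) → f = 0) :
    ∃ f ∈ O₂, f ≠ 0 ∧ ∀ y, f y ≠ 0 → ∃ x, g x = y := by
  have := h₁.finiteType
  have := h₂.finiteType
  have := h₂.noeth
  have := hi.isDomain
  let r : O₂ →ₐ[ℂ] O₁ := ((pull g).comp O₂.val).codRestrict O₁ fun f => hg f.1 f.2
  have hr : ∀ f x, (r f).1 x = f.1 (g x) := fun f x => rfl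
  have hft : (r : O₂ →+* O₁).FinitePresentation := by
    rw [← RingHom.FinitePresentation.of_finiteType]
    let : Algebra O₂ O₁ := (r : O₂ →+* O₁).toAlgebra
    have : IsScalarTower ℂ O₂ O₁ := IsScalarTower.of_algebraMap_eq fun z => (r.commutes z).symm
    exact Algebra.FiniteType.of_restrictScalars_finiteType ℂ O₂ O₁
  obtain ⟨S, hS⟩ := PrimeSpectrum.exists_constructibleSetData_iff.mpr
    (PrimeSpectrum.isConstructible_range_comap hft)
  have hinj : Function.Injective r := by
    rw [injective_iff_map_eq_zero]
    intro f hf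
    exact Subtype.ext (hdom f.1 f.2 fun x => by rw [← hr, hf]; rfl)
  have hdomain : IsDomain O₂ := hinj.isDomain r.toRingHom
  have hbot : (⟨⊥, Ideal.isPrime_bot⟩ : PrimeSpectrum O₂) ∈ S.toSet := by
    rw [hS]
    refine ⟨⟨⊥, Ideal.isPrime_bot⟩, PrimeSpectrum.ext ?_⟩
    exact (RingHom.injective_iff_ker_eq_bot (r : O₂ →+* O₁)).mp hinj
  simp only [PrimeSpectrum.ConstructibleSetData.toSet, Set.mem_iUnion] at hbot
  obtain ⟨C, hC, hbot1, hbot2⟩ := hbot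
  have hCg : ∀ i, C.g i = 0 := fun i => hbot1 ⟨i, rfl⟩
  have hCf : C.f ≠ 0 := fun h0 => hbot2 (by simp [h0])
  refine ⟨C.f.1, C.f.2, fun h0 => hCf (Subtype.ext h0), fun y hy => ?_⟩
  let my : PrimeSpectrum O₂ := ⟨RingHom.ker (evalAt O₂ y), RingHom.ker_isPrime _⟩
  have hmy : my ∈ S.toSet := by
    simp only [PrimeSpectrum.ConstructibleSetData.toSet, Set.mem_iUnion]
    refine ⟨C, hC, ?_, ?_⟩
    · rintro _ ⟨i, rfl⟩
      rw [hCg]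
      exact zero_mem _
    · intro hc
      exact hy (hc rfl)
  rw [hS] at hmy
  obtain ⟨Q, hQ⟩ := hmy
  obtain ⟨x, hx⟩ := h₁.exists_zero Q.2.ne_top
  refine ⟨x, h₂.sep _ _ fun f hf => ?_⟩
  have hmem : (⟨f, hf⟩ - algebraMap ℂ O₂ (f y) : O₂) ∈ my.asIdeal := by
    change evalAt O₂ y _ = 0
    simp
  rw [← hQ] at hmem
  have := hx _ hmem
  rw [RingHom.coe_coe, hr] at this
  simpa [sub_eq_zero] using this

/-- Connected groups are path connected. -/
theorem exists_path (h : IsGrp O) (hc : ZConn O) (x : H) :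
    ∃ c : ℝ → H, c 0 = 1 ∧ c 1 = x ∧ ∀ f ∈ O, Continuous (f ∘ c) := by
  have hirr := h.irr hc
  obtain ⟨Y, B, y₁, Φ, hF, hbot⟩ := exists_dense_fam h hirr
  have : Nonempty Y := ⟨y₁⟩
  obtain ⟨k, hk, hk0, hopen⟩ := exists_basic_open hF.aff h.toIsAff hF.irr hF.reg
    (fun f hf h0 => by
      have : (⟨f, hf⟩ : O) ∈ vanIdeal O Φ := h0
      rw [hbot] at this
      exact congrArg Subtype.val this)
  have hk1 : (fun z => k (x * z)) ∈ O := h.left x k hk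
  have hex : ∃ z, k (x * z) ≠ 0 ∧ k z ≠ 0 := by
    by_contra! hne
    rcases hirr _ hk1 _ hk (funext fun z => by
      by_cases hz : k (x * z) = 0
      · simp [hz]
      · simp [hne z hz]) with h0 | h0
    · refine hk0 (funext fun z => ?_)
      have := congrFun h0 (x⁻¹ * z)
      simpa using this
    · exact hk0 h0
  obtain ⟨z, hz1, hz2⟩ := hex
  obtain ⟨y, hy⟩ := hopen _ hz1
  obtain ⟨y', hy'⟩ := hopen _ hz2
  let Ψ : Y × Y → H := fun p => Φ p.1 * (Φ p.2)⁻¹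
  have hΨ : Reg (prodAlg B B) O Ψ :=
    h.mulReg (hF.reg.comp reg_fst) (h.invReg (hF.reg.comp reg_snd))
  obtain ⟨c, h0, h1, hcc⟩ := (hF.mul h hF).path (y, y')
  refine ⟨Ψ ∘ c, ?_, ?_, fun f hf => hcc _ (hΨ f hf)⟩
  · simp [Ψ, h0, hF.base]
  · simp [Ψ, h1, hy, hy']

end Fam

end AlgGrp

namespace AlgGrp

section Fin
variable {X Y : Type} [Group X] [Group Y] {O₁ : Subalgebra ℂ (X → ℂ)} {O₂ : Subalgebra ℂ (Y → ℂ)}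

/-- Pullback of functions. -/
def pbO {q : X → Y} (hq : Reg O₁ O₂ q) : O₂ →ₐ[ℂ] O₁ where
  toFun f := ⟨f.1 ∘ q, hq _ f.2⟩
  map_one' := rfl
  map_mul' _ _ := rfl
  map_zero' := rfl
  map_add' _ _ := rfl
  commutes' _ := rfl

@[simp] lemma pbO_apply {q : X → Y} (hq : Reg O₁ O₂ q) (f : O₂) (x : X) :
    (pbO hq f).1 x = f.1 (q x) := rfl

/-- The characteristic polynomial of a function with respect to a finite subgroup. -/
def charP (h : IsGrp O₁) (K : Subgroup X) [Fintype K] (f : O₁) : Polynomial O₁ :=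
  ∏ a : K, (Polynomial.X - Polynomial.C (ltransO h (a : X) f))

lemma ltransO_mulmul (h : IsGrp O₁) (a b : X) (f : O₁) :
    ltransO h b (ltransO h a f) = ltransO h (a * b) f := by
  ext x; simp [mul_assoc]

lemma charP_map (h : IsGrp O₁) (K : Subgroup X) [Fintype K] (f : O₁) (b : K) :
    (charP h K f).map (ltransO h (b : X)).toRingHom = charP h K f := by
  rw [charP, Polynomial.map_prod]
  refine Fintype.prod_equiv (Equiv.mulRight b) _ _ fun a => ?_
  simp [ltransO_mulmul]

lemma charP_monic (h : IsGrp O₁) (K : Subgroup X) [Fintype K] (f : O₁) : (charP h K f).Monic :=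
  Polynomial.monic_prod_of_monic _ _ fun _ _ => Polynomial.monic_X_sub_C _

lemma charP_eval (h : IsGrp O₁) (K : Subgroup X) [Fintype K] (f : O₁) :
    (charP h K f).eval f = 0 := by
  rw [charP, Polynomial.eval_prod]
  refine Finset.prod_eq_zero (Finset.mem_univ 1) ?_
  have : ltransO h (1 : X) f = f := by ext x; simp
  simp [this]

/-- Invariant polynomials descend along quotient maps. -/
lemma lifts_of_inv (h₁ : IsGrp O₁) (h₂ : IsGrp O₂) (hc : ZConn O₂) (q : X →* Y)
    (hq : Reg O₁ O₂ q) (hs : Function.Surjective q) {P : Polynomial O₁}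
    (hP : ∀ b : q.ker, P.map (ltransO h₁ (b : X)).toRingHom = P) :
    P ∈ Polynomial.lifts (pbO hq).toRingHom := by
  rw [Polynomial.lifts_iff_coeff_lifts]
  intro n
  obtain ⟨F, hF, e⟩ := descent h₁ h₂ hc q hq hs (P.coeff n).2 (by
    intro x x' hx
    have := congrArg (fun P => (Polynomial.coeff P n).1 x) (hP ⟨x' * x⁻¹, by
      rw [MonoidHom.mem_ker]; simp [hx]⟩)
    simpa using this.symm)
  exact ⟨⟨F, hF⟩, by ext x; simp [e]⟩

lemma exists_charP (h₁ : IsGrp O₁) (h₂ : IsGrp O₂) (hc : ZConn O₂) (q : X →* Y)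
    (hq : Reg O₁ O₂ q) (hs : Function.Surjective q) [Fintype q.ker] (f : O₁) :
    ∃ Q : Polynomial O₂, Q.Monic ∧ Q.map (pbO hq).toRingHom = charP h₁ q.ker f := by
  obtain ⟨Q, hQ, _, hm⟩ := Polynomial.lifts_and_natDegree_eq_and_monic
    (lifts_of_inv h₁ h₂ hc q hq hs (charP_map h₁ q.ker f)) (charP_monic h₁ q.ker f)
  exact ⟨Q, hm, hQ⟩

lemma exists_bound (h₁ : IsGrp O₁) (h₂ : IsGrp O₂) (hc : ZConn O₂) (q : X →* Y)
    (hq : Reg O₁ O₂ q) (hs : Function.Surjective q) [Fintype q.ker] (f : O₁) :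
    ∃ S : Finset O₂, ∀ x, ‖f.1 x‖ ≤ ∑ c ∈ S, ‖c.1 (q x)‖ + 1 := by
  classical
  obtain ⟨Q, hm, hQ⟩ := exists_charP h₁ h₂ hc q hq hs f
  refine ⟨(Finset.range Q.natDegree).image Q.coeff, fun x => ?_⟩
  let p : Polynomial ℂ := Q.map (evalAt O₂ (q x)).toRingHom
  have hpm : p.Monic := hm.map _
  have hroot : p.IsRoot (f.1 x) := by
    have h0 := congrArg (evalAt O₁ x) (charP_eval h₁ q.ker f)
    have e : (evalAt O₂ (q x)).toRingHom = (evalAt O₁ x).toRingHom.comp (pbO hq).toRingHom := by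
      ext; rfl
    rw [map_zero, ← hQ, ← AlgHom.coe_toRingHom, Polynomial.eval_map, Polynomial.hom_eval₂] at h0
    rw [Polynomial.IsRoot, Polynomial.eval_map, e]
    exact h0
  have hb := hroot.norm_lt_cauchyBound hpm.ne_zero
  rw [Polynomial.cauchyBound, hpm.leadingCoeff, nnnorm_one, div_one] at hb
  have : (Finset.range p.natDegree).sup (fun k => ‖p.coeff k‖₊) ≤
      ∑ c ∈ (Finset.range Q.natDegree).image Q.coeff, ‖c.1 (q x)‖₊ := by
    refine Finset.sup_le fun k hk => ?_
    rw [hm.natDegree_map] at hk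
    have : p.coeff k = (Q.coeff k).1 (q x) := by simp [p]
    rw [this]
    exact Finset.single_le_sum (f := fun c : O₂ => ‖c.1 (q x)‖₊) (fun _ _ => zero_le)
      (Finset.mem_image_of_mem _ hk)
  have h3 := NNReal.coe_le_coe.mpr (hb.le.trans (add_le_add_left this 1))
  push_cast at h3
  exact h3

end Fin

end AlgGrp

namespace AlgGrp

section Top
variable {X Y : Type} {O₁ : Subalgebra ℂ (X → ℂ)} {O₂ : Subalgebra ℂ (Y → ℂ)}

/-- The classical topology of an affine variety. -/
def ctop (O : Subalgebra ℂ (X → ℂ)) : TopologicalSpace X :=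
  TopologicalSpace.induced (fun x (f : O) => f.1 x) inferInstance

lemma continuous_ctop {O : Subalgebra ℂ (X → ℂ)} {f : X → ℂ} (hf : f ∈ O) :
    @Continuous _ _ (ctop O) _ f := by
  let _ := ctop O
  have h1 : Continuous (fun x (f : O) => f.1 x) := continuous_induced_dom
  exact (continuous_apply (A := fun _ : O => ℂ) (⟨f, hf⟩ : O)).comp h1

lemma continuous_to_ctop {O : Subalgebra ℂ (X → ℂ)} {Z : Type*} [TopologicalSpace Z] {g : Z → X}
    (h : ∀ f ∈ O, Continuous (f ∘ g)) : @Continuous _ _ _ (ctop O) g := by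
  let _ := ctop O
  exact continuous_induced_rng.mpr (continuous_pi fun f => h f.1 f.2)

lemma tendsto_ctop {O : Subalgebra ℂ (X → ℂ)} {x : X} {l : Filter X}
    (h : ∀ f ∈ O, Filter.Tendsto f l (nhds (f x))) : l ≤ @nhds _ (ctop O) x := by
  rw [ctop, nhds_induced, ← Filter.map_le_iff_le_comap]
  exact tendsto_pi_nhds.mpr fun f => h f.1 f.2

lemma Reg.continuous_ctop {g : X → Y} (hg : Reg O₁ O₂ g) : @Continuous _ _ (ctop O₁) (ctop O₂) g := by
  let _ := ctop O₁
  exact continuous_to_ctop fun f hf => AlgGrp.continuous_ctop (hg f hf)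

lemma t2_ctop (h : IsAff O₁) : @T2Space _ (ctop O₁) := by
  let _ := ctop O₁
  refine T2Space.of_injective_continuous (f := fun x (f : O₁) => f.1 x) ?_ continuous_induced_dom
  exact fun x y e => h.sep x y fun f hf => congrFun e ⟨f, hf⟩

lemma continuous_prodAlg {F : X × Y → ℂ} (hF : F ∈ prodAlg O₁ O₂) :
    @Continuous _ _ (@instTopologicalSpaceProd _ _ (ctop O₁) (ctop O₂)) _ F := by
  let _ := ctop O₁
  let _ := ctop O₂
  obtain ⟨S, hS⟩ := mem_prodAlg_iff.mp hF
  have : F = fun p => ∑ i ∈ S, i.1.1 p.1 * i.2.1 p.2 := funext fun p => hS p.1 p.2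
  rw [this]
  exact continuous_finsetSum _ fun i _ =>
    ((continuous_ctop i.1.2).comp continuous_fst).mul ((continuous_ctop i.2.2).comp continuous_snd)

variable [Group X] [Group Y]

lemma topGroup_ctop (h : IsGrp O₁) : @IsTopologicalGroup X (ctop O₁) _ := by
  let _ := ctop O₁
  refine { continuous_mul := ?_, continuous_inv := ?_ }
  · exact continuous_to_ctop fun f hf => continuous_prodAlg (h.mul f hf)
  · exact Reg.continuous_ctop h.inv

lemma proper_ctop (h₁ : IsGrp O₁) (h₂ : IsGrp O₂) (hc : ZConn O₂) (q : X →* Y)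
    (hq : Reg O₁ O₂ q) (hs : Function.Surjective q) [Finite q.ker] :
    @IsProperMap _ _ (ctop O₁) (ctop O₂) q := by
  let _ := ctop O₁
  let _ := ctop O₂
  have := t2_ctop h₂.toIsAff
  have := Fintype.ofFinite q.ker
  rw [isProperMap_iff_ultrafilter_of_t2]
  refine ⟨hq.continuous_ctop, fun 𝒰 y hy => ?_⟩
  have hlim : ∀ f : O₁, ∃ l : ℂ, Filter.Tendsto f.1 𝒰 (nhds l) := by
    intro f
    obtain ⟨S, hS⟩ := exists_bound h₁ h₂ hc q hq hs f
    have hB : Continuous fun y => ∑ c ∈ S, ‖c.1 y‖ + 1 :=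
      (continuous_finsetSum _ fun c _ => (continuous_ctop c.2).norm).add continuous_const
    have h1 := (hB.tendsto y).comp hy
    set B := ∑ c ∈ S, ‖c.1 y‖ + 1
    have h2 : ∀ᶠ x in (𝒰 : Filter X), f.1 x ∈ Metric.closedBall (0 : ℂ) (B + 1) := by
      filter_upwards [h1.eventually_lt_const (lt_add_one B)] with x hx
      simpa using (hS x).trans hx.le
    have h3 : (𝒰.map f.1 : Filter ℂ) ≤ Filter.principal (Metric.closedBall (0 : ℂ) (B + 1)) := by
      rw [Filter.le_principal_iff]
      exact h2
    obtain ⟨l, _, hl⟩ := (isCompact_closedBall (0 : ℂ) (B + 1)).ultrafilter_le_nhds _ h3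
    exact ⟨l, hl⟩
  choose l hl using hlim
  have huniq : ∀ (f : O₁) (c : ℂ), Filter.Tendsto f.1 𝒰 (nhds c) → l f = c :=
    fun f c hc => tendsto_nhds_unique (hl f) hc
  let φ : O₁ →ₐ[ℂ] ℂ :=
    { toFun := l
      map_one' := huniq _ _ tendsto_const_nhds
      map_mul' := fun a b => huniq _ _ ((hl a).mul (hl b))
      map_zero' := huniq _ _ tendsto_const_nhds
      map_add' := fun a b => huniq _ _ ((hl a).add (hl b))
      commutes' := fun c => huniq _ _ tendsto_const_nhds }
  obtain ⟨x, hx⟩ := h₁.point φ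
  refine ⟨x, tendsto_ctop fun f hf => ?_⟩
  have := hl ⟨f, hf⟩
  rwa [show l ⟨f, hf⟩ = f x from hx ⟨f, hf⟩] at this

/-- A finite covering of a simply connected group by a connected group is trivial. -/
theorem injective_of_simplyConnected (h₁ : IsGrp O₁) (hc₁ : ZConn O₁) (h₂ : IsGrp O₂)
    (hc : ZConn O₂) (q : X →* Y) (hq : Reg O₁ O₂ q) (hs : Function.Surjective q) [Finite q.ker]
    (hsc : ∀ γ : @FundamentalGroup Y (ctop O₂) 1, γ = 1) : Function.Injective q := by
  let _ := ctop O₁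
  let _ := ctop O₂
  have := t2_ctop h₁.toIsAff
  have := topGroup_ctop h₁
  have hp := proper_ctop h₁ h₂ hc q hq hs
  have hqm : Topology.IsQuotientMap q := hp.isClosedMap.isQuotientMap hp.continuous hs
  have hfin : (q.ker : Set X).Finite := Set.toFinite _
  have hcov := (hqm.isQuotientCoveringMap_of_isDiscrete_ker_monoidHom
    (hfin.isDiscrete)).isCoveringMap
  rw [injective_iff_map_eq_one]
  intro k hk
  obtain ⟨c, c0, c1, hcc⟩ := exists_path h₁ hc₁ k
  have hcc' : Continuous c := continuous_to_ctop hcc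
  let Γ : C(unitInterval, X) := ⟨fun t => c t, hcc'.comp continuous_subtype_val⟩
  let loop : Path (1 : Y) 1 :=
    { toFun := q ∘ Γ
      continuous_toFun := hp.continuous.comp Γ.continuous
      source' := by simp [Γ, c0]
      target' := by simp [Γ, c1, hk] }
  have hom : Path.Homotopic loop (Path.refl 1) := by
    have := hsc (FundamentalGroup.fromPath (Path.Homotopic.Quotient.mk loop))
    exact Path.Homotopic.Quotient.exact this
  have := hcov.liftPath_apply_one_eq_of_homotopicRel (γ₀ := loop.toContinuousMap)
    (γ₁ := (Path.refl (1 : Y)).toContinuousMap) hom 1 (by simp) (by simp)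
  have e1 : hcov.liftPath loop.toContinuousMap 1 (by simp) = Γ := by
    symm
    rw [hcov.eq_liftPath_iff']
    exact ⟨rfl, by simp [Γ, c0]⟩
  have e2 : hcov.liftPath (Path.refl (1 : Y)).toContinuousMap 1 (by simp) =
      ContinuousMap.const _ 1 := by
    symm
    rw [hcov.eq_liftPath_iff']
    exact ⟨by ext; simp, by simp⟩
  rw [e1, e2] at this
  simpa [Γ, c1] using this

end Top

end AlgGrp

namespace AlgGrp

section Lift
variable {A E G S : Type} [CommGroup A] [Group E] [Group G] [Group S] {k : ℕ}
variable {OA : Subalgebra ℂ (A → ℂ)} {OE : Subalgebra ℂ (E → ℂ)} {OG : Subalgebra ℂ (G → ℂ)}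
variable {OS : Subalgebra ℂ (S → ℂ)} {u : Fin k → A →* ℂˣ} {i : A →* E} {q : E →* G}

/-- A torus extension contains a closed subgroup which is a finite cover of the base. -/
theorem TorExt.exists_finCover (h : TorExt OA OE OG u i q) : ∃ K : Subgroup E,
    ZClosed OE (K : Set E) ∧ (∀ g, ∃ x ∈ K, q x = g) ∧ {x | x ∈ K ∧ q x = 1}.Finite := by
  choose δ m hm hδ hδi using h.exists_delta
  have hδ0 : ∀ j x, δ j x ≠ 0 := fun j x h0 => by
    have : δ j (x * x⁻¹) = 0 := by rw [map_mul, h0, zero_mul]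
    simp at this
  refine ⟨⨅ j, (δ j).ker, ?_, fun g => ?_, ?_⟩
  · have : ((⨅ j, (δ j).ker : Subgroup E) : Set E) = {x | ∀ j, x ∈ {x | δ j x = (1 : E → ℂ) x}} := by
      ext x; simp [MonoidHom.mem_ker]
    rw [this]
    exact ZClosed.forall fun j => ZClosed.eqLocus (hδ j) OE.one_mem
  · obtain ⟨x, rfl⟩ := h.q_surj g
    have : ∀ j, ∃ z : ℂˣ, (z : ℂ) ^ m j = δ j x := by
      intro j
      obtain ⟨z, hz⟩ := IsAlgClosed.exists_pow_nat_eq (δ j x) (hm j)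
      have hz0 : z ≠ 0 := by
        rintro rfl
        rw [zero_pow (hm j).ne'] at hz
        exact hδ0 j x hz.symm
      exact ⟨Units.mk0 z hz0, hz⟩
    choose z hz using this
    obtain ⟨a, ha⟩ := h.tor.bij.2 z
    refine ⟨(i a)⁻¹ * x, ?_, by simp [h.qi]⟩
    simp only [Subgroup.mem_iInf, MonoidHom.mem_ker]
    intro j
    have e : δ j (i a) = δ j x := by rw [hδi, ← hz, ← ha]
    rw [map_mul, ← e, ← map_mul]
    simp
  · have hsub : {x | x ∈ (⨅ j, (δ j).ker : Subgroup E) ∧ q x = 1} ⊆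
        i '' {a | ∀ j, u j a ∈ rootsOfUnity (m j) ℂ} := by
      rintro x ⟨hx, hqx⟩
      obtain ⟨a, rfl⟩ := (h.exact x).mp hqx
      refine ⟨a, fun j => ?_, rfl⟩
      simp only [Subgroup.mem_iInf, MonoidHom.mem_ker] at hx
      have := hx j
      rw [hδi] at this
      rw [mem_rootsOfUnity]
      exact Units.ext (by simpa using this)
    refine Set.Finite.subset (Set.Finite.image _ ?_) hsub
    have hfin : (Set.univ.pi fun j => ((rootsOfUnity (m j) ℂ : Subgroup ℂˣ) : Set ℂˣ)).Finite := by
      refine Set.Finite.pi fun j => ?_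
      have : NeZero (m j) := ⟨(hm j).ne'⟩
      have : Finite (rootsOfUnity (m j) ℂ) := inferInstance
      exact Set.toFinite _
    refine Set.Finite.subset (hfin.preimage h.tor.bij.1.injOn) ?_
    intro a ha j _
    exact ha j

lemma exists_hom_of_bij {P : Type} [Group P] {OP : Subalgebra ℂ (P → ℂ)} (hP : IsGrp OP)
    (hS : IsGrp OS) (cS : ZConn OS) (p : P →* S) (hp : Reg OP OS p) (hb : Function.Bijective p)
    (τ : P →* E) (hτ : Reg OP OE τ) : ∃ σ : S →* E, Reg OS OE σ ∧ ∀ x, σ (p x) = τ x := by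
  let e := MulEquiv.ofBijective p hb
  have he : ∀ x, (τ.comp e.symm.toMonoidHom) (p x) = τ x := fun x =>
    congrArg τ (e.symm_apply_apply x)
  refine ⟨τ.comp e.symm.toMonoidHom, descent_reg hP hS cS p hp hb.2 ?_, he⟩
  rw [show (τ.comp e.symm.toMonoidHom : S → E) ∘ p = τ from funext he]
  exact hτ

/-- Finite covers of simply connected groups split. -/
lemma exists_hom_of_finite_ker {W : Type} [Group W] {OW : Subalgebra ℂ (W → ℂ)} (hW : IsGrp OW)
    (hS : IsGrp OS) (cS : ZConn OS) (hsc : ∀ γ : @FundamentalGroup S (ctop OS) 1, γ = 1)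
    (p : W →* S) (hp : Reg OW OS p) (hps : Function.Surjective p) (hfin : Finite p.ker)
    (τ : W →* E) (hτ : Reg OW OE τ) :
    ∃ σ : S →* E, Reg OS OE σ ∧ ∀ s, ∃ w, p w = s ∧ σ s = τ w := by
  let P := idComp hW
  have hP : IsGrp (res OW P.subtype) := hW.resSub _ (idComp_closed hW)
  let p' : P →* S := p.comp P.subtype
  have hp' : Reg (res OW P.subtype) OS p' := hp.comp (reg_res _ _)
  have hps' : Function.Surjective p' := fun s => by
    obtain ⟨x, hx, e⟩ := map_idComp_surj hW hS cS p hp hps s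
    exact ⟨⟨x, hx⟩, e⟩
  have hfin' : Finite p'.ker := by
    refine Finite.of_injective (fun x : p'.ker => (⟨x.1.1, x.2⟩ : p.ker)) ?_
    intro x y hxy
    have h3 : x.1.1 = y.1.1 := congrArg (fun z : p.ker => z.1) hxy
    exact Subtype.ext (Subtype.ext h3)
  have hinj := injective_of_simplyConnected hP (idComp_conn hW) hS cS p' hp' hps' hsc
  obtain ⟨σ, hσ, e⟩ := exists_hom_of_bij hP hS cS p' hp' ⟨hinj, hps'⟩ (τ.comp P.subtype)
    (hτ.comp (reg_res _ _))
  refine ⟨σ, hσ, fun s => ?_⟩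
  obtain ⟨x, rfl⟩ := hps' s
  exact ⟨x.1, rfl, e x⟩

/-- Homomorphisms from simply connected groups lift to torus extensions. -/
theorem TorExt.exists_lift (h : TorExt OA OE OG u i q) (hS : IsGrp OS) (cS : ZConn OS)
    (hsc : ∀ γ : @FundamentalGroup S (ctop OS) 1, γ = 1) (π : S →* G) (hπ : Reg OS OG π) :
    ∃ σ : S →* E, Reg OS OE σ ∧ ∀ s, q (σ s) = π s := by
  obtain ⟨K, hK, hKs, hKf⟩ := h.exists_finCover
  let W : Subgroup (S × E) := (K.comap (MonoidHom.snd S E)) ⊓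
    (MonoidHom.eqLocus (π.comp (MonoidHom.fst S E)) (q.comp (MonoidHom.snd S E)))
  have hW : IsGrp (res (prodAlg OS OE) W.subtype) := by
    refine (hS.prod h.hE).resSub W ?_
    exact (hK.preimage (reg_snd (O₁ := OS) (O₂ := OE))).inter
      (ZClosed.eqLocus_reg h.hG.toIsAff (hπ.comp reg_fst) (h.qReg.comp reg_snd))
  let p : W →* S := (MonoidHom.fst S E).comp W.subtype
  have hp : Reg (res (prodAlg OS OE) W.subtype) OS p := reg_fst.comp (reg_res _ _)
  have hps : Function.Surjective p := fun s => by
    obtain ⟨x, hx, e⟩ := hKs (π s)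
    exact ⟨⟨(s, x), hx, e.symm⟩, rfl⟩
  have hfin : Finite p.ker := by
    have := hKf.to_subtype
    refine Finite.of_injective (fun x : p.ker => (⟨x.1.1.2, ?_⟩ : {x | x ∈ K ∧ q x = 1})) ?_
    · refine ⟨x.1.2.1, ?_⟩
      have h1 : x.1.1.1 = 1 := x.2
      have h2 : π x.1.1.1 = q x.1.1.2 := x.1.2.2
      rw [← h2, h1, map_one]
    · intro x y hxy
      have h1 : x.1.1.1 = 1 := x.2
      have h2 : y.1.1.1 = 1 := y.2
      have h3 : x.1.1.2 = y.1.1.2 := congrArg Subtype.val hxy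
      exact Subtype.ext (Subtype.ext (Prod.ext (h1.trans h2.symm) h3))
  obtain ⟨σ, hσ, e⟩ := exists_hom_of_finite_ker hW hS cS hsc p hp hps hfin
    ((MonoidHom.snd S E).comp W.subtype) (OE := OE) (reg_snd.comp (reg_res _ _))
  refine ⟨σ, hσ, fun s => ?_⟩
  obtain ⟨w, rfl, e⟩ := e s
  rw [e]
  have h2 : π w.1.1 = q w.1.2 := w.2.2
  exact h2.symm

end Lift

end AlgGrp

namespace AlgGrp

section Cover
variable {A E G S T Z : Type} [CommGroup A] [Group E] [Group G] [Group S] [Group T] [Group Z] {k : ℕ}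
variable {OA : Subalgebra ℂ (A → ℂ)} {OE : Subalgebra ℂ (E → ℂ)} {OG : Subalgebra ℂ (G → ℂ)}
variable {OS : Subalgebra ℂ (S → ℂ)} {OT : Subalgebra ℂ (T → ℂ)} {OZ : Subalgebra ℂ (Z → ℂ)}
variable {u : Fin k → A →* ℂˣ} {i : A →* E} {q : E →* G}
variable {Gu : Subgroup G} {m : ℕ} {φ : Gu →* Matrix (Fin m) (Fin m) ℂ}

/-- Homomorphisms trivial on the kernel descend along surjections. -/
lemma exists_hom_of_ker {P : Type} [Group P] {OP : Subalgebra ℂ (P → ℂ)} (hP : IsGrp OP)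
    (hS : IsGrp OS) (cS : ZConn OS) (p : P →* S) (hp : Reg OP OS p) (hs : Function.Surjective p)
    (τ : P →* E) (hτ : Reg OP OE τ) (hk : ∀ x, p x = 1 → τ x = 1) :
    ∃ σ : S →* E, Reg OS OE σ ∧ ∀ x, σ (p x) = τ x := by
  let σ : S →* E := p.liftOfSurjective hs ⟨τ, fun x hx => hk x hx⟩
  have he : ∀ x, σ (p x) = τ x := fun x => p.liftOfRightInverse_comp_apply _ _ _ x
  refine ⟨σ, descent_reg hP hS cS p hp hs ?_, he⟩
  rw [show (σ : S → E) ∘ p = τ from funext he]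
  exact hτ

open scoped commutatorElement in
lemma TorExt.exists_theta (h : TorExt OA OE OG u i q) (hU : UnipSub OG Gu φ)
    (W : Type) [Group W] {OW : Subalgebra ℂ (W → ℂ)} (hW : IsGrp OW) (p : W →* E)
    (hp : Reg OW OE p) (σ : W →* E) (hσ : Reg OW OE σ)
    (hR : ∀ w, ∀ g : G, ⁅g, q (p w * (σ w)⁻¹)⁆ ∈ Gu) :
    ∃ Θ : W →* E, Reg OW OE Θ ∧ (∀ w, q (Θ w) = q (p w)) ∧
      (∀ w, q (p w) = 1 → σ w = 1 → Θ w = 1) := by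
  have := hU.normal
  let R : Subgroup E := (Subgroup.center (G ⧸ Gu)).comap ((QuotientGroup.mk' Gu).comp q)
  have hmem : ∀ r, r ∈ R ↔ ∀ g : G, ⁅g, q r⁆ ∈ Gu := by
    intro r
    simp only [R, Subgroup.mem_comap, Subgroup.mem_center_iff]
    constructor
    · intro hr g
      have := hr (QuotientGroup.mk' Gu g)
      rw [← QuotientGroup.eq_one_iff]
      change QuotientGroup.mk' Gu ⁅g, q r⁆ = 1
      rw [map_commutatorElement, commutatorElement_eq_one_iff_mul_comm]
      exact this
    · intro hr g
      obtain ⟨g, rfl⟩ := QuotientGroup.mk'_surjective Gu g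
      have h1 : QuotientGroup.mk' Gu ⁅g, q r⁆ = 1 := (QuotientGroup.eq_one_iff _).mpr (hr g)
      rw [map_commutatorElement, commutatorElement_eq_one_iff_mul_comm] at h1
      exact h1
  obtain ⟨ψ, hψ, hψi, hψc⟩ := h.exists_psi hU R (fun r hr g => by
    rw [map_commutatorElement]; exact (hmem r).mp hr _)
  let ρ : W → R := fun w => ⟨p w * (σ w)⁻¹, (hmem _).mpr (hR w)⟩
  have hρ : Reg OW (res OE R.subtype) ρ := reg_to_res (h.hE.mulReg hp (h.hE.invReg hσ))
  have hρm : ∀ w w', ψ (ρ (w * w')) = ψ (ρ w) * ψ (ρ w') := by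
    intro w w'
    let r' : R := ρ (w * w') * (ρ w)⁻¹
    have h1 : ψ r' = ψ (ρ w') := hψc (p w) _ _ (by simp [r', ρ, mul_assoc])
    have h2 : ρ (w * w') = r' * ρ w := by simp [r']
    rw [h2, map_mul, h1, mul_comm]
  have hc : ∀ a x, i a * x = x * i a := h.central
  let Θ : W →* E := MonoidHom.mk' (fun w => i (ψ (ρ w))⁻¹ * p w) (by
    intro w w'
    rw [hρm, map_mul, mul_inv, map_mul]
    have := hc (ψ (ρ w'))⁻¹ (p w)
    simp only [mul_assoc]
    rw [← mul_assoc (i (ψ (ρ w'))⁻¹), this]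
    simp only [mul_assoc])
  refine ⟨Θ, ?_, fun w => ?_, fun w h1 h2 => ?_⟩
  · have h3 : Reg OW OE (fun w => i (ψ (ρ w))) := h.iReg.comp (hψ.comp hρ)
    have h4 := h.hE.mulReg (h.hE.invReg h3) hp
    have : (Θ : W → E) = fun w => (i (ψ (ρ w)))⁻¹ * p w := by funext w; simp [Θ]
    rw [this]
    exact h4
  · simp [Θ, h.qi]
  · obtain ⟨a, ha⟩ := (h.exact _).mp h1
    have haR : i a ∈ R := by rw [hmem]; intro g; simp [h.qi]
    have : ρ w = ⟨i a, haR⟩ := Subtype.ext (by simp [ρ, h2, ha])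
    change i (ψ (ρ w))⁻¹ * p w = 1
    rw [this, hψi, ← ha, ← map_mul]
    simp

open scoped commutatorElement in
/-- The covering group maps to every torus extension. -/
theorem TorExt.exists_cover_hom (h : TorExt OA OE OG u i q) (hU : UnipSub OG Gu φ)
    (hT : IsGrp OT) (cT : ZConn OT) (π : T →* G) (hπ : Reg OT OG π)
    (N : Subgroup T) (hN : N.Normal) (hNc : ZClosed OT (N : Set T)) (hNU : ∀ x ∈ N, π x ∈ Gu)
    (hZ : IsGrp OZ) (ζ : Z →* T) (hζ : Reg OZ OT ζ) (hζc : ∀ z (g : G), ⁅g, π (ζ z)⁆ ∈ Gu)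
    (hS : IsGrp OS) (ς : S →* T) (hς : Reg OS OT ς) (hcomm : ∀ z s, ζ z * ς s = ς s * ζ z)
    (hdec : ∀ x, ∃ z s, x * (ζ z * ς s)⁻¹ ∈ N) (htriv : ∀ z s, ζ z * ς s ∈ N → z = 1 ∧ s = 1)
    (σ : S →* E) (hσ : Reg OS OE σ) (hσq : ∀ s, q (σ s) = π (ς s)) :
    ∃ f : T →* E, Reg OT OE f ∧ ∀ x, q (f x) = π x := by
  have := hU.normal
  let μ : Z × S →* T := MonoidHom.mk' (fun w => ζ w.1 * ς w.2) (by
    rintro ⟨z, s⟩ ⟨z', s'⟩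
    simp only [Prod.mk_mul_mk, map_mul, mul_assoc]
    rw [← mul_assoc (ζ z') (ς s), hcomm z' s]
    simp only [mul_assoc])
  have hμ : Reg (prodAlg OZ OS) OT μ := hT.mulReg (hζ.comp reg_fst) (hς.comp reg_snd)
  let V := T × E × (Z × S)
  let OV : Subalgebra ℂ (V → ℂ) := prodAlg OT (prodAlg OE (prodAlg OZ OS))
  have hV : IsGrp OV := hT.prod (h.hE.prod (hZ.prod hS))
  let v1 : V →* T := MonoidHom.fst _ _
  let v2 : V →* E := (MonoidHom.fst _ _).comp (MonoidHom.snd _ _)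
  let v3 : V →* Z × S := (MonoidHom.snd _ _).comp (MonoidHom.snd _ _)
  have hv1 : Reg OV OT v1 := reg_fst
  have hv2 : Reg OV OE v2 := reg_fst.comp reg_snd
  have hv3 : Reg OV (prodAlg OZ OS) v3 := reg_snd.comp reg_snd
  have hv4 : Reg OV OS ((MonoidHom.snd Z S).comp v3) := reg_snd.comp hv3
  let W : Subgroup V := MonoidHom.eqLocus (π.comp v1) (q.comp v2) ⊓
    MonoidHom.eqLocus ((QuotientGroup.mk' N).comp v1) ((QuotientGroup.mk' N).comp (μ.comp v3))
  have hWmem : ∀ w : V, w ∈ W ↔ π (v1 w) = q (v2 w) ∧ v1 w * (μ (v3 w))⁻¹ ∈ N := by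
    intro w
    refine and_congr Iff.rfl ?_
    change QuotientGroup.mk' N (v1 w) = QuotientGroup.mk' N (μ (v3 w)) ↔ _
    rw [← mul_inv_eq_one, ← map_inv, ← map_mul, ← QuotientGroup.eq_one_iff (N := N)]
    rfl
  have hWc : ZClosed OV (W : Set V) := by
    have e : (W : Set V) = {w | (π ∘ v1) w = (q ∘ v2) w} ∩
        (fun w => v1 w * (μ (v3 w))⁻¹) ⁻¹' (N : Set T) := by
      ext w; exact hWmem w
    rw [e]
    exact (ZClosed.eqLocus_reg h.hG.toIsAff (hπ.comp hv1) (h.qReg.comp hv2)).inter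
      (hNc.preimage (hT.mulReg hv1 (hT.invReg (hμ.comp hv3))))
  have hWg := hV.resSub W hWc
  have hWr : Reg (res OV W.subtype) OV W.subtype := reg_res _ _
  obtain ⟨Θ, hΘ, hΘq, hΘ1⟩ := h.exists_theta hU W hWg (v2.comp W.subtype) (hv2.comp hWr)
    (σ.comp (((MonoidHom.snd Z S).comp v3).comp W.subtype)) (hσ.comp (hv4.comp hWr)) (by
      intro w g
      obtain ⟨h1, h2⟩ := (hWmem w.1).mp w.2
      set z := (v3 w.1).1 with hz
      set s := (v3 w.1).2 with hs
      set n := v1 w.1 * (μ (v3 w.1))⁻¹ with hn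
      have h3 : v1 w.1 = n * (ζ z * ς s) := by
        have : μ (v3 w.1) = ζ z * ς s := rfl
        rw [hn, this]; group
      have h4 : q (v2 w.1 * (σ s)⁻¹) = π n * π (ζ z) := by
        rw [map_mul, map_inv, hσq, ← h1, h3, map_mul, map_mul π (ζ z), ← mul_assoc,
          mul_inv_cancel_right]
      change ⁅g, q (v2 w.1 * (σ s)⁻¹)⁆ ∈ Gu
      rw [h4]
      have h5 := hNU n h2
      have e : ⁅g, π n * π (ζ z)⁆ = g * π n * g⁻¹ * (⁅g, π (ζ z)⁆ * (π n)⁻¹) := by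
        simp only [commutatorElement_def]; group
      rw [e]
      exact Gu.mul_mem (this.conj_mem _ h5 g) (Gu.mul_mem (hζc z g) (Gu.inv_mem h5)))
  obtain ⟨f, hf, e⟩ := exists_hom_of_ker hWg hT cT (v1.comp W.subtype) (hv1.comp hWr) (by
      intro x
      obtain ⟨z, s, hzs⟩ := hdec x
      obtain ⟨p, hp⟩ := h.q_surj (π x)
      exact ⟨⟨(x, p, (z, s)), (hWmem _).mpr ⟨hp.symm, hzs⟩⟩, rfl⟩) Θ hΘ (by
      intro w hw
      obtain ⟨h1, h2⟩ := (hWmem w.1).mp w.2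
      have hw : v1 w.1 = 1 := hw
      rw [hw, map_one] at h1
      rw [hw, one_mul] at h2
      have h3 := htriv (v3 w.1).1 (v3 w.1).2 (N.inv_mem_iff.mp h2)
      refine hΘ1 w h1.symm ?_
      change σ (v3 w.1).2 = 1
      rw [h3.2, map_one])
  refine ⟨f, hf, fun x => ?_⟩
  obtain ⟨z, s, hzs⟩ := hdec x
  obtain ⟨p, hp⟩ := h.q_surj (π x)
  have := e ⟨(x, p, (z, s)), (hWmem _).mpr ⟨hp.symm, hzs⟩⟩
  change f x = _ at this
  rw [this, hΘq]
  exact hp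

/-- If the pushout cocycle extends to the cover, the extension splits. -/
theorem TorExt.exists_section (h : TorExt OA OE OG u i q) (hT : IsGrp OT) (π : T →* G)
    (hπ : Reg OT OG π) (hs : Function.Surjective π) (f : T →* E) (hf : Reg OT OE f)
    (hq : ∀ x, q (f x) = π x) (d : T →* A) (hd : Reg OT OA d) (hfd : ∀ x, π x = 1 → f x = i (d x)) :
    ∃ σ : G →* E, Reg OG OE σ ∧ ∀ g, q (σ g) = g := by
  let τ : T →* E := MonoidHom.mk' (fun x => i (d x)⁻¹ * f x) (by
    intro w w'
    rw [map_mul, map_mul, mul_inv, map_mul]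
    have := h.central (d w')⁻¹ (f w)
    simp only [mul_assoc]
    rw [← mul_assoc (i (d w')⁻¹), this]
    simp only [mul_assoc])
  have hτ : Reg OT OE τ := by
    have : (τ : T → E) = fun w => (i (d w))⁻¹ * f w := by funext w; simp [τ]
    rw [this]
    exact h.hE.mulReg (h.hE.invReg (h.iReg.comp hd)) hf
  obtain ⟨σ, hσ, e⟩ := exists_hom_of_ker hT h.hG h.cG π hπ hs τ hτ (fun x hx => by
    change i (d x)⁻¹ * f x = 1
    rw [hfd x hx]; simp)
  refine ⟨σ, hσ, fun g => ?_⟩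
  obtain ⟨x, rfl⟩ := hs g
  rw [e]
  simp [τ, h.qi, hq]

/-- If the extension splits, the pushout cocycle extends to the cover. -/
theorem TorExt.exists_extension (h : TorExt OA OE OG u i q) (π : T →* G)
    (hπ : Reg OT OG π) (f : T →* E) (hf : Reg OT OE f)
    (hq : ∀ x, q (f x) = π x) (σ : G →* E) (hσ : Reg OG OE σ) (hσq : ∀ g, q (σ g) = g) :
    ∃ d : T →* A, Reg OT OA d ∧ ∀ x, π x = 1 → f x = i (d x) := by
  have : ∀ x, ∃ a, i a = f x * (σ (π x))⁻¹ := fun x => (h.exact _).mp (by simp [hq, hσq])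
  choose d hd using this
  have hdf : ∀ x, f x = i (d x) * σ (π x) := fun x => by rw [hd]; group
  have hmul : ∀ x y, d (x * y) = d x * d y := fun x y => h.i_inj (by
    rw [hd, map_mul, hdf x, hdf y, map_mul, map_mul, map_mul]
    have := h.central (d y) (σ (π x))
    simp only [mul_assoc, mul_inv_rev]
    rw [← mul_assoc (σ (π x)), ← this]
    simp only [mul_assoc]
    simp)
  refine ⟨MonoidHom.mk' d hmul, h.reg_of_comp_i ?_, fun x hx => ?_⟩
  · rw [show (i : A → E) ∘ (MonoidHom.mk' d hmul : T →* A) = fun x => f x * (σ (π x))⁻¹ from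
      funext hd]
    exact h.hE.mulReg hf (h.hE.invReg (hσ.comp hπ))
  · have := hdf x
    rw [hx, map_one, mul_one] at this
    exact this

end Cover

end AlgGrp

namespace AlgGrp

variable {G H : AffAlgGroup}

lemma torus_comm (h : G.IsTorus) (x y : G.Gp) : x * y = y * x := by
  obtain ⟨k, φ, h1, h2, h3, h4, h5, h6, h7⟩ := h
  obtain ⟨a, ha⟩ := h3 x.1 x.2
  obtain ⟨b, hb⟩ := h3 y.1 y.2
  refine Subtype.ext ?_
  rw [gp_mul_val, gp_mul_val, ← ha, ← hb, ← h5, ← h5, mul_comm]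

/-- The commutative group structure on the points of a torus. -/
abbrev torusCommGroup (h : G.IsTorus) : CommGroup G.Gp :=
  { (inferInstance : Group G.Gp) with mul_comm := torus_comm h }

lemma exists_isTor (h : G.IsTorus) :
    ∃ (k : ℕ) (u : Fin k → G.Gp →* ℂˣ),
      @IsTor G.Gp (torusCommGroup h) k (OG G) u := by
  have h' := h
  obtain ⟨k, φ, h1, h2, h3, h4, h5, h6, h7⟩ := h'
  have hex : ∀ x : G.Gp, ∃ u, φ u = x.1 := fun x => h3 x.1 x.2
  choose ψ hψ using hex
  have hφψ : ∀ u, ψ ⟨φ u, h1 u⟩ = u := fun u => h2 (hψ _)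
  let u : Fin k → G.Gp →* ℂˣ := fun j =>
    { toFun := fun x => ψ x j
      map_one' := by
        have : ψ 1 = fun _ => 1 := h2 ((hψ 1).trans h4.symm)
        rw [this]
      map_mul' := fun x y => by
        have : ψ (x * y) = ψ x * ψ y := h2 (by rw [hψ, h5, hψ, hψ]; rfl)
        rw [this]; rfl }
  have hmem : ∀ j, (fun x => (u j x : ℂ)) ∈ OG G := by
    intro j
    obtain ⟨Q, hQ⟩ := h7 j
    refine mem_OG.mpr ⟨Q, fun x => ?_⟩
    have := hQ (ψ x)
    rwa [hψ] at this
  refine ⟨k, u, @IsTor.mk _ (torusCommGroup h) _ _ _ (isGrp_OG G) ⟨?_, ?_⟩ ?_⟩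
  · intro x y hxy
    have : ψ x = ψ y := hxy
    exact Subtype.ext (by rw [← hψ x, ← hψ y, this])
  · intro v
    exact ⟨⟨φ v, h1 v⟩, hφψ v⟩
  · apply le_antisymm
    · have hgen : ∀ i : Fin G.n, (fun x : G.Gp => x.1 i) ∈ Algebra.adjoin ℂ
          (Set.range (fun j a => (u j a : ℂ)) ∪ Set.range (fun j a => (((u j a)⁻¹ : ℂˣ) : ℂ))) := by
        intro i
        obtain ⟨P, hP⟩ := h6 i
        have e : (fun x : G.Gp => x.1 i) = fun x => eval (Sum.elim (fun j => (u j x : ℂ))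
            (fun j => (((u j x)⁻¹ : ℂˣ) : ℂ))) P := by
          funext x
          have := hP (ψ x)
          rw [hψ] at this
          exact this
        rw [e]
        clear hP e
        induction P using MvPolynomial.induction_on with
        | C a =>
          simp only [eval_C]
          exact Subalgebra.algebraMap_mem _ a
        | add p q hp hq =>
          have := add_mem hp hq
          simpa [Pi.add_def] using this
        | mul_X p j hp =>
          have hj : (fun x => Sum.elim (fun j => (u j x : ℂ))
            (fun j => (((u j x)⁻¹ : ℂˣ) : ℂ)) j) ∈ Algebra.adjoin ℂ
            (Set.range (fun j a => (u j a : ℂ)) ∪ Set.range (fun j a => (((u j a)⁻¹ : ℂˣ) : ℂ))) := by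
            cases j with
            | inl j => exact Algebra.subset_adjoin (Or.inl ⟨j, rfl⟩)
            | inr j => exact Algebra.subset_adjoin (Or.inr ⟨j, rfl⟩)
          have := mul_mem hp hj
          simpa [Pi.mul_def] using this
      intro f hf
      obtain ⟨p, hp⟩ := mem_OG.mp hf
      rw [show f = fun x => eval x.1 p from funext hp]
      exact eval_mem hgen p
    · refine Algebra.adjoin_le ?_
      rintro _ (⟨j, rfl⟩ | ⟨j, rfl⟩)
      · exact hmem j
      · have := (isGrp_OG G).inv _ (hmem j)
        change (fun a => (((u j a)⁻¹ : ℂˣ) : ℂ)) ∈ OG G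
        convert this using 1
        funext x
        simp

lemma exists_torExt {As : AffAlgGroup} (hG : G.IsConnected) (hAs : As.IsTorus)
    {ρ : AlgAction G As} (hρ : ρ.IsTrivial) (e : AlgExtension G As ρ) :
    ∃ (k : ℕ) (u : Fin k → As.Gp →* ℂˣ),
      @TorExt As.Gp e.E.Gp G.Gp (torusCommGroup hAs) _ _ k (OG As) (OG e.E) (OG G) u
        e.i.toGpHom e.q.toGpHom := by
  obtain ⟨k, u, hu⟩ := exists_isTor hAs
  refine ⟨k, u, @TorExt.mk _ _ _ (torusCommGroup hAs) _ _ _ _ _ _ _ _ _ hu (isGrp_OG _) (isGrp_OG _) (zconn_OG hG)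
    (reg_toGpHom _) (reg_toGpHom _) ?_ ?_ ?_ ?_⟩
  · intro x y hxy
    exact Subtype.ext (e.i_inj x.2 y.2 (congrArg Subtype.val hxy))
  · intro g
    obtain ⟨x, hx, hxg⟩ := e.q_surj g.1 g.2
    exact ⟨⟨x, hx⟩, Subtype.ext hxg⟩
  · intro x
    constructor
    · intro hx
      obtain ⟨a, ha, hax⟩ := (e.exact x.1 x.2).mp (congrArg Subtype.val hx)
      exact ⟨⟨a, ha⟩, Subtype.ext hax⟩
    · rintro ⟨a, rfl⟩
      exact Subtype.ext ((e.exact _ (e.i.maps_to a.2)).mpr ⟨a.1, a.2, rfl⟩)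
  · intro a x
    have h1 : x * (e.i.toGpHom a * x⁻¹) = e.i.toGpHom a := by
      refine Subtype.ext ((e.conj_compat x.1 x.2 a.1 a.2).trans ?_)
      rw [hρ _ (e.q.maps_to x.2) _ a.2]
      rfl
    conv_lhs => rw [← h1]
    group

lemma exists_unipSub (N : AlgSubgroup G) (hn : N.IsNormal) (hc : N.toGrp.IsConnected)
    (hu : N.toGrp.IsUnipotent) :
    ∃ (m : ℕ) (φ : N.toSubgroup →* Matrix (Fin m) (Fin m) ℂ), UnipSub (OG G) N.toSubgroup φ := by
  obtain ⟨m, φ, ⟨P, hP⟩, h2, h3, h4⟩ := hu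
  have hmul : ∀ x ∈ N.carrier, ∀ y ∈ N.carrier, ∀ i j, matEntry (φ (G.mul x y)) i j =
      ∑ k, matEntry (φ x) i k * matEntry (φ y) k j := by
    intro x hx y hy i j
    have := h4 x hx y hy
    have h5 : φ (G.mul x y) = matMulPt m (φ x) (φ y) := this
    rw [h5]
    simp [matMulPt, matEntry]
  let M : Pt G.n → Matrix (Fin m) (Fin m) ℂ := fun x => Matrix.of (matEntry (φ x))
  have hM : ∀ x ∈ N.carrier, ∀ y ∈ N.carrier, M (G.mul x y) = M x * M y := by
    intro x hx y hy
    ext i j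
    rw [Matrix.mul_apply]
    exact hmul x hx y hy i j
  have hone : M G.one = 1 := by
    have e1 : M G.one * M G.one = M G.one := by
      rw [← hM _ N.one_mem _ N.one_mem, G.one_mul' G.one_mem]
    have hdet : (M G.one).det = 1 := by
      rw [Matrix.det_of_isUpperTriangular]
      · exact Finset.prod_eq_one fun i _ => (h3 _ N.one_mem).1 i
      · intro i j hij
        exact (h3 _ N.one_mem).2 i j hij
    have hunit : IsUnit (M G.one) := (Matrix.isUnit_iff_isUnit_det _).mpr (by rw [hdet]; exact isUnit_one)
    exact hunit.mul_left_cancel (by rw [e1, mul_one])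
  let Φ : N.toSubgroup →* Matrix (Fin m) (Fin m) ℂ :=
    { toFun := fun x => M x.1.1
      map_one' := hone
      map_mul' := fun x y => hM _ x.2 _ y.2 }
  refine ⟨m, Φ, zclosed_toSubgroup N, zconn_toSubgroup N hc, ⟨fun x hx g => ?_⟩,
    fun i j => ?_, fun x y hxy => ?_, fun x i => (h3 _ x.2).1 i, fun x i j => (h3 _ x.2).2 i j⟩
  · have := hn g.1 g.2 x.1 hx
    rw [mul_assoc]
    exact this
  · refine mem_res.mpr ⟨fun x => eval x.1 (P (finProdFinEquiv (i, j))), mem_OG.mpr ⟨_, fun _ => rfl⟩, ?_⟩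
    funext x
    exact (hP x.1.1 x.2 _).symm
  · refine Subtype.ext (Subtype.ext (h2 x.2 y.2 (funext fun l => ?_)))
    have := congrFun (congrFun hxy (finProdFinEquiv.symm l).1) (finProdFinEquiv.symm l).2
    change φ x.1.1 (finProdFinEquiv ((finProdFinEquiv.symm l).1, (finProdFinEquiv.symm l).2)) =
      φ y.1.1 (finProdFinEquiv ((finProdFinEquiv.symm l).1, (finProdFinEquiv.symm l).2)) at this
    rwa [Prod.mk.eta, Equiv.apply_symm_apply] at this

lemma ctop_OG (G : AffAlgGroup) : ctop (OG G) = (inferInstance : TopologicalSpace G.Gp) := by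
  apply le_antisymm
  · refine continuous_id_iff_le.mp ?_
    let _ := ctop (OG G)
    exact continuous_induced_rng.mpr (continuous_pi fun i => continuous_ctop (coord_mem_OG i))
  · refine continuous_id_iff_le.mp (continuous_to_ctop fun f hf => ?_)
    obtain ⟨p, hp⟩ := mem_OG.mp hf
    rw [show f = fun x => eval x.1 p from funext hp]
    exact (MvPolynomial.continuous_eval p).comp continuous_subtype_val

lemma reg_incl (K : AlgSubgroup G) : Reg (OG K.toGrp) (OG G) K.incl :=
  reg_OG fun i => coord_mem_OG (G := K.toGrp) i

end AlgGrp

namespace AlgGrp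

variable {G H : AffAlgGroup}

lemma zconn_of_bijOn (f : AlgGroupHom G H) (K : AlgSubgroup G) (M : AlgSubgroup H)
    (hM : M.toGrp.IsConnected) (hinj : Set.InjOn f.toFun K.carrier)
    (himg : f.toFun '' K.carrier = M.carrier) : ZConn (OG K.toGrp) := by
  have hmem : ∀ x ∈ K.carrier, f.toFun x ∈ M.carrier := fun x hx => himg ▸ ⟨x, hx, rfl⟩
  let g : K.toGrp.Gp →* M.toGrp.Gp := MonoidHom.mk' (fun x => ⟨f.toFun x.1, hmem x.1 x.2⟩)
    fun x y => Subtype.ext (f.map_mul (K.subset x.2) (K.subset y.2))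
  refine ZConn.of_bij (isGrp_OG _) (isGrp_OG M.toGrp) (zconn_OG hM) g ?_ ⟨?_, ?_⟩
  · obtain ⟨P, hP⟩ := f.regular
    exact reg_OG fun i => mem_OG.mpr ⟨P i, fun x => hP x.1 (K.subset x.2) i⟩
  · intro x y hxy
    exact Subtype.ext (hinj x.2 y.2 (congrArg Subtype.val hxy))
  · intro y
    have hy : y.1 ∈ f.toFun '' K.carrier := himg ▸ y.2
    obtain ⟨x, hx, hxy⟩ := hy
    exact ⟨⟨x, hx⟩, Subtype.ext hxy⟩

variable {LD : LeviDecomposition G} (CD : CoveringData G LD)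

lemma covering_decomp (x : CD.Gt.Gp) : ∃ (u : CD.Gu'.toGrp.Gp) (z : CD.Zc.toGrp.Gp)
    (s : CD.Gs.toGrp.Gp), x = CD.Gu'.incl u * (CD.Zc.incl z * CD.Gs.incl s) := by
  obtain ⟨u, hu, z, hz, s, hs, h⟩ := CD.decomp x.1 x.2
  exact ⟨⟨u, hu⟩, ⟨z, hz⟩, ⟨s, hs⟩, Subtype.ext h⟩

lemma zconn_covering : ZConn (OG CD.Gt) := by
  have hu := zconn_of_bijOn CD.qG CD.Gu' LD.Gu LD.Gu_radical.2.1 CD.qG_Gu'_inj CD.qG_Gu'_img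
  have hz := zconn_of_bijOn CD.qG CD.Zc CD.Z CD.Z_connected CD.qG_Zc_inj CD.qG_Zc_img
  have hs := zconn_OG CD.Gs_connected
  have hall : ∀ x, x ∈ idComp (isGrp_OG CD.Gt) := by
    intro x
    obtain ⟨u, z, s, rfl⟩ := covering_decomp CD x
    exact mul_mem (hu.map_idComp _ _ (reg_incl _) u)
      (mul_mem (hz.map_idComp _ _ (reg_incl _) z) (hs.map_idComp _ _ (reg_incl _) s))
  intro e he h01 x y
  rw [(mem_idComp _).mp (hall x) e he h01, (mem_idComp _).mp (hall y) e he h01]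

open scoped commutatorElement in
lemma commutator_mem_radical (z : CD.Zc.toGrp.Gp) (g : G.Gp) :
    ⁅g, CD.qG.toGpHom (CD.Zc.incl z)⁆ ∈ LD.Gu.toSubgroup := by
  have hn := LD.Gu_radical.1
  have hz : CD.qG.toFun z.1 ∈ CD.Z.carrier := CD.qG_Zc_img ▸ ⟨z.1, z.2, rfl⟩
  obtain ⟨u, hu, l, hl, h⟩ := LD.decomp g.1 g.2
  let u' : G.Gp := ⟨u, LD.Gu.subset hu⟩
  let l' : G.Gp := ⟨l, LD.L.subset hl⟩
  let z' : G.Gp := CD.qG.toGpHom (CD.Zc.incl z)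
  have hg : g = u' * l' := Subtype.ext h
  have hzl : z' * l' = l' * z' := Subtype.ext (CD.Z_central _ hz _ hl)
  have hu' : u' ∈ LD.Gu.toSubgroup := hu
  have h1 : z' * (u'⁻¹ * z'⁻¹) ∈ LD.Gu.toSubgroup := hn _ z'.2 _ (inv_mem hu')
  change ⁅g, z'⁆ ∈ _
  have h2 : ⁅g, z'⁆ = u' * (z' * (u'⁻¹ * z'⁻¹)) := by
    rw [commutatorElement_def, hg, mul_inv_rev, mul_assoc u' l' z', ← hzl]
    group
  rw [h2]
  exact mul_mem hu' h1

theorem exists_covering_lift {As : AffAlgGroup} (hG : G.IsConnected) (hAs : As.IsTorus)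
    {ρ : AlgAction G As} (hρ : ρ.IsTrivial) (e : AlgExtension G As ρ) :
    ∃ f : CD.Gt.Gp →* e.E.Gp, Reg (OG CD.Gt) (OG e.E) f ∧
      ∀ x, e.q.toGpHom (f x) = CD.qG.toGpHom x := by
  obtain ⟨k, u, h⟩ := exists_torExt hG hAs hρ e
  obtain ⟨m, φ, hU⟩ := exists_unipSub LD.Gu LD.Gu_radical.1 LD.Gu_radical.2.1 LD.Gu_radical.2.2.1
  have hsc : ∀ γ : @FundamentalGroup CD.Gs.toGrp.Gp (ctop (OG CD.Gs.toGrp)) 1, γ = 1 := by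
    rw [ctop_OG]
    exact CD.Gs_simplyConnected
  have hr := reg_toGpHom CD.qG
  let _ := torusCommGroup hAs
  obtain ⟨σ, hσ, hσq⟩ := TorExt.exists_lift h (isGrp_OG CD.Gs.toGrp) (zconn_OG CD.Gs_connected) hsc
    (CD.qG.toGpHom.comp CD.Gs.incl) (hr.comp (reg_incl _))
  refine TorExt.exists_cover_hom h hU (isGrp_OG CD.Gt) (zconn_covering CD) CD.qG.toGpHom hr
    CD.Gu'.toSubgroup ⟨fun x hx g => ?_⟩ (zclosed_toSubgroup _) (fun x hx => ?_)
    (isGrp_OG CD.Zc.toGrp) CD.Zc.incl (reg_incl _) (commutator_mem_radical CD)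
    (isGrp_OG CD.Gs.toGrp) CD.Gs.incl (reg_incl _)
    (fun z s => Subtype.ext (CD.Zc_Gs_comm _ z.2 _ s.2)) (fun x => ?_) (fun z s hzs => ?_) σ hσ hσq
  · rw [mul_assoc]
    exact CD.Gu'_normal g.1 g.2 x.1 hx
  · change CD.qG.toFun x.1 ∈ LD.Gu.carrier
    rw [← CD.qG_Gu'_img]
    exact ⟨x.1, hx, rfl⟩
  · obtain ⟨u, z, s, rfl⟩ := covering_decomp CD x
    refine ⟨z, s, ?_⟩
    rw [mul_inv_cancel_right]
    exact u.2
  · have h1 : (CD.Zc.incl z * CD.Gs.incl s).1 ∈ ({CD.Gt.one} : Set _) := by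
      rw [← CD.levi_inter]
      exact ⟨hzs, z.1, z.2, s.1, s.2, rfl⟩
    have h2 : CD.Zc.incl z * CD.Gs.incl s = 1 := Subtype.ext h1
    have h3 : CD.Zc.incl z = CD.Gs.incl s⁻¹ := by
      rw [map_inv]
      exact eq_inv_of_mul_eq_one_left h2
    have h4 : z.1 ∈ ({CD.Gt.one} : Set _) := by
      rw [← CD.Zc_Gs_inter]
      refine ⟨z.2, ?_⟩
      have h5 : z.1 = (s⁻¹ : CD.Gs.toGrp.Gp).1 := congrArg Subtype.val h3
      rw [h5]
      exact (s⁻¹ : CD.Gs.toGrp.Gp).2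
    have h6 : z = 1 := Subtype.ext h4
    refine ⟨h6, ?_⟩
    rw [h6, map_one, one_mul] at h2
    have h7 : s.1 = CD.Gt.one := congrArg Subtype.val h2
    exact Subtype.ext h7

theorem exists_pushout {As : AffAlgGroup} (hG : G.IsConnected) (hAs : As.IsTorus)
    {ρ : AlgAction G As} (hρ : ρ.IsTrivial) (e : AlgExtension G As ρ) :
    ∃ γ : CD.PiG →* As.Gp, CD.IsPushoutOf γ e := by
  obtain ⟨f, hf, hq⟩ := exists_covering_lift CD hG hAs hρ e
  obtain ⟨f', hf'⟩ := exists_algGroupHom f hf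
  obtain ⟨k, u, h⟩ := exists_torExt hG hAs hρ e
  have hi : Function.Injective e.i.toGpHom := by
    let _ := torusCommGroup hAs
    exact h.i_inj
  have hex : ∀ x : CD.PiG, ∃ a, e.i.toGpHom a = f x.1 := by
    intro x
    have hx : CD.qG.toGpHom x.1 = 1 := x.2
    let _ := torusCommGroup hAs
    exact (h.exact _).mp ((hq x.1).trans hx)
  choose γ hγ using hex
  let γ' : CD.PiG →* As.Gp := MonoidHom.mk' γ fun x y => hi (by
    rw [hγ, map_mul, hγ, hγ]
    exact map_mul f x.1 y.1)
  refine ⟨γ', f', fun x hx => ?_, fun x => ?_⟩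
  · let x' : CD.Gt.Gp := ⟨x, hx⟩
    change e.q.toFun (f'.toFun x'.1) = _
    rw [hf']
    exact congrArg Subtype.val (hq x')
  · rw [hf']
    exact (congrArg Subtype.val (hγ x)).symm

theorem splits_iff_of_isPushoutOf {As : AffAlgGroup} (hG : G.IsConnected) (hAs : As.IsTorus)
    {ρ : AlgAction G As} (hρ : ρ.IsTrivial) (e : AlgExtension G As ρ) (γ : CD.PiG →* As.Gp)
    (hγ : CD.IsPushoutOf γ e) :
    e.Splits ↔ ∃ d : AlgGroupHom CD.Gt As, ∀ x : CD.PiG, d.toFun x.1.1 = (γ x).1 := by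
  obtain ⟨f, hf, hfγ⟩ := hγ
  obtain ⟨k, u, h⟩ := exists_torExt hG hAs hρ e
  have hr := reg_toGpHom CD.qG
  have hi : Function.Injective e.i.toGpHom := by
    let _ := torusCommGroup hAs
    exact h.i_inj
  have hs : Function.Surjective CD.qG.toGpHom := fun g => by
    obtain ⟨x, hx, hxg⟩ := CD.qG_surj g.1 g.2
    exact ⟨⟨x, hx⟩, Subtype.ext hxg⟩
  have hq : ∀ x, e.q.toGpHom (f.toGpHom x) = CD.qG.toGpHom x := fun x => Subtype.ext (hf x.1 x.2)
  have hfγ' : ∀ x : CD.PiG, f.toGpHom x.1 = e.i.toGpHom (γ x) := fun x => Subtype.ext (hfγ x)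
  let _ := torusCommGroup hAs
  constructor
  · rintro ⟨σ, hσ⟩
    obtain ⟨d, hd, hdf⟩ := TorExt.exists_extension h CD.qG.toGpHom hr f.toGpHom (reg_toGpHom _) hq
      σ.toGpHom (reg_toGpHom _) fun g => Subtype.ext (hσ g.1 g.2)
    obtain ⟨d', hd'⟩ := exists_algGroupHom (G := CD.Gt) (H := As) d hd
    refine ⟨d', fun x => ?_⟩
    rw [hd']
    exact congrArg Subtype.val (hi ((hdf x.1 x.2).symm.trans (hfγ' x)))
  · rintro ⟨d, hd⟩
    obtain ⟨σ, hσ, hσq⟩ := TorExt.exists_section h (isGrp_OG _) CD.qG.toGpHom hr hs f.toGpHom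
      (reg_toGpHom _) hq d.toGpHom (reg_toGpHom _) fun x hx => (hfγ' ⟨x, hx⟩).trans
        (congrArg _ (Subtype.ext (hd ⟨x, hx⟩).symm))
    obtain ⟨σ', hσ'⟩ := exists_algGroupHom σ hσ
    refine ⟨σ', fun g hg => ?_⟩
    let g' : G.Gp := ⟨g, hg⟩
    change e.q.toFun (σ'.toFun g'.1) = g'.1
    rw [hσ']
    exact congrArg Subtype.val (hσq g')

end AlgGrp

namespace AlgGrp

/-! ### Tangent spaces of finite coverings -/

section Pts
variable {X : Type} {O : Subalgebra ℂ (X → ℂ)}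

/-- The maximal ideal of a point. -/
def maxI (O : Subalgebra ℂ (X → ℂ)) (x : X) : Ideal O := RingHom.ker (evalAt O x)

lemma mem_maxI {x : X} {f : O} : f ∈ maxI O x ↔ f.1 x = 0 := RingHom.mem_ker

lemma IsAff.exists_one_zero (h : IsAff O) {x y : X} (hxy : x ≠ y) :
    ∃ f : O, f.1 x = 1 ∧ f.1 y = 0 := by
  have : ∃ f ∈ O, f x ≠ f y := by
    by_contra hcon
    push Not at hcon
    exact hxy (h.sep x y hcon)
  obtain ⟨f, hf, hne⟩ := this
  have h0 : f x - f y ≠ 0 := sub_ne_zero.mpr hne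
  refine ⟨(f x - f y)⁻¹ • (⟨f, hf⟩ - algebraMap ℂ O (f y)), ?_, ?_⟩
  · change (f x - f y)⁻¹ * (f x - f y) = 1
    exact inv_mul_cancel₀ h0
  · change (f x - f y)⁻¹ * (f y - f y) = 0
    simp

lemma IsAff.exists_interp (h : IsAff O) {ι : Type} [Fintype ι] (p : ι → X)
    (hp : Function.Injective p) (c : ι → ℂ) : ∃ f : O, ∀ i, f.1 (p i) = c i := by
  classical
  have : ∀ i j, ∃ f : O, i ≠ j → f.1 (p i) = 1 ∧ f.1 (p j) = 0 := by
    intro i j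
    by_cases hij : i = j
    · exact ⟨0, fun h => absurd hij h⟩
    · obtain ⟨f, hf⟩ := h.exists_one_zero (hp.ne hij)
      exact ⟨f, fun _ => hf⟩
  choose f hf using this
  refine ⟨∑ i, c i • ∏ j ∈ Finset.univ.erase i, f i j, fun k => ?_⟩
  have he : ∀ F : O, F.1 (p k) = evalAt O (p k) F := fun _ => rfl
  rw [he, map_sum, Finset.sum_eq_single k]
  · rw [map_smul, map_prod, Finset.prod_eq_one, smul_eq_mul, mul_one]
    intro j hj
    exact (hf k j (Finset.ne_of_mem_erase hj).symm).1
  · intro i _ hik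
    rw [map_smul, map_prod, Finset.prod_eq_zero (i := k)
      (Finset.mem_erase.mpr ⟨hik.symm, Finset.mem_univ _⟩), smul_zero]
    exact (hf i k hik).2
  · simp

end Pts

section Fin
variable {X Y : Type} [Group X] [Group Y] {O₁ : Subalgebra ℂ (X → ℂ)} {O₂ : Subalgebra ℂ (Y → ℂ)}

/-- The Lagrange interpolation polynomial of `g` with respect to `f` along a finite subgroup. -/
def lagP (h : IsGrp O₁) (K : Subgroup X) [Fintype K] [DecidableEq K] (f g : O₁) :
    Polynomial O₁ :=
  ∑ a : K, Polynomial.C (ltransO h (a : X) g) *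
    ∏ b ∈ Finset.univ.erase a, (Polynomial.X - Polynomial.C (ltransO h (b : X) f))

lemma lagP_map (h : IsGrp O₁) (K : Subgroup X) [Fintype K] [DecidableEq K] (f g : O₁) (c : K) :
    (lagP h K f g).map (ltransO h (c : X)).toRingHom = lagP h K f g := by
  rw [lagP, Polynomial.map_sum]
  refine Fintype.sum_equiv (Equiv.mulRight c) _ _ fun a => ?_
  rw [Polynomial.map_mul, Polynomial.map_prod]
  congr 1
  · simp [ltransO_mulmul]
  · refine Finset.prod_equiv (Equiv.mulRight c) (fun b => by simp) fun b _ => ?_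
    simp [ltransO_mulmul]

lemma lagP_eval (h : IsGrp O₁) (K : Subgroup X) [Fintype K] [DecidableEq K] (f g : O₁) :
    (lagP h K f g).eval f = g * ∏ b ∈ Finset.univ.erase (1 : K), (f - ltransO h (b : X) f) := by
  have h1 : ∀ f : O₁, ltransO h (1 : X) f = f := fun f => by ext x; simp
  rw [lagP, Polynomial.eval_finsetSum, Finset.sum_eq_single 1]
  · simp [Polynomial.eval_prod, h1]
  · intro a _ ha
    rw [Polynomial.eval_mul, Polynomial.eval_prod, Finset.prod_eq_zero (i := (1 : K)), mul_zero]
    · exact Finset.mem_erase.mpr ⟨ha.symm, Finset.mem_univ _⟩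
    · simp [h1]
  · simp

lemma lagP_coeff (h : IsGrp O₁) (K : Subgroup X) [Fintype K] [DecidableEq K] (f g : O₁)
    (hg : ∀ a ∈ K, g.1 a = 0) (n : ℕ) : ((lagP h K f g).coeff n).1 1 = 0 := by
  have : (lagP h K f g).map (evalAt O₁ 1).toRingHom = 0 := by
    rw [lagP, Polynomial.map_sum]
    refine Finset.sum_eq_zero fun a _ => ?_
    rw [Polynomial.map_mul, Polynomial.map_C]
    have : (evalAt O₁ 1).toRingHom (ltransO h (a : X) g) = 0 := by
      simp [hg a a.2]
    rw [this, map_zero, zero_mul]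
  have := congrArg (Polynomial.coeff · n) this
  simpa using this

/-- The fibre over the identity is reduced. -/
theorem mem_map_maxI (h₁ : IsGrp O₁) (h₂ : IsGrp O₂) (hc : ZConn O₂) (q : X →* Y)
    (hq : Reg O₁ O₂ q) (hs : Function.Surjective q) [Finite q.ker] {g : O₁} (hg : ∀ a ∈ q.ker, g.1 a = 0) :
    g ∈ (maxI O₂ 1).map (pbO hq) := by
  classical
  let _ := Fintype.ofFinite q.ker
  obtain ⟨f, hf⟩ := h₁.toIsAff.exists_interp (fun a : q.ker => (a : X)) Subtype.val_injective
    (fun a => ((Fintype.equivFin q.ker a : ℕ) : ℂ))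
  have hinj : ∀ a b : q.ker, f.1 a = f.1 b → a = b := by
    intro a b hab
    rw [hf, hf] at hab
    have := Nat.cast_injective (R := ℂ) hab
    exact (Fintype.equivFin q.ker).injective (Fin.ext this)
  let I := (maxI O₂ 1).map (pbO hq)
  let w : O₁ := ∏ b ∈ Finset.univ.erase (1 : q.ker), (f - ltransO h₁ (b : X) f)
  have hwg : g * w ∈ I := by
    rw [← lagP_eval h₁ q.ker f g, Polynomial.eval_eq_sum, Polynomial.sum]
    refine Ideal.sum_mem _ fun n _ => Ideal.mul_mem_right _ _ ?_
    have hl := lifts_of_inv h₁ h₂ hc q hq hs (lagP_map h₁ q.ker f g)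
    rw [Polynomial.lifts_iff_coeff_lifts] at hl
    obtain ⟨r, hr⟩ := hl n
    have hr' : pbO hq r = (lagP h₁ q.ker f g).coeff n := hr
    rw [← hr']
    refine Ideal.mem_map_of_mem _ (mem_maxI.mpr ?_)
    have := lagP_coeff h₁ q.ker f g hg n
    rw [← hr', pbO_apply, map_one] at this
    exact this
  have htop : I ⊔ Ideal.span {w} = ⊤ := by
    by_contra hne
    obtain ⟨x, hx⟩ := h₁.toIsAff.exists_zero hne
    have hqx : q x = 1 := by
      refine h₂.sep _ _ fun r hr => ?_
      have := hx (pbO hq (⟨r, hr⟩ - algebraMap ℂ O₂ (r 1))) (Ideal.mem_sup_left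
        (Ideal.mem_map_of_mem _ (mem_maxI.mpr (sub_self _))))
      exact sub_eq_zero.mp this
    have hw := hx w (Ideal.mem_sup_right (Ideal.mem_span_singleton_self w))
    have hw' : evalAt O₁ x w = 0 := hw
    rw [map_prod, Finset.prod_eq_zero_iff] at hw'
    obtain ⟨b, hb, hb0⟩ := hw'
    let a : q.ker := ⟨x, hqx⟩
    have : f.1 a = f.1 (b * a : q.ker) := sub_eq_zero.mp hb0
    have := hinj _ _ this
    exact (Finset.ne_of_mem_erase hb) (by simpa using this.symm)
  have h1 : (1 : O₁) ∈ I ⊔ Ideal.span {w} := by rw [htop]; trivial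
  obtain ⟨y, hy, z, hz, hyz⟩ := Submodule.mem_sup.mp h1
  obtain ⟨c, rfl⟩ := Ideal.mem_span_singleton'.mp hz
  have : g = g * y + c * (g * w) := by
    calc g = g * (y + c * w) := by rw [hyz, mul_one]
      _ = _ := by ring
  rw [this]
  exact I.add_mem (I.mul_mem_left _ hy) (I.mul_mem_left _ hwg)

theorem ptDer_eq_zero (h₁ : IsGrp O₁) (h₂ : IsGrp O₂) (hc : ZConn O₂) (q : X →* Y)
    (hq : Reg O₁ O₂ q) (hs : Function.Surjective q) [Finite q.ker] {δ : O₁ →ₗ[ℂ] ℂ} (hδ : IsPtDer δ) (h0 : ∀ r : O₂, δ (pbO hq r) = 0) :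
    δ = 0 := by
  classical
  let _ := Fintype.ofFinite q.ker
  have hI : ∀ g ∈ (maxI O₂ 1).map (pbO hq), δ g = 0 := by
    intro g hg
    refine Submodule.span_induction (p := fun g _ => δ g = 0) ?_ (map_zero δ) ?_ ?_ hg
    · rintro _ ⟨r, -, rfl⟩
      exact h0 r
    · intro x y _ _ hx hy
      rw [map_add, hx, hy, add_zero]
    · intro c x hx hx0
      have hx1 : x.1 1 = 0 := by
        have : (maxI O₂ 1).map (pbO hq) ≤ maxI O₁ 1 := by
          refine Ideal.map_le_iff_le_comap.mpr fun r hr => ?_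
          rw [Ideal.mem_comap, mem_maxI, pbO_apply, map_one]
          exact mem_maxI.mp hr
        exact mem_maxI.mp (this hx)
      rw [smul_eq_mul, hδ, hx0, hx1, mul_zero, zero_mul, add_zero]
  obtain ⟨e, he⟩ := h₁.toIsAff.exists_interp (fun a : q.ker => (a : X)) Subtype.val_injective
    (fun a => if a = 1 then 1 else 0)
  have he1 : e.1 1 = 1 := by simpa using he 1
  have hone : δ 1 = 0 := by
    have := h0 1
    rwa [map_one] at this
  ext g
  let g0 : O₁ := g - algebraMap ℂ O₁ (g.1 1)
  have hg0 : g0.1 1 = 0 := sub_self _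
  have h3 : δ (g0 * e) = 0 := by
    refine hI _ (mem_map_maxI h₁ h₂ hc q hq hs fun a ha => ?_)
    have h4 := he ⟨a, ha⟩
    change g0.1 a * e.1 a = 0
    by_cases hone' : a = 1
    · rw [hone', hg0, zero_mul]
    · rw [h4, if_neg (fun h => hone' (congrArg Subtype.val h)), mul_zero]
  rw [hδ, hg0, he1, zero_mul, one_mul, zero_add] at h3
  have h5 : g = g0 + (g.1 1) • 1 := by
    rw [← Algebra.algebraMap_eq_smul_one]; simp [g0]
  rw [h5, map_add, map_smul, h3, hone]
  simp

lemma exists_trace (h₁ : IsGrp O₁) (h₂ : IsGrp O₂) (hc : ZConn O₂) (q : X →* Y)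
    (hq : Reg O₁ O₂ q) (hs : Function.Surjective q) [Finite q.ker] (h : O₁) :
    ∃ t : O₂, ∀ x, t.1 (q x) = ∑ᶠ a : q.ker, h.1 (a * x) := by
  let _ := Fintype.ofFinite q.ker
  have hmem : (fun x => ∑ᶠ a : q.ker, h.1 (a * x)) ∈ O₁ := by
    have := (∑ a : q.ker, ltransO h₁ (a : X) h).2
    convert this using 1
    funext x
    rw [finsum_eq_sum_of_fintype]
    have e : ∀ F : O₁, F.1 x = evalAt O₁ x F := fun _ => rfl
    rw [e, map_sum]
    rfl
  obtain ⟨F, hF, e⟩ := descent h₁ h₂ hc q hq hs hmem (by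
    intro x x' hx
    rw [finsum_eq_sum_of_fintype, finsum_eq_sum_of_fintype]
    let b : q.ker := ⟨x * x'⁻¹, by rw [MonoidHom.mem_ker]; simp [hx]⟩
    refine Fintype.sum_equiv (Equiv.mulRight b) _ _ fun a => ?_
    simp [b, mul_assoc])
  exact ⟨⟨F, hF⟩, e⟩

lemma mem_sq_of_pbO_mem (h₁ : IsGrp O₁) (h₂ : IsGrp O₂) (hc : ZConn O₂) (q : X →* Y)
    (hq : Reg O₁ O₂ q) (hs : Function.Surjective q) [Finite q.ker] {r : O₂} (hr : pbO hq r ∈ ((maxI O₂ 1) ^ 2).map (pbO hq)) :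
    r ∈ (maxI O₂ 1) ^ 2 := by
  classical
  let _ := Fintype.ofFinite q.ker
  have key : ∀ h ∈ ((maxI O₂ 1) ^ 2).map (pbO hq), ∃ t ∈ (maxI O₂ 1) ^ 2,
      ∀ x, t.1 (q x) = ∑ᶠ a : q.ker, h.1 (a * x) := by
    intro h hh
    rw [Ideal.map, Submodule.mem_span_iff_exists_finset_subset] at hh
    obtain ⟨c, S, hS, -, rfl⟩ := hh
    choose! s hs1 hs2 using fun x (hx : x ∈ S) => hS hx
    choose T hT using exists_trace h₁ h₂ hc q hq hs
    refine ⟨∑ x ∈ S, s x * T (c x), Ideal.sum_mem _ fun x hx => Ideal.mul_mem_right _ _ (hs1 x hx), ?_⟩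
    intro y
    have e1 : ∀ F : O₂, F.1 (q y) = evalAt O₂ (q y) F := fun _ => rfl
    have e2 : ∀ (F : O₁) x, F.1 x = evalAt O₁ x F := fun _ _ => rfl
    rw [finsum_eq_sum_of_fintype, e1, map_sum]
    simp only [e2, map_sum]
    rw [Finset.sum_comm]
    refine Finset.sum_congr rfl fun x hx => ?_
    rw [map_mul]
    change (s x).1 (q y) * (T (c x)).1 (q y) = _
    rw [hT, finsum_eq_sum_of_fintype, Finset.mul_sum]
    refine Finset.sum_congr rfl fun a _ => ?_
    rw [smul_eq_mul, map_mul, mul_comm]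
    congr 1
    conv_rhs => rw [← hs2 x hx]
    have ha : q a = 1 := a.2
    change _ = (s x).1 (q (a * y))
    rw [map_mul, ha, one_mul]
  obtain ⟨t, ht, h⟩ := key _ hr
  have hN : (Fintype.card q.ker : ℂ) ≠ 0 := Nat.cast_ne_zero.mpr Fintype.card_ne_zero
  have : r = (Fintype.card q.ker : ℂ)⁻¹ • t := by
    ext y
    obtain ⟨x, rfl⟩ := hs y
    change r.1 (q x) = (Fintype.card q.ker : ℂ)⁻¹ * t.1 (q x)
    have h3 : ∀ a : q.ker, (pbO hq r).1 (a * x) = r.1 (q x) := by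
      intro a
      have ha : q a = 1 := a.2
      rw [pbO_apply, map_mul, ha, one_mul]
    rw [h, finsum_eq_sum_of_fintype]
    simp only [h3]
    rw [Finset.sum_const, Finset.card_univ, nsmul_eq_mul, inv_mul_cancel_left₀ hN]
  rw [this, Algebra.smul_def]
  exact Ideal.mul_mem_left _ _ ht

lemma mem_sq_of_pbO_mem_sq (h₁ : IsGrp O₁) (h₂ : IsGrp O₂) (hc : ZConn O₂) (q : X →* Y)
    (hq : Reg O₁ O₂ q) (hs : Function.Surjective q) [Finite q.ker] {r : O₂} (hr : pbO hq r ∈ (maxI O₁ 1) ^ 2) :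
    r ∈ (maxI O₂ 1) ^ 2 := by
  classical
  let _ := Fintype.ofFinite q.ker
  refine mem_sq_of_pbO_mem h₁ h₂ hc q hq hs ?_
  have hcop : ∀ a b : q.ker, a ≠ b → IsCoprime (maxI O₁ (a : X)) (maxI O₁ (b : X)) := by
    intro a b hab
    obtain ⟨f, hf1, hf0⟩ := h₁.toIsAff.exists_one_zero (Subtype.val_injective.ne hab)
    rw [Ideal.isCoprime_iff_exists]
    exact ⟨1 - f, mem_maxI.mpr (by change 1 - f.1 a = 0; rw [hf1, sub_self]), f, mem_maxI.mpr hf0,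
      by ring⟩
  have hle : ∏ a : q.ker, maxI O₁ (a : X) ≤ (maxI O₂ 1).map (pbO hq) := by
    rw [Ideal.prod_eq_iInf_of_pairwise_isCoprime fun a _ b _ hab => hcop a b hab]
    intro g hg
    refine mem_map_maxI h₁ h₂ hc q hq hs fun a ha => ?_
    have : g ∈ maxI O₁ a := by
      simp only [Ideal.mem_iInf] at hg
      exact hg ⟨a, ha⟩ (Finset.mem_univ _)
    exact mem_maxI.mp this
  rw [Ideal.map_pow]
  refine Ideal.pow_right_mono hle 2 ?_
  rw [← Finset.prod_pow, Ideal.prod_eq_iInf_of_pairwise_isCoprime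
    fun a _ b _ hab => (hcop a b hab).pow]
  simp only [Ideal.mem_iInf]
  intro a _
  have h1 : (maxI O₁ 1).map (ltransO h₁ (a : X)⁻¹) ≤ maxI O₁ (a : X) := by
    refine Ideal.map_le_iff_le_comap.mpr fun f hf => ?_
    rw [Ideal.mem_comap, mem_maxI, ltransO_apply, inv_mul_cancel]
    exact mem_maxI.mp hf
  have h2 := Ideal.mem_map_of_mem (ltransO h₁ (a : X)⁻¹) hr
  rw [Ideal.map_pow] at h2
  have h3 : ltransO h₁ (a : X)⁻¹ (pbO hq r) = pbO hq r := by
    ext x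
    have ha : q a = 1 := a.2
    rw [ltransO_apply, pbO_apply, pbO_apply, map_mul, map_inv, ha, inv_one, one_mul]
  rw [h3] at h2
  exact Ideal.pow_right_mono h1 2 h2

lemma IsPtDer.sq {H : Type} [Group H] {O : Subalgebra ℂ (H → ℂ)} {δ : O →ₗ[ℂ] ℂ} (hδ : IsPtDer δ)
    {f : O} (hf : f ∈ (maxI O 1) ^ 2) : δ f = 0 := by
  rw [pow_two] at hf
  refine Submodule.mul_induction_on hf (fun a ha b hb => ?_) fun a b ha hb => ?_
  · rw [hδ, mem_maxI.mp ha, mem_maxI.mp hb]; ring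
  · rw [map_add, ha, hb, add_zero]

theorem exists_ptDer (h₁ : IsGrp O₁) (h₂ : IsGrp O₂) (hc : ZConn O₂) (q : X →* Y)
    (hq : Reg O₁ O₂ q) (hs : Function.Surjective q) [Finite q.ker] {δ : O₂ →ₗ[ℂ] ℂ} (hδ : IsPtDer δ) :
    ∃ δ' : O₁ →ₗ[ℂ] ℂ, IsPtDer δ' ∧ ∀ r, δ' (pbO hq r) = δ r := by
  have hδ1 : δ 1 = 0 := by
    have := hδ 1 1
    have e : (1 : O₂).1 1 = 1 := rfl
    rw [mul_one, e, one_mul] at this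
    simpa using this
  let W : Submodule ℂ O₁ := Submodule.span ℂ {1} ⊔ ((maxI O₁ 1) ^ 2).restrictScalars ℂ
  let L : O₂ →ₗ[ℂ] (O₁ ⧸ W) := W.mkQ ∘ₗ (pbO hq).toLinearMap
  have hmem : δ ∈ LinearMap.range L.dualMap := by
    rw [LinearMap.range_dualMap_eq_dualAnnihilator_ker, Submodule.mem_dualAnnihilator]
    intro r hr
    have hr' : pbO hq r ∈ W := by
      rwa [LinearMap.mem_ker, LinearMap.comp_apply, Submodule.mkQ_apply,
        Submodule.Quotient.mk_eq_zero] at hr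
    obtain ⟨y, hy, z, hz, hyz⟩ := Submodule.mem_sup.mp hr'
    obtain ⟨c, rfl⟩ := Submodule.mem_span_singleton.mp hy
    have h3 : r - c • 1 ∈ (maxI O₂ 1) ^ 2 := by
      refine mem_sq_of_pbO_mem_sq h₁ h₂ hc q hq hs ?_
      rw [map_sub, map_smul, map_one, ← hyz, add_sub_cancel_left]
      exact hz
    have h4 := hδ.sq h3
    rwa [map_sub, map_smul, hδ1, smul_zero, sub_zero] at h4
  obtain ⟨φ, hφ⟩ := hmem
  let δ' : O₁ →ₗ[ℂ] ℂ := φ ∘ₗ W.mkQ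
  have hW : ∀ f ∈ W, δ' f = 0 := by
    intro f hf
    change φ (W.mkQ f) = 0
    rw [Submodule.mkQ_apply, (Submodule.Quotient.mk_eq_zero W).mpr hf, map_zero]
  refine ⟨δ', fun a b => ?_, fun r => LinearMap.congr_fun hφ r⟩
  have h1 : δ' 1 = 0 := hW _ (Submodule.mem_sup_left (Submodule.mem_span_singleton_self 1))
  have h2 : δ' ((a - (a.1 1) • 1) * (b - (b.1 1) • 1)) = 0 := by
    refine hW _ (Submodule.mem_sup_right ?_)
    rw [Submodule.restrictScalars_mem, pow_two]
    refine Ideal.mul_mem_mul (mem_maxI.mpr ?_) (mem_maxI.mpr ?_)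
    · change a.1 1 - a.1 1 * 1 = 0; ring
    · change b.1 1 - b.1 1 * 1 = 0; ring
  have h3 : (a - (a.1 1) • 1) * (b - (b.1 1) • 1) =
      a * b - (a.1 1) • b - (b.1 1) • a + (a.1 1 * b.1 1) • 1 := by
    simp only [sub_mul, mul_sub, smul_mul_assoc, mul_smul_comm, one_mul, mul_one]
    rw [smul_sub, smul_smul, mul_comm (b.1 1)]
    abel
  rw [h3, map_add, map_sub, map_sub, map_smul, map_smul, map_smul, h1] at h2
  simp only [smul_eq_mul, mul_zero, add_zero] at h2
  linear_combination h2

end Fin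

end AlgGrp

namespace AlgGrp

/-! ### Directional derivatives of polynomials -/

section Poly
variable {m n : ℕ}

/-- The derivative of a polynomial at `x` in the direction `v`. -/
def dirD (x v : Pt n) : MvPolynomial (Fin n) ℂ →ₗ[ℂ] ℂ where
  toFun p := ∑ j, v j * eval x (pderiv j p)
  map_add' p q := by simp [mul_add, Finset.sum_add_distrib]
  map_smul' c p := by
    simp only [Derivation.map_smul, smul_eval, RingHom.id_apply, smul_eq_mul, Finset.mul_sum]
    exact Finset.sum_congr rfl fun j _ => by ring

lemma dirD_apply (x v : Pt n) (p : MvPolynomial (Fin n) ℂ) :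
    dirD x v p = ∑ j, v j * eval x (pderiv j p) := rfl

lemma dirD_C (x v : Pt n) (c : ℂ) : dirD x v (C c) = 0 := by simp [dirD_apply]

lemma dirD_X (x v : Pt n) (i : Fin n) : dirD x v (X i) = v i := by
  classical
  rw [dirD_apply, Finset.sum_eq_single i]
  · simp
  · intro j _ hj
    rw [pderiv_X_of_ne hj.symm]; simp
  · simp

lemma dirD_mul (x v : Pt n) (p q : MvPolynomial (Fin n) ℂ) :
    dirD x v (p * q) = eval x p * dirD x v q + eval x q * dirD x v p := by
  simp only [dirD_apply, Derivation.leibniz, smul_eq_mul, map_add, map_mul, mul_add,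
    Finset.sum_add_distrib, Finset.mul_sum]
  congr 1 <;> exact Finset.sum_congr rfl fun j _ => by ring

/-- A linear functional obeying the Leibniz rule is a directional derivative. -/
lemma eq_dirD {x : Pt n} {L : MvPolynomial (Fin n) ℂ →ₗ[ℂ] ℂ}
    (hL : ∀ p q, L (p * q) = eval x p * L q + eval x q * L p) (p : MvPolynomial (Fin n) ℂ) :
    L p = dirD x (fun i => L (X i)) p := by
  have h1 : L 1 = 0 := by
    have := hL 1 1
    rw [mul_one, map_one (eval x), one_mul] at this
    simpa using this
  induction p using MvPolynomial.induction_on with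
  | C a =>
    have : (C a : MvPolynomial (Fin n) ℂ) = a • 1 := by rw [smul_eq_C_mul, mul_one]
    rw [dirD_C, this, map_smul, h1, smul_zero]
  | add p q hp hq => rw [map_add, map_add, hp, hq]
  | mul_X p i hp => rw [hL, dirD_mul, hp, dirD_X]

lemma eval_aeval' (x : Pt m) (F : Fin n → MvPolynomial (Fin m) ℂ) (p : MvPolynomial (Fin n) ℂ) :
    eval x (aeval F p) = eval (fun i => eval x (F i)) p := by
  induction p using MvPolynomial.induction_on with
  | C a => rw [aeval_C, algebraMap_eq, eval_C, eval_C]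
  | add p q hp hq => rw [map_add, map_add, map_add, hp, hq]
  | mul_X p i hp => rw [map_mul, map_mul, map_mul, aeval_X, eval_X, hp]

/-- The chain rule. -/
lemma dirD_aeval (x v : Pt m) (F : Fin n → MvPolynomial (Fin m) ℂ) (p : MvPolynomial (Fin n) ℂ) :
    dirD x v (aeval F p) = dirD (fun i => eval x (F i)) (fun i => dirD x v (F i)) p := by
  have := eq_dirD (x := fun i => eval x (F i)) (L := dirD x v ∘ₗ (aeval F).toLinearMap) (by
    intro p q
    simp only [LinearMap.comp_apply, AlgHom.toLinearMap_apply, map_mul, dirD_mul, eval_aeval']) p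
  simpa only [LinearMap.comp_apply, AlgHom.toLinearMap_apply, aeval_X] using this

/-- The polynomial obtained by differentiating in the second group of variables. -/
def dirD₂ (w : Pt n) : MvPolynomial (Fin (n + n)) ℂ →ₗ[ℂ] MvPolynomial (Fin (n + n)) ℂ :=
  ∑ k, w k • (pderiv (Fin.natAdd n k)).toLinearMap

lemma dirD₂_apply (w : Pt n) (p : MvPolynomial (Fin (n + n)) ℂ) :
    dirD₂ w p = ∑ k, w k • pderiv (Fin.natAdd n k) p := by
  simp [dirD₂, LinearMap.sum_apply]

lemma dirD₂_mul (w : Pt n) (p q : MvPolynomial (Fin (n + n)) ℂ) :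
    dirD₂ w (p * q) = p * dirD₂ w q + q * dirD₂ w p := by
  simp only [dirD₂_apply, Derivation.leibniz, smul_eq_mul, smul_add, Finset.sum_add_distrib,
    Finset.mul_sum, mul_smul_comm]

lemma eval_dirD₂ (z : Pt (n + n)) (w : Pt n) (p : MvPolynomial (Fin (n + n)) ℂ) :
    eval z (dirD₂ w p) = dirD z (Fin.append (0 : Pt n) w) p := by
  rw [dirD₂_apply, map_sum, dirD_apply, Fin.sum_univ_add]
  simp only [Fin.append_left, Fin.append_right, Pi.zero_apply, zero_mul, Finset.sum_const_zero,
    zero_add, smul_eval]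

lemma dirD_append_zero (z : Pt (n + n)) (v : Pt n) (p : MvPolynomial (Fin (n + n)) ℂ) :
    dirD z (Fin.append v (0 : Pt n)) p = ∑ j, v j * eval z (pderiv (Fin.castAdd n j) p) := by
  rw [dirD_apply, Fin.sum_univ_add]
  simp only [Fin.append_left, Fin.append_right, Pi.zero_apply, zero_mul, Finset.sum_const_zero,
    add_zero]

/-- The mixed second derivative. -/
lemma mixed_eq (z : Pt (n + n)) (v w : Pt n) (p : MvPolynomial (Fin (n + n)) ℂ) :
    dirD z (Fin.append v (0 : Pt n)) (dirD₂ w p) =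
      ∑ j, ∑ k, v j * w k *
        eval z (pderiv (Fin.castAdd n j) (pderiv (Fin.natAdd n k) p)) := by
  rw [dirD_append_zero]
  refine Finset.sum_congr rfl fun j _ => ?_
  rw [dirD₂_apply, map_sum, map_sum, Finset.mul_sum]
  refine Finset.sum_congr rfl fun k _ => ?_
  rw [Derivation.map_smul, smul_eval]
  ring

/-- Freezing the first group of variables. -/
def subst₁ (x : Pt n) : Fin (n + n) → MvPolynomial (Fin n) ℂ := Fin.append (fun j => C (x j)) X

/-- Freezing the second group of variables. -/
def subst₂ (y : Pt n) : Fin (n + n) → MvPolynomial (Fin n) ℂ := Fin.append X (fun j => C (y j))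

lemma eval_subst₁ (x y : Pt n) : (fun i => eval y (subst₁ x i)) = Fin.append x y := by
  funext i
  refine Fin.addCases (fun i => ?_) (fun i => ?_) i <;>
    simp only [subst₁, Fin.append_left, Fin.append_right, eval_C, eval_X]

lemma eval_subst₂ (x y : Pt n) : (fun i => eval x (subst₂ y i)) = Fin.append x y := by
  funext i
  refine Fin.addCases (fun i => ?_) (fun i => ?_) i <;>
    simp only [subst₂, Fin.append_left, Fin.append_right, eval_C, eval_X]

lemma dirD_subst₁ (x y w : Pt n) : (fun i => dirD y w (subst₁ x i)) = Fin.append (0 : Pt n) w := by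
  funext i
  refine Fin.addCases (fun i => ?_) (fun i => ?_) i <;>
    simp only [subst₁, Fin.append_left, Fin.append_right, dirD_C, dirD_X, Pi.zero_apply]

lemma dirD_subst₂ (x y v : Pt n) : (fun i => dirD x v (subst₂ y i)) = Fin.append v (0 : Pt n) := by
  funext i
  refine Fin.addCases (fun i => ?_) (fun i => ?_) i <;>
    simp only [subst₂, Fin.append_left, Fin.append_right, dirD_C, dirD_X, Pi.zero_apply]

lemma mem_tangentAt {V : Set (Pt n)} {x v : Pt n} :
    v ∈ tangentAt V x ↔ ∀ p, (∀ y ∈ V, eval y p = 0) → dirD x v p = 0 := Iff.rfl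

lemma dirD_eq_zero_of_right {V : Set (Pt n)} {x y w : Pt n} (hw : w ∈ tangentAt V y)
    {r : MvPolynomial (Fin (n + n)) ℂ} (hr : ∀ y ∈ V, eval (Fin.append x y) r = 0) :
    dirD (Fin.append x y) (Fin.append (0 : Pt n) w) r = 0 := by
  have := mem_tangentAt.mp hw (aeval (subst₁ x) r) fun y hy => by
    rw [eval_aeval', eval_subst₁]; exact hr y hy
  rwa [dirD_aeval, eval_subst₁, dirD_subst₁] at this

/-- The mixed derivative of a polynomial vanishing on `V × V`. -/
lemma mixed_eq_zero {V : Set (Pt n)} {x v w : Pt n}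
    (hv : v ∈ tangentAt V x) (hw : w ∈ tangentAt V x) {r : MvPolynomial (Fin (n + n)) ℂ}
    (hr : ∀ x ∈ V, ∀ y ∈ V, eval (Fin.append x y) r = 0) :
    dirD (Fin.append x x) (Fin.append v (0 : Pt n)) (dirD₂ w r) = 0 := by
  have := mem_tangentAt.mp hv (aeval (subst₂ x) (dirD₂ w r)) fun y hy => by
    rw [eval_aeval', eval_subst₂, eval_dirD₂]
    exact dirD_eq_zero_of_right hw (hr y hy)
  rwa [dirD_aeval, eval_subst₂, dirD_subst₂] at this

/-- The second order chain rule at a point where the first derivatives vanish. -/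
lemma mixed_aeval {z : Pt (n + n)} {v w : Pt n} {F : Fin n → MvPolynomial (Fin (n + n)) ℂ}
    (h0 : ∀ i, dirD z (Fin.append (0 : Pt n) w) (F i) = 0) (p : MvPolynomial (Fin n) ℂ) :
    dirD z (Fin.append v (0 : Pt n)) (dirD₂ w (aeval F p)) =
      dirD (fun i => eval z (F i))
        (fun i => dirD z (Fin.append v (0 : Pt n)) (dirD₂ w (F i))) p := by
  have hb : ∀ p : MvPolynomial (Fin n) ℂ, eval z (dirD₂ w (aeval F p)) = 0 := by
    intro p
    rw [eval_dirD₂, dirD_aeval]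
    simp only [h0]
    rw [dirD_apply]
    simp only [zero_mul, Finset.sum_const_zero]
  have := eq_dirD (x := fun i => eval z (F i))
    (L := dirD z (Fin.append v (0 : Pt n)) ∘ₗ dirD₂ w ∘ₗ (aeval F).toLinearMap) (by
    intro p q
    simp only [LinearMap.comp_apply, AlgHom.toLinearMap_apply, map_mul, dirD₂_mul, map_add, dirD_mul,
      hb, eval_aeval']
    ring) p
  simpa only [LinearMap.comp_apply, AlgHom.toLinearMap_apply, aeval_X] using this

end Poly

/-! ### Tangent vectors and point derivations -/

section Tangent
variable {Z : Type} [Group Z] {O : Subalgebra ℂ (Z → ℂ)} {n : ℕ} {c : Z → Pt n}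

/-- The function on `Z` defined by a polynomial. -/
def polyFun (hO : ∀ f : Z → ℂ, f ∈ O ↔ ∃ p : MvPolynomial (Fin n) ℂ, ∀ z, f z = eval (c z) p) : MvPolynomial (Fin n) ℂ →ₐ[ℂ] O where
  toFun p := ⟨fun z => eval (c z) p, (hO _).mpr ⟨p, fun _ => rfl⟩⟩
  map_one' := Subtype.ext (funext fun z => map_one _)
  map_mul' p q := Subtype.ext (funext fun z => map_mul _ p q)
  map_zero' := Subtype.ext (funext fun z => map_zero _)
  map_add' p q := Subtype.ext (funext fun z => map_add _ p q)
  commutes' a := Subtype.ext (funext fun z => by simp [algebraMap_eq])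

variable (hO : ∀ f : Z → ℂ, f ∈ O ↔ ∃ p : MvPolynomial (Fin n) ℂ, ∀ z, f z = eval (c z) p)

lemma polyFun_apply (p : MvPolynomial (Fin n) ℂ) (z : Z) :
    (polyFun hO p).1 z = eval (c z) p := rfl

lemma polyFun_surj : Function.Surjective (polyFun hO) := by
  intro f
  obtain ⟨p, hp⟩ := (hO f.1).mp f.2
  refine ⟨p, ?_⟩
  ext z
  rw [polyFun_apply]
  exact (hp z).symm

lemma exists_ptDer_of_tangent {v : Pt n} (hv : v ∈ tangentAt (Set.range c) (c 1)) :
    ∃ δ : O →ₗ[ℂ] ℂ, IsPtDer δ ∧ ∀ p, δ (polyFun hO p) = dirD (c 1) v p := by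
  have hk : LinearMap.ker (polyFun hO).toLinearMap ≤ LinearMap.ker (dirD (c 1) v) := by
    intro p hp
    refine mem_tangentAt.mp hv p ?_
    rintro _ ⟨z, rfl⟩
    exact congrFun (congrArg Subtype.val (LinearMap.mem_ker.mp hp)) z
  have hmem : dirD (c 1) v ∈ LinearMap.range (polyFun hO).toLinearMap.dualMap := by
    rw [LinearMap.range_dualMap_eq_dualAnnihilator_ker, Submodule.mem_dualAnnihilator]
    exact hk
  obtain ⟨δ, hδ⟩ := hmem
  have hδ' : ∀ p, δ (polyFun hO p) = dirD (c 1) v p := fun p => LinearMap.congr_fun hδ p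
  refine ⟨δ, fun a b => ?_, hδ'⟩
  obtain ⟨p, rfl⟩ := polyFun_surj hO a
  obtain ⟨q, rfl⟩ := polyFun_surj hO b
  rw [← map_mul, hδ', hδ', hδ', dirD_mul]
  rfl

lemma IsPtDer.apply_polyFun {δ : O →ₗ[ℂ] ℂ} (hδ : IsPtDer δ) (p : MvPolynomial (Fin n) ℂ) :
    δ (polyFun hO p) = dirD (c 1) (fun i => δ (polyFun hO (MvPolynomial.X i))) p :=
  eq_dirD (x := c 1) (L := δ ∘ₗ (polyFun hO).toLinearMap) (fun p q => by
    simp only [LinearMap.comp_apply, AlgHom.toLinearMap_apply, map_mul]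
    exact hδ _ _) p

lemma IsPtDer.mem_tangentAt {δ : O →ₗ[ℂ] ℂ} (hδ : IsPtDer δ) :
    (fun i => δ (polyFun hO (MvPolynomial.X i))) ∈ tangentAt (Set.range c) (c 1) := by
  refine AlgGrp.mem_tangentAt.mpr fun p hp => ?_
  rw [← hδ.apply_polyFun hO]
  have h0 : polyFun hO p = 0 := by
    ext z
    rw [polyFun_apply]
    exact hp _ ⟨z, rfl⟩
  rw [h0, map_zero]

end Tangent

end AlgGrp

namespace AlgGrp

/-! ### The Lie algebra of an extension by a torus splits -/

section LieSplit
variable {G As : AffAlgGroup} {ρ : AlgAction G As}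

lemma exists_isCommutatorRep (E : AffAlgGroup) : ∃ F, IsCommutatorRep E F := by
  have hE := isGrp_OG E
  have hcomm : Reg (prodAlg (OG E) (OG E)) (OG E)
      (fun p : E.Gp × E.Gp => p.1 * p.2 * (p.1⁻¹ * p.2⁻¹)) :=
    hE.mulReg (hE.mulReg reg_fst reg_snd) (hE.mulReg (hE.invReg reg_fst) (hE.invReg reg_snd))
  have key : ∀ i : Fin E.n, ∃ r : MvPolynomial (Fin (E.n + E.n)) ℂ, ∀ x y : E.Gp,
      (x * y * (x⁻¹ * y⁻¹)).1 i = eval (Fin.append x.1 y.1) r := by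
    intro i
    obtain ⟨S, hS⟩ := mem_prodAlg_iff.mp (hcomm _ (coord_mem_OG i))
    have hp : ∀ f : OG E, ∃ p : MvPolynomial (Fin E.n) ℂ, ∀ x : E.Gp, f.1 x = eval x.1 p :=
      fun f => mem_OG.mp f.2
    choose P hP using hp
    refine ⟨∑ s ∈ S, rename (Fin.castAdd E.n) (P s.1) * rename (Fin.natAdd E.n) (P s.2),
      fun x y => ?_⟩
    refine (hS x y).trans ?_
    rw [map_sum]
    refine Finset.sum_congr rfl fun s _ => ?_
    have h1 : Fin.append x.1 y.1 ∘ Fin.castAdd E.n = x.1 := funext fun j => Fin.append_left _ _ j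
    have h2 : Fin.append x.1 y.1 ∘ Fin.natAdd E.n = y.1 := funext fun j => Fin.append_right _ _ j
    rw [map_mul, eval_rename, eval_rename, h1, h2, hP, hP]
  choose F hF using key
  exact ⟨F, fun x hx y hy i => hF i ⟨x, hx⟩ ⟨y, hy⟩⟩

lemma commutatorRep_eval {E : AffAlgGroup} {F : Fin E.n → MvPolynomial (Fin (E.n + E.n)) ℂ}
    (hF : IsCommutatorRep E F) (x y : E.Gp) (i : Fin E.n) :
    eval (Fin.append x.1 y.1) (F i) = (x * y * (x⁻¹ * y⁻¹)).1 i :=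
  (hF x.1 x.2 y.1 y.2 i).symm

lemma tangentAt_mono {n : ℕ} {V W : Set (Pt n)} (h : V ⊆ W) (x : Pt n) :
    tangentAt V x ≤ tangentAt W x := fun _ hv p hp => hv p fun y hy => hp y (h hy)

/-- The points of a subgroup of `E`, as a subset of affine space. -/
def coordSet {E : AffAlgGroup} (K : Subgroup E.Gp) : Set (Pt E.n) :=
  Set.range fun z : K => z.1.1

lemma coordSet_subset {E : AffAlgGroup} (K : Subgroup E.Gp) : coordSet K ⊆ E.carrier := by
  rintro _ ⟨z, rfl⟩
  exact z.1.2

/-- The Lie subalgebra of a subgroup. -/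
def lieSub {E : AffAlgGroup} (K : Subgroup E.Gp) {𝔢 : Type} [LieRing 𝔢] [LieAlgebra ℂ 𝔢]
    {ε : 𝔢 →ₗ[ℂ] Pt E.n} (hε : IsLieAlgebraOf E 𝔢 ε) : LieSubalgebra ℂ 𝔢 where
  toSubmodule := (tangentAt (coordSet K) E.one).comap ε
  lie_mem' := by
    intro v w hv hw
    have hv' : ε v ∈ tangentAt (coordSet K) E.one := hv
    have hw' : ε w ∈ tangentAt (coordSet K) E.one := hw
    change ε ⁅v, w⁆ ∈ tangentAt (coordSet K) E.one
    obtain ⟨F, hF⟩ := exists_isCommutatorRep E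
    have h1 : ∀ y : E.Gp, ∀ i, eval (Fin.append E.one y.1) (F i) = E.one i := by
      intro y i
      refine (commutatorRep_eval hF 1 y i).trans ?_
      rw [one_mul, inv_one, one_mul, mul_inv_cancel]
      rfl
    have h0 : ∀ i, dirD (Fin.append E.one E.one) (Fin.append (0 : Pt E.n) (ε w)) (F i) = 0 := by
      intro i
      have := dirD_eq_zero_of_right (x := E.one) (r := F i - C (E.one i))
        (tangentAt_mono (coordSet_subset K) _ hw') (fun y hy => by
          rw [map_sub, eval_C, h1 ⟨y, hy⟩ i, sub_self])
      rwa [map_sub, dirD_C, sub_zero] at this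
    refine mem_tangentAt.mpr fun p hp => ?_
    have hbr : ε ⁅v, w⁆ = fun i => dirD (Fin.append E.one E.one)
        (Fin.append (ε v) (0 : Pt E.n)) (dirD₂ (ε w) (F i)) := by
      funext i
      rw [mixed_eq]
      exact hε.bracket_eq F hF v w i
    have hone : (fun i => eval (Fin.append E.one E.one) (F i)) = E.one :=
      funext fun i => h1 1 i
    have hmix := mixed_aeval (v := ε v) h0 p
    rw [hone] at hmix
    rw [hbr, ← hmix]
    refine mixed_eq_zero hv' hw' ?_
    rintro _ ⟨a, rfl⟩ _ ⟨b, rfl⟩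
    rw [eval_aeval', show (fun i => eval (Fin.append a.1.1 b.1.1) (F i)) = _ from
      funext (commutatorRep_eval hF a.1 b.1)]
    exact hp _ ⟨a * b * (a⁻¹ * b⁻¹), rfl⟩

lemma mem_lieSub {E : AffAlgGroup} {K : Subgroup E.Gp} {𝔢 : Type} [LieRing 𝔢] [LieAlgebra ℂ 𝔢]
    {ε : 𝔢 →ₗ[ℂ] Pt E.n} {hε : IsLieAlgebraOf E 𝔢 ε} {w : 𝔢} :
    w ∈ lieSub K hε ↔ ε w ∈ tangentAt (coordSet K) E.one := Iff.rfl

lemma mem_res_OG {E : AffAlgGroup} (K : Subgroup E.Gp) (f : K → ℂ) :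
    f ∈ res (OG E) K.subtype ↔ ∃ p : MvPolynomial (Fin E.n) ℂ, ∀ z : K, f z = eval z.1.1 p := by
  constructor
  · rintro ⟨g, hg, rfl⟩
    obtain ⟨p, hp⟩ := mem_OG.mp hg
    exact ⟨p, fun z => hp z.1⟩
  · rintro ⟨p, hp⟩
    refine mem_res.mpr ⟨fun x => eval x.1 p, mem_OG.mpr ⟨p, fun _ => rfl⟩, ?_⟩
    funext z
    exact (hp z).symm

/-- The coordinates of a point of an affine algebraic group. -/
def coords (G : AffAlgGroup) (x : G.Gp) : Pt G.n := x.1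

lemma range_coords (G : AffAlgGroup) : Set.range (coords G) = G.carrier := by
  ext x
  exact ⟨by rintro ⟨z, rfl⟩; exact z.2, fun hx => ⟨⟨x, hx⟩, rfl⟩⟩

/-- A closed subgroup mapping onto `G` with finite kernel has the same Lie algebra as `G`. -/
lemma lieSub_bijective (hG : G.IsConnected) {E : AffAlgGroup} (q : AlgGroupHom E G)
    {K : Subgroup E.Gp} (hK : ZClosed (OG E) (K : Set E.Gp))
    (hs : ∀ g : G.Gp, ∃ x ∈ K, q.toGpHom x = g) (hf : {x | x ∈ K ∧ q.toGpHom x = 1}.Finite)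
    {𝔤 : Type} [LieRing 𝔤] [LieAlgebra ℂ 𝔤] {η : 𝔤 →ₗ[ℂ] Pt G.n} (hη : IsLieAlgebraOf G 𝔤 η)
    {𝔢 : Type} [LieRing 𝔢] [LieAlgebra ℂ 𝔢] {ε : 𝔢 →ₗ[ℂ] Pt E.n} (hε : IsLieAlgebraOf E 𝔢 ε)
    (dq : 𝔢 →ₗ⁅ℂ⁆ 𝔤) {dq₀ : Pt E.n →ₗ[ℂ] Pt G.n} (hd : IsDerivAtOne q dq₀)
    (hdq : ∀ w, η (dq w) = dq₀ (ε w)) :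
    Function.Bijective (dq.comp (lieSub K hε).incl) := by
  have hKg := (isGrp_OG E).resSub K hK
  let q' : K →* G.Gp := q.toGpHom.comp K.subtype
  have hq' : Reg (res (OG E) K.subtype) (OG G) q' := (reg_toGpHom q).comp (reg_res _ _)
  have hs' : Function.Surjective q' := fun g => by
    obtain ⟨x, hx, h⟩ := hs g
    exact ⟨⟨x, hx⟩, h⟩
  have hfin : Finite q'.ker := by
    have := hf.to_subtype
    refine Finite.of_injective
      (fun x : q'.ker => (⟨x.1.1, x.1.2, x.2⟩ : {x | x ∈ K ∧ q.toGpHom x = 1})) ?_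
    intro x y hxy
    exact Subtype.ext (Subtype.ext (congrArg (fun z => z.1) hxy))
  have hO : ∀ f : K → ℂ, f ∈ res (OG E) K.subtype ↔
      ∃ p : MvPolynomial (Fin E.n) ℂ, ∀ z : K, f z = eval z.1.1 p := mem_res_OG K
  have hOG : ∀ f : G.Gp → ℂ, f ∈ OG G ↔
      ∃ p : MvPolynomial (Fin G.n) ℂ, ∀ z : G.Gp, f z = eval (coords G z) p := fun f => mem_OG
  obtain ⟨P, hP⟩ := q.regular
  have hpb : ∀ i, pbO hq' (polyFun hOG (X i)) = polyFun hO (P i) := by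
    intro i
    ext z
    rw [pbO_apply, polyFun_apply, polyFun_apply, eval_X]
    exact hP z.1.1 z.1.2 i
  have hdir : ∀ w : 𝔢, ∀ i, η (dq w) i = dirD E.one (ε w) (P i) := by
    intro w i
    rw [hdq]
    exact hd P hP _ ((hε.range_eq _).mp ⟨w, rfl⟩) i
  constructor
  · rw [injective_iff_map_eq_zero]
    intro w hw
    obtain ⟨δ, hδ, hδp⟩ := exists_ptDer_of_tangent hO (c := fun z : K => z.1.1) w.2
    have hdw : dq w.1 = 0 := hw
    let δG : OG G →ₗ[ℂ] ℂ := δ ∘ₗ (pbO hq').toLinearMap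
    have hδG : IsPtDer δG := by
      intro a b
      have h2 := hδ (pbO hq' a) (pbO hq' b)
      rw [← map_mul, pbO_apply, pbO_apply, map_one] at h2
      exact h2
    have hzero : ∀ r, δ (pbO hq' r) = 0 := by
      intro r
      obtain ⟨p, rfl⟩ := polyFun_surj hOG r
      have h3 := hδG.apply_polyFun hOG p
      have h4 : (fun i => δG (polyFun hOG (X i))) = 0 := by
        funext i
        change δ (pbO hq' (polyFun hOG (X i))) = 0
        rw [hpb, hδp]
        refine (hdir w.1 i).symm.trans ?_
        rw [hdw, map_zero]
        rfl
      rw [h4, dirD_apply] at h3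
      refine h3.trans ?_
      simp only [Pi.zero_apply, zero_mul, Finset.sum_const_zero]
    have hδ0 := ptDer_eq_zero hKg (isGrp_OG G) (zconn_OG hG) q' hq' hs' hδ hzero
    have hw0 : ε w.1 = 0 := by
      funext i
      have h5 := hδp (X i)
      rw [dirD_X, hδ0] at h5
      exact h5.symm
    exact Subtype.ext (hε.inj (hw0.trans (map_zero ε).symm))
  · intro u
    have hu : η u ∈ tangentAt (Set.range (coords G)) G.one := by
      rw [range_coords]
      exact (hη.range_eq _).mp ⟨u, rfl⟩
    obtain ⟨δ, hδ, hδp⟩ := exists_ptDer_of_tangent hOG (c := coords G) hu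
    obtain ⟨δ', hδ', hc⟩ := exists_ptDer hKg (isGrp_OG G) (zconn_OG hG) q' hq' hs' hδ
    have ht := hδ'.mem_tangentAt hO
    obtain ⟨w, hw⟩ := (hε.range_eq _).mpr (tangentAt_mono (coordSet_subset K) _ ht)
    have hwK : w ∈ lieSub K hε := by
      rw [mem_lieSub, hw]
      exact ht
    refine ⟨⟨w, hwK⟩, hη.inj ?_⟩
    funext i
    refine (hdir w i).trans ?_
    rw [hw]
    refine (hδ'.apply_polyFun hO (P i)).symm.trans ?_
    rw [← hpb, hc, hδp]
    exact dirD_X _ _ i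

lemma exists_lie_splitting (hG : G.IsConnected) (hAs : As.IsTorus) (hρ : ρ.IsTrivial)
    (e : AlgExtension G As ρ)
    {𝔤 : Type} [LieRing 𝔤] [LieAlgebra ℂ 𝔤] {η : 𝔤 →ₗ[ℂ] Pt G.n} (hη : IsLieAlgebraOf G 𝔤 η)
    {𝔢 : Type} [LieRing 𝔢] [LieAlgebra ℂ 𝔢] {ε : 𝔢 →ₗ[ℂ] Pt e.E.n}
    (hε : IsLieAlgebraOf e.E 𝔢 ε) (dq : 𝔢 →ₗ⁅ℂ⁆ 𝔤) {dq₀ : Pt e.E.n →ₗ[ℂ] Pt G.n}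
    (hd : IsDerivAtOne e.q dq₀) (hdq : ∀ w, η (dq w) = dq₀ (ε w)) :
    ∃ s : 𝔤 →ₗ⁅ℂ⁆ 𝔢, ∀ u, dq (s u) = u := by
  let _ := torusCommGroup hAs
  obtain ⟨k, u, h⟩ := exists_torExt hG hAs hρ e
  obtain ⟨K, hK, hs, hf⟩ := h.exists_finCover
  have hb := lieSub_bijective hG e.q hK hs hf hη hε dq hd hdq
  let φ := LieEquiv.ofBijective _ hb
  refine ⟨(lieSub K hε).incl.comp φ.symm.toLieHom, fun u => ?_⟩
  exact φ.apply_symm_apply u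

end LieSplit

end AlgGrp

/-- For a connected algebraic group `G` and a torus `A_s`
with trivial `G`-action:  the map `D : Ext_alg(G, A_s) → Ext(𝔤, 𝔞_s)` sending
an algebraic extension to its Lie algebra extension is zero (every associated
Lie algebra extension splits), and the sequence
`Hom(G̃, A_s) → Hom(Π_G, A_s) → Ext_alg(G, A_s) → 0` is exact, where the first
map is restriction and the second is the pushout map `Φ : γ ↦ γ_* G̃`. -/
theorem torus_extensions_exact_sequence
    (G : AffAlgGroup) (hG : G.IsConnected) (LD : LeviDecomposition G)
    (CD : CoveringData G LD)
    (As : AffAlgGroup) (hAs : As.IsTorus)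
    (ρ : AlgAction G As) (hρ : ρ.IsTrivial) :
    -- (a)  D = 0 : the Lie algebra extension of any extension of `G` by `A_s`
    -- splits (as an extension of Lie algebras)
    (∀ e : AlgExtension G As ρ,
      ∀ (𝔤 : Type) [LieRing 𝔤] [LieAlgebra ℂ 𝔤] (e𝔤 : 𝔤 →ₗ[ℂ] Pt G.n),
        IsLieAlgebraOf G 𝔤 e𝔤 →
      ∀ (𝔢 : Type) [LieRing 𝔢] [LieAlgebra ℂ 𝔢] (e𝔢 : 𝔢 →ₗ[ℂ] Pt e.E.n),
        IsLieAlgebraOf e.E 𝔢 e𝔢 →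
      ∀ dq : 𝔢 →ₗ⁅ℂ⁆ 𝔤,
        (∃ dq₀ : Pt e.E.n →ₗ[ℂ] Pt G.n, IsDerivAtOne e.q dq₀ ∧
          ∀ w : 𝔢, e𝔤 (dq w) = dq₀ (e𝔢 w)) →
        ∃ s : 𝔤 →ₗ⁅ℂ⁆ 𝔢, ∀ u : 𝔤, dq (s u) = u) ∧
    -- (b)  exactness of `Hom(G̃, A_s) → Hom(Π_G, A_s) → Ext_alg(G, A_s) → 0`
    (∀ (Ext : Type) [AddCommGroup Ext] (cm : ExtClassMap G As ρ Ext),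
      (∀ x : Ext, ∃ (γ : ↥CD.PiG →* As.Gp) (e : AlgExtension G As ρ),
        CD.IsPushoutOf γ e ∧ cm.cls e = x) ∧
      (∀ (γ : ↥CD.PiG →* As.Gp) (e : AlgExtension G As ρ), CD.IsPushoutOf γ e →
        (cm.cls e = 0 ↔
          ∃ d : AlgGroupHom CD.Gt As, ∀ x : ↥CD.PiG, d.toFun x.1.1 = (γ x).1))) := by
  refine ⟨fun e 𝔤 _ _ e𝔤 hη 𝔢 _ _ e𝔢 hε dq ⟨dq₀, hd, hdq⟩ =>
    AlgGrp.exists_lie_splitting hG hAs hρ e hη hε dq hd hdq, fun Ext _ cm => ⟨fun x => ?_, ?_⟩⟩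
  · obtain ⟨e, rfl⟩ := cm.surj x
    obtain ⟨γ, hγ⟩ := AlgGrp.exists_pushout CD hG hAs hρ e
    exact ⟨γ, e, hγ, rfl⟩
  · intro γ e hγ
    exact (cm.cls_eq_zero_iff e).trans
      (AlgGrp.splits_iff_of_isPushoutOf CD hG hAs hρ e γ hγ)
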